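/- Cayley–Hamilton–Newton type expansions of the descendants: Let {R,F} be a compatible pair of R-matrices on V = ℂ^N with F strict skew invertible and R skew invertible of BMW type, and let the antisymmetrizers A^(i) be defined for 1 ≤ i ≤ n. Then for 1 ≤ i ≤ n and m ≥ i−2 one has A^(m,i) = (−1)^{i−1} Σ_{j=0}^{i−1} (−q)^j · ( M^{[m+i−j]} + ((1−q^{−2})/(1+μq^{2i−3})) Σ_{r=1}^{i−j−1} M^{[m+i−j−2r]} (q² g)^r ) · a_j, and for 1 ≤ i ≤ n and m ≥ i one has B^(m,i) = (−1)^{i−1} Σ_{j=0}^{i−1} (−q)^j · ( μ^{−1} q^{−2j} M^{[m−i+j]} g^{i−j} − (q^{−1}(1−q^{−2})/(1+μq^{2i−3})) Σ_{r=1}^{i−j−1} M^{[m+i−j−2r]} (q² g)^r ) · a_j, where a_j and g multiply matrix entries on the right. -/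

import Mathlib

open scoped BigOperators
open Matrix

noncomputable section

namespace QMA

/-- The space of operators on `V^{⊗ n}` (matrices indexed by multi-indices),
    with entries in `A`, where `V = ℂ^N`. -/
abbrev MatV (N n : ℕ) (A : Type*) := Matrix (Fin n → Fin N) (Fin n → Fin N) A

variable {N : ℕ} [NeZero N] {A : Type*}

/-- The `j`-th component of a multi-index (junk value if out of range). -/
def idx {n : ℕ} (a : Fin n → Fin N) (j : ℕ) : Fin N :=
  if h : j < n then a ⟨j, h⟩ else ⟨0, Nat.pos_of_ne_zero (NeZero.ne N)⟩

/-- Place a two-factor operator `X` on the (0-indexed) tensor factors `p, p+1`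
    of `V^{⊗ n}`, acting as the identity elsewhere. -/
def lift2 [Semiring A] {n : ℕ} (p : ℕ) (X : MatV N 2 A) : MatV N n A :=
  fun a b =>
    if ∀ m : Fin n, (m : ℕ) = p ∨ (m : ℕ) = p + 1 ∨ a m = b m then
      X ![idx a p, idx a (p + 1)] ![idx b p, idx b (p + 1)]
    else 0

/-- Place a one-factor operator `X` on the (0-indexed) tensor factor `p`
    of `V^{⊗ n}`, acting as the identity elsewhere. -/
def lift1 [Semiring A] {n : ℕ} (p : ℕ) (X : Matrix (Fin N) (Fin N) A) : MatV N n A :=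
  fun a b =>
    if ∀ m : Fin n, (m : ℕ) = p ∨ a m = b m then X (idx a p) (idx b p) else 0

/-- Extend an operator on `V^{⊗ n}` to `V^{⊗ (n+1)}` by the identity on the last factor. -/
def ext1 [Semiring A] {n : ℕ} (X : MatV N n A) : MatV N (n + 1) A :=
  fun a b =>
    if a (Fin.last n) = b (Fin.last n) then X (fun t => a t.castSucc) (fun t => b t.castSucc)
    else 0

/-- The partial trace over the last tensor factor, weighted by the matrix `D`. -/
def ptrace [NonUnitalNonAssocSemiring A] {n : ℕ} (D : Matrix (Fin N) (Fin N) A)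
    (X : MatV N (n + 1) A) : MatV N n A :=
  fun a b => ∑ m : Fin N, ∑ c : Fin N, D m c * X (Fin.snoc a c) (Fin.snoc b m)

/-- The full `D`-weighted trace over all `n` tensor factors. -/
def trAll [NonUnitalNonAssocSemiring A] (D : Matrix (Fin N) (Fin N) A) :
    (n : ℕ) → MatV N n A → A
  | 0, X => X (fun i => i.elim0) (fun i => i.elim0)
  | n + 1, X => trAll D n (ptrace D X)

/-- The `D`-weighted trace over all tensor factors except the first. -/
def trTail [NonUnitalNonAssocSemiring A] (D : Matrix (Fin N) (Fin N) A) :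
    (j : ℕ) → MatV N (j + 1) A → MatV N 1 A
  | 0, X => X
  | j + 1, X => trTail D j (ptrace D X)

/-- Identify operators on `V^{⊗1}` with `N × N` matrices. -/
def toN (X : MatV N 1 A) : Matrix (Fin N) (Fin N) A := fun i j => X (fun _ => i) (fun _ => j)

/-- Entrywise embedding of complex matrices into matrices over a `ℂ`-algebra. -/
def cmap [Ring A] [Algebra ℂ A] {m : Type*} (X : Matrix m m ℂ) : Matrix m m A :=
  X.map (algebraMap ℂ A)

/-- Multiply all entries of a matrix by `c` on the right. -/
def rmulE [Mul A] {m : Type*} (X : Matrix m m A) (c : A) : Matrix m m A := fun a b => X a b * c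

/-- Multiply all entries of a matrix by `c` on the left. -/
def lmulE [Mul A] {m : Type*} (c : A) (X : Matrix m m A) : Matrix m m A := fun a b => c * X a b

/-- The operator `D` associated with a skew inverse `Ψ`: `D_1 = Tr_(2) Ψ₁₂`. -/
def Dof (Ψ : MatV N 2 ℂ) : Matrix (Fin N) (Fin N) ℂ :=
  fun i j => ∑ m : Fin N, Ψ ![i, m] ![j, m]

/-- `Ψ` is a skew inverse of the R-matrix `R`:
    `Tr_(2)(R₁₂ Ψ₂₃) = Tr_(2)(Ψ₁₂ R₂₃) = P₁₃`. -/
def SkewPair (R Ψ : MatV N 2 ℂ) : Prop :=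
  (∀ a1 a3 b1 b3 : Fin N,
      (∑ m : Fin N, ∑ c : Fin N, R ![a1, m] ![b1, c] * Ψ ![c, a3] ![m, b3]) =
        if a1 = b3 ∧ a3 = b1 then 1 else 0) ∧
  (∀ a1 a3 b1 b3 : Fin N,
      (∑ m : Fin N, ∑ c : Fin N, Ψ ![a1, m] ![b1, c] * R ![c, a3] ![m, b3]) =
        if a1 = b3 ∧ a3 = b1 then 1 else 0)

/-- The `q`-number `j_q = (q^j - q^{-j})/(q - q^{-1})`. -/
def nq (q : ℂ) (j : ℕ) : ℂ := (q ^ (j : ℤ) - q ^ (-(j : ℤ))) / (q - q⁻¹)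

/-- The rank-one projector `K = μ⁻¹ (q-q⁻¹)⁻¹ (qI - R)(q⁻¹I + R)` of a BMW-type R-matrix. -/
def bmwK (q μ : ℂ) (R : MatV N 2 ℂ) : MatV N 2 ℂ :=
  (μ⁻¹ * (q - q⁻¹)⁻¹) • ((q • (1 : MatV N 2 ℂ) - R) * (q⁻¹ • (1 : MatV N 2 ℂ) + R))

/-- The braid relation `R₁ R₂ R₁ = R₂ R₁ R₂`. -/
def IsBraid (R : MatV N 2 ℂ) : Prop :=
  lift2 (n := 3) 0 R * lift2 1 R * lift2 0 R = lift2 1 R * lift2 0 R * lift2 1 R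

/-- `R` is an R-matrix of BMW type with eigenvalues `q, -q⁻¹, μ`. -/
def IsBMW (q μ : ℂ) (R : MatV N 2 ℂ) : Prop :=
  (q • (1 : MatV N 2 ℂ) - R) * (q⁻¹ • (1 : MatV N 2 ℂ) + R) * (μ • (1 : MatV N 2 ℂ) - R) = 0 ∧
  lift2 (n := 3) 1 (bmwK q μ R) * lift2 0 (bmwK q μ R) =
      lift2 1 (bmwK q μ R) * lift2 0 R * lift2 1 R ∧
  lift2 (n := 3) 1 (bmwK q μ R) * lift2 0 (bmwK q μ R) =
      lift2 1 (bmwK q μ R) * lift2 0 R⁻¹ * lift2 1 R⁻¹ ∧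
  lift2 (n := 3) 0 (bmwK q μ R) * lift2 1 (bmwK q μ R) * lift2 0 (bmwK q μ R) =
      lift2 0 (bmwK q μ R)

/-- `{R, F}` is a compatible pair of R-matrices (twist relations). -/
def Compatible (R F : MatV N 2 ℂ) : Prop :=
  lift2 (n := 3) 0 R * lift2 1 F * lift2 0 F = lift2 1 F * lift2 0 F * lift2 1 R ∧
  lift2 (n := 3) 1 R * lift2 0 F * lift2 1 F = lift2 0 F * lift2 1 F * lift2 0 R

/-- The antisymmetrizers `A^{(i)} ∈ End(V^{⊗i})` of a BMW-type R-matrix. -/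
def asym (q μ : ℂ) (R : MatV N 2 ℂ) : (i : ℕ) → MatV N i ℂ
  | 0 => 1
  | 1 => 1
  | i + 2 =>
      (q ^ (i + 1) / nq q (i + 2)) •
        (ext1 (asym q μ R (i + 1)) *
          ((1 : MatV N (i + 2) ℂ) +
              ((q ^ (-(2 * ((i : ℤ) + 1))) - 1) / (q - q⁻¹)) • lift2 i R +
              (μ * (q ^ (-(2 * ((i : ℤ) + 1))) - 1) / (μ + q ^ (1 - 2 * ((i : ℤ) + 1)))) •
                lift2 i (bmwK q μ R)) *
          ext1 (asym q μ R (i + 1)))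

/-- The height-`k` cutting condition
    `A^{(k)} σ⁻_k(q^{-2k}) A^{(k)} = 0` in `End(V^{⊗(k+1)})`. -/
def HeightCut (q μ : ℂ) (R : MatV N 2 ℂ) (k : ℕ) : Prop :=
  ext1 (asym q μ R k) *
      ((1 : MatV N (k + 1) ℂ) +
          ((q ^ (-(2 * (k : ℤ))) - 1) / (q - q⁻¹)) • lift2 (k - 1) R +
          (μ * (q ^ (-(2 * (k : ℤ))) - 1) / (μ + q ^ (1 - 2 * (k : ℤ)))) •
            lift2 (k - 1) (bmwK q μ R)) *
      ext1 (asym q μ R k) = 0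

/-- `R` is an R-matrix of height `k`. -/
def HasHeight (q μ : ℂ) (R : MatV N 2 ℂ) (k : ℕ) : Prop :=
  2 ≤ k ∧ (∀ i, 2 ≤ i → i ≤ k → asym q μ R i ≠ 0) ∧ HeightCut q μ R k

section AlgebraSide

variable [Ring A] [Algebra ℂ A]

/-- The copies `M_{(i+1)}` of the quantum matrix inside `V^{⊗n}`:
    `M_{(1)} = M₁`, `M_{(i+1)} = F_i M_{(i)} F_i⁻¹`. -/
def Mcopy {n : ℕ} (F : MatV N 2 ℂ) (M : Matrix (Fin N) (Fin N) A) : ℕ → MatV N n A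
  | 0 => lift1 0 M
  | j + 1 => cmap (lift2 j F) * Mcopy F M j * cmap (lift2 j F⁻¹)

/-- The product `M_{(1)} M_{(2)} ⋯ M_{(j)}`. -/
def Mprod {n : ℕ} (F : MatV N 2 ℂ) (M : Matrix (Fin N) (Fin N) A) : ℕ → MatV N n A
  | 0 => 1
  | j + 1 => Mprod F M j * Mcopy F M j

/-- The product `M_{(2)} M_{(3)} ⋯ M_{(j+1)}`. -/
def MprodFrom2 {n : ℕ} (F : MatV N 2 ℂ) (M : Matrix (Fin N) (Fin N) A) : ℕ → MatV N n A
  | 0 => 1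
  | j + 1 => MprodFrom2 F M j * Mcopy F M (j + 1)

/-- The defining relation `R₁ M_{(1)} M_{(2)} = M_{(1)} M_{(2)} R₁` of the
    quantum matrix algebra `M(R,F)`. -/
def QMArel (R F : MatV N 2 ℂ) (M : Matrix (Fin N) (Fin N) A) : Prop :=
  cmap (lift2 (n := 2) 0 R) * Mcopy F M 0 * Mcopy F M 1 =
    Mcopy F M 0 * Mcopy F M 1 * cmap (lift2 (n := 2) 0 R)

/-- The 2-contraction `g` of the quantum matrix `M`. -/
def gElt (q μ : ℂ) (R F ΨR : MatV N 2 ℂ) (M : Matrix (Fin N) (Fin N) A) : A :=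
  (μ * (q - q⁻¹) / ((q - μ) * (q⁻¹ + μ))) •
    trAll (cmap (Dof ΨR)) 2 (Mprod F M 2 * cmap (lift2 0 (bmwK q μ R)))

/-- The elementary symmetric functions `a_i` of the quantum matrix `M`. -/
def aElt (q μ : ℂ) (R F ΨR : MatV N 2 ℂ) (M : Matrix (Fin N) (Fin N) A) : ℕ → A
  | 0 => 1
  | i + 1 => trAll (cmap (Dof ΨR)) (i + 1) (Mprod F M (i + 1) * cmap (asym q μ R (i + 1)))

/-- The map `φ(X)₁ = Tr_{R(2)}(F₁ X₁ F₁⁻¹ R₁)`. -/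
def phi (R F ΨR : MatV N 2 ℂ) (X : Matrix (Fin N) (Fin N) A) : Matrix (Fin N) (Fin N) A :=
  toN (ptrace (cmap (Dof ΨR))
    (cmap (lift2 (n := 2) 0 F) * lift1 0 X * cmap (lift2 (n := 2) 0 F⁻¹) *
      cmap (lift2 (n := 2) 0 R)))

/-- The map `ξ(X)₁ = Tr_{R(2)}(F₁ X₁ F₁⁻¹ K₁)`. -/
def xi (q μ : ℂ) (R F ΨR : MatV N 2 ℂ) (X : Matrix (Fin N) (Fin N) A) :
    Matrix (Fin N) (Fin N) A :=
  toN (ptrace (cmap (Dof ΨR))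
    (cmap (lift2 (n := 2) 0 F) * lift1 0 X * cmap (lift2 (n := 2) 0 F⁻¹) *
      cmap (lift2 (n := 2) 0 (bmwK q μ R))))

/-- The map `φ⁻¹(X)₁ = μ⁻² Tr_{R_f(2)}(F₁⁻¹ X₁ R₁⁻¹ F₁)`,
    where the `R_f`-trace has weight `D_{F⁻¹} (D_{R⁻¹})⁻¹ D_F`. -/
def phiInv (μ : ℂ) (R F ΨF ΨFinv ΨRinv : MatV N 2 ℂ) (X : Matrix (Fin N) (Fin N) A) :
    Matrix (Fin N) (Fin N) A :=
  (μ⁻¹) ^ 2 •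
    toN (ptrace (cmap (Dof ΨFinv * (Dof ΨRinv)⁻¹ * Dof ΨF))
      (cmap (lift2 (n := 2) 0 F⁻¹) * lift1 0 X * cmap (lift2 (n := 2) 0 R⁻¹) *
        cmap (lift2 (n := 2) 0 F)))

/-- Star-multiplication by `M`: `L(X) = M ⋆ X = M · φ(X)`. -/
def Lmap (R F ΨR : MatV N 2 ℂ) (M X : Matrix (Fin N) (Fin N) A) : Matrix (Fin N) (Fin N) A :=
  M * phi R F ΨR X

/-- The star-powers `M^{[n]}` of the quantum matrix. -/
def starPow (R F ΨR : MatV N 2 ℂ) (M : Matrix (Fin N) (Fin N) A) : ℕ → Matrix (Fin N) (Fin N) A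
  | 0 => 1
  | n + 1 => M * phi R F ΨR (starPow R F ΨR M n)

/-- The wedge powers `M^{a^{(i)}} = Tr_{R(2,…,i)}(M_{(1)} ⋯ M_{(i)} A^{(i)})`. -/
def Mwedge (q μ : ℂ) (R F ΨR : MatV N 2 ℂ) (M : Matrix (Fin N) (Fin N) A) :
    ℕ → Matrix (Fin N) (Fin N) A
  | 0 => 1
  | i + 1 => toN (trTail (cmap (Dof ΨR)) i (Mprod F M (i + 1) * cmap (asym q μ R (i + 1))))

/-- The descendants `A^{(m,i)} = i_q · M^{[m]} ⋆ M^{a^{(i)}}` (here `m ≥ 0`). -/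
def Ad (q μ : ℂ) (R F ΨR : MatV N 2 ℂ) (M : Matrix (Fin N) (Fin N) A) (m i : ℕ) :
    Matrix (Fin N) (Fin N) A :=
  nq q i • (Lmap R F ΨR M)^[m] (Mwedge q μ R F ΨR M i)

/-- The descendants `B^{(m,i)}`, including the boundary value
    `B^{(0,i)} = i_q φ⁻¹(ξ(M^{a^{(i)}}))`. -/
def Bd (q μ : ℂ) (R F ΨR ΨF ΨFinv ΨRinv : MatV N 2 ℂ) (M : Matrix (Fin N) (Fin N) A) :
    ℕ → ℕ → Matrix (Fin N) (Fin N) A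
  | 0, i => nq q i • phiInv μ R F ΨF ΨFinv ΨRinv (xi q μ R F ΨR (Mwedge q μ R F ΨR M i))
  | m + 1, i => nq q i • (Lmap R F ΨR M)^[m] (M * xi q μ R F ΨR (Mwedge q μ R F ΨR M i))

/-- The boundary descendant
    `A^{(-1,i)} = i_q φ⁻¹(Tr_{R(2,…,i)}(M_{(2)} ⋯ M_{(i)} A^{(i)}))`. -/
def Aneg1 (q μ : ℂ) (R F ΨR ΨF ΨFinv ΨRinv : MatV N 2 ℂ) (M : Matrix (Fin N) (Fin N) A) :
    ℕ → Matrix (Fin N) (Fin N) A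
  | 0 => 0
  | i + 1 =>
      nq q (i + 1) •
        phiInv μ R F ΨF ΨFinv ΨRinv
          (toN (trTail (cmap (Dof ΨR)) i (MprodFrom2 F M i * cmap (asym q μ R (i + 1)))))

/-- The shifted family `AdS m i = A^{(m-1,i)}` (so that `AdS 0 i = A^{(-1,i)}`). -/
def AdS (q μ : ℂ) (R F ΨR ΨF ΨFinv ΨRinv : MatV N 2 ℂ) (M : Matrix (Fin N) (Fin N) A) :
    ℕ → ℕ → Matrix (Fin N) (Fin N) A
  | 0, i => Aneg1 q μ R F ΨR ΨF ΨFinv ΨRinv M i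
  | m + 1, i => Ad q μ R F ΨR M m i

/-- The coefficients `ε_i` of the symplectic Cayley-Hamilton identity. -/
def eps (q μ : ℂ) (R F ΨR : MatV N 2 ℂ) (M : Matrix (Fin N) (Fin N) A) (k i : ℕ) : A :=
  if i ≤ k then
    ∑ j ∈ Finset.range (i / 2 + 1), aElt q μ R F ΨR M (i - 2 * j) * gElt q μ R F ΨR M ^ j
  else
    (∑ j ∈ Finset.range ((2 * k - i) / 2 + 1),
        aElt q μ R F ΨR M (2 * k - i - 2 * j) * gElt q μ R F ΨR M ^ j) *
      gElt q μ R F ΨR M ^ (i - k)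

/-- The map `π(X)₁ = Tr_{R(2)}(R₁ X₁ K₁)`. -/
def piMap (q μ : ℂ) (R ΨR : MatV N 2 ℂ) (X : Matrix (Fin N) (Fin N) A) :
    Matrix (Fin N) (Fin N) A :=
  toN (ptrace (cmap (Dof ΨR))
    (cmap (lift2 (n := 2) 0 R) * lift1 0 X * cmap (lift2 (n := 2) 0 (bmwK q μ R))))

end AlgebraSide

/-- The matrix `G₁ = Tr_(2,3)(K₂ F₁⁻¹ F₂⁻¹)`. -/
def Gmat (q μ : ℂ) (R F : MatV N 2 ℂ) : Matrix (Fin N) (Fin N) ℂ :=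
  toN (trTail (1 : Matrix (Fin N) (Fin N) ℂ) 2
    (lift2 (n := 3) 1 (bmwK q μ R) * lift2 0 F⁻¹ * lift2 1 F⁻¹))

end QMA

end

noncomputable section

namespace QMA

section

variable {S : Type*} [Ring S] [Algebra ℂ S]

/-- The defining relations of the Birman–Murakami–Wenzl algebra on three strands, for the braid
generators `r, s`, their inverses `r', s'` and the contractions `k, l`. -/
structure BMWPair (q μ : ℂ) (r s r' s' k l : S) : Prop where
  r_mul_inv : r * r' = 1
  inv_mul_r : r' * r = 1
  s_mul_inv : s * s' = 1
  inv_mul_s : s' * s = 1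
  k_eq : k = (μ⁻¹ * (q - q⁻¹)⁻¹) • ((q • (1 : S) - r) * (q⁻¹ • (1 : S) + r))
  l_eq : l = (μ⁻¹ * (q - q⁻¹)⁻¹) • ((q • (1 : S) - s) * (q⁻¹ • (1 : S) + s))
  rk : r * k = μ • k
  kr : k * r = μ • k
  sl : s * l = μ • l
  ls : l * s = μ • l
  skein_r : r' = r - (q - q⁻¹) • (1 : S) + (q - q⁻¹) • k
  skein_s : s' = s - (q - q⁻¹) • (1 : S) + (q - q⁻¹) • l
  braid : r * s * r = s * r * s
  klk : k * l * k = k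
  lkl : l * k * l = l
  ksr : k * s * r = k * l
  srl : s * r * l = k * l
  lrs : l * r * s = l * k
  rsk : r * s * k = l * k
  ksr' : k * s' * r' = k * l
  srl' : s' * r' * l = k * l
  lrs' : l * r' * s' = l * k
  rsk' : r' * s' * k = l * k

section Cubic

variable {q μ : ℂ} {r r' k : S}

private theorem quad_comm :
    (q • (1 : S) - r) * (q⁻¹ • (1 : S) + r) * r = r * ((q • (1 : S) - r) * (q⁻¹ • (1 : S) + r)) := by
  simp only [mul_add, add_mul, sub_mul, mul_sub, smul_mul_assoc, mul_smul_comm, one_mul, mul_one,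
    mul_assoc]

theorem contraction_mul_self
    (hk : k = (μ⁻¹ * (q - q⁻¹)⁻¹) • ((q • (1 : S) - r) * (q⁻¹ • (1 : S) + r)))
    (hc : (q • (1 : S) - r) * (q⁻¹ • (1 : S) + r) * (μ • (1 : S) - r) = 0) : k * r = μ • k := by
  rw [mul_sub, mul_smul_comm, mul_one, sub_eq_zero] at hc
  rw [hk, smul_mul_assoc, ← hc, smul_comm]

theorem self_mul_contraction
    (hk : k = (μ⁻¹ * (q - q⁻¹)⁻¹) • ((q • (1 : S) - r) * (q⁻¹ • (1 : S) + r)))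
    (hc : (q • (1 : S) - r) * (q⁻¹ • (1 : S) + r) * (μ • (1 : S) - r) = 0) : r * k = μ • k := by
  rw [← contraction_mul_self hk hc, hk, smul_mul_assoc, mul_smul_comm, quad_comm]

theorem inv_eq_skein (hq : q ≠ 0) (hl : q - q⁻¹ ≠ 0) (hμ : μ ≠ 0)
    (hk : k = (μ⁻¹ * (q - q⁻¹)⁻¹) • ((q • (1 : S) - r) * (q⁻¹ • (1 : S) + r)))
    (hkr : k * r = μ • k) (h1 : r * r' = 1) :
    r' = r - (q - q⁻¹) • (1 : S) + (q - q⁻¹) • k := by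
  have h2 : r * r = 1 + (q - q⁻¹) • r - (μ * (q - q⁻¹)) • k := by
    have : (μ * (q - q⁻¹)) • k = (q • (1 : S) - r) * (q⁻¹ • (1 : S) + r) := by
      rw [hk, smul_smul]
      have : μ * (q - q⁻¹) * (μ⁻¹ * (q - q⁻¹)⁻¹) = 1 := by
        rw [mul_mul_mul_comm, mul_inv_cancel₀ hμ, mul_inv_cancel₀ hl, one_mul]
      rw [this, one_smul]
    rw [this]
    simp only [mul_add, sub_mul, smul_mul_assoc, mul_smul_comm, one_mul, mul_one, smul_sub,
      smul_smul, inv_mul_cancel₀ hq]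
    module
  have h3 : (r - (q - q⁻¹) • (1 : S) + (q - q⁻¹) • k) * r = 1 := by
    rw [add_mul, sub_mul, h2, smul_mul_assoc, one_mul, smul_mul_assoc, hkr]
    module
  calc r' = ((r - (q - q⁻¹) • (1 : S) + (q - q⁻¹) • k) * r) * r' := by rw [h3, one_mul]
    _ = _ := by rw [mul_assoc, h1, mul_one]

end Cubic

theorem comm_poly {q μ : ℂ} {r s k l u : S}
    (hk : k = (μ⁻¹ * (q - q⁻¹)⁻¹) • ((q • (1 : S) - r) * (q⁻¹ • (1 : S) + r)))
    (hl : l = (μ⁻¹ * (q - q⁻¹)⁻¹) • ((q • (1 : S) - s) * (q⁻¹ • (1 : S) + s)))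
    (h : u * r = s * u) : u * k = l * u := by
  have h2 : u * (q • (1 : S) - r) = (q • (1 : S) - s) * u := by
    simp [mul_sub, sub_mul, h]
  have h3 : u * (q⁻¹ • (1 : S) + r) = (q⁻¹ • (1 : S) + s) * u := by
    simp [mul_add, add_mul, h]
  rw [hk, hl, mul_smul_comm, smul_mul_assoc, ← mul_assoc, h2, mul_assoc, h3, mul_assoc]

theorem braid_conj {r s r' s' : S} (h1 : r * r' = 1) (h2 : r' * r = 1) (h3 : s * s' = 1)
    (h4 : s' * s = 1) (hb : r * s * r = s * r * s) : s * (r' * s') = r' * s' * r := by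
  have e1 : s' * r * s = r * s * r' := by
    calc s' * r * s = s' * (r * s * r) * r' := by
          rw [mul_assoc s', mul_assoc s', mul_assoc (r * s), h1, mul_one]
      _ = s' * s * (r * s * r') := by rw [hb]; simp only [mul_assoc]
      _ = r * s * r' := by rw [h4, one_mul]
  calc s * (r' * s') = r' * (r * s * r') * s' := by
        rw [mul_assoc r, ← mul_assoc r', h2, one_mul, mul_assoc]
    _ = r' * (s' * r * (s * s')) := by rw [← e1]; simp only [mul_assoc]
    _ = r' * s' * r := by rw [h3, mul_one, ← mul_assoc]

/-- The full list of relations follows from the ones defining an R-matrix of BMW type. -/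
theorem BMWPair.of_relations {q μ : ℂ} (hq : q ≠ 0) (hl0 : q - q⁻¹ ≠ 0) (hμ : μ ≠ 0)
    {r s r' s' k l : S} (h1 : r * r' = 1) (h2 : r' * r = 1) (h3 : s * s' = 1) (h4 : s' * s = 1)
    (hk : k = (μ⁻¹ * (q - q⁻¹)⁻¹) • ((q • (1 : S) - r) * (q⁻¹ • (1 : S) + r)))
    (hl : l = (μ⁻¹ * (q - q⁻¹)⁻¹) • ((q • (1 : S) - s) * (q⁻¹ • (1 : S) + s)))
    (hcr : (q • (1 : S) - r) * (q⁻¹ • (1 : S) + r) * (μ • (1 : S) - r) = 0)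
    (hcs : (q • (1 : S) - s) * (q⁻¹ • (1 : S) + s) * (μ • (1 : S) - s) = 0)
    (hb : r * s * r = s * r * s) (hlk : l * k = l * r * s) (hlk' : l * k = l * r' * s')
    (hklk : k * l * k = k) : BMWPair q μ r s r' s' k l := by
  have hkr := contraction_mul_self hk hcr
  have hls := contraction_mul_self hl hcs
  have hrsk : r * s * k = l * (r * s) := comm_poly hk hl (by rw [hb, mul_assoc])
  have hrsk2 : r' * s' * k = l * (r' * s') :=
    comm_poly hk hl (braid_conj h1 h2 h3 h4 hb).symm
  set u := r * s * r with hu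
  set u' := r' * s' * r' with hu'
  have huu : u * u' = 1 := by
    rw [hu, hu']
    calc r * s * r * (r' * s' * r') = r * (s * (r * r') * s') * r' := by simp only [mul_assoc]
      _ = 1 := by rw [h1, mul_one, h3, mul_one, h1]
  have huu' : u' * u = 1 := by
    rw [hu, hu']
    calc r' * s' * r' * (r * s * r) = r' * (s' * (r' * r) * s) * r := by simp only [mul_assoc]
      _ = 1 := by rw [h2, mul_one, h4, mul_one, h2]
  have hur : u * r = s * u := by
    calc u * r = s * r * s * r := by rw [hb]
      _ = s * u := by rw [hu]; simp only [mul_assoc]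
  have hus : u * s = r * u := by
    calc u * s = r * (s * r * s) := by rw [hu]; simp only [mul_assoc]
      _ = r * u := by rw [← hb]
  have huk : u * k = l * u := comm_poly hk hl hur
  have hul : u * l = k * u := comm_poly hl hk hus
  have inv_conj : ∀ {x x' y y' : S}, x * x' = 1 → y' * y = 1 → u * x = y * u → u * x' = y' * u := by
    intro x x' y y' hx hy h
    calc u * x' = y' * y * (u * x') := by rw [hy, one_mul]
      _ = y' * (u * x) * x' := by rw [h]; simp only [mul_assoc]
      _ = y' * u := by rw [mul_assoc, mul_assoc, hx, mul_one]
  have hur' : u * r' = s' * u := inv_conj h1 h4 hur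
  have hus' : u * s' = r' * u := inv_conj h3 h2 hus
  have cancel : ∀ {x y : S}, u * x = u * y → x = y := by
    intro x y h
    rw [← one_mul x, ← huu', mul_assoc, h, ← mul_assoc, huu', one_mul]
  have m2 : ∀ {a b c d : S}, u * a = c * u → u * b = d * u → u * (a * b) = c * d * u := by
    intro a b c d h h'
    rw [← mul_assoc, h, mul_assoc, h', mul_assoc]
  have rcancel : ∀ {x y : S}, x * u = y * u → x = y := by
    intro x y h
    rw [← mul_one x, ← huu, ← mul_assoc, h, mul_assoc, huu, mul_one]
  have trans : ∀ {a b c d : S}, u * a = c * u → u * b = d * u → a = b → c = d := by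
    intro a b c d h h' e
    exact rcancel (by rw [← h, ← h', e])
  refine
    { r_mul_inv := h1, inv_mul_r := h2, s_mul_inv := h3, inv_mul_s := h4, k_eq := hk, l_eq := hl
      rk := self_mul_contraction hk hcr
      kr := hkr
      sl := self_mul_contraction hl hcs
      ls := hls
      skein_r := inv_eq_skein hq hl0 hμ hk hkr h1
      skein_s := inv_eq_skein hq hl0 hμ hl hls h3
      braid := hb
      klk := hklk
      lkl := trans (m2 (m2 huk hul) huk) huk hklk
      ksr := (trans (m2 hul huk) (m2 (m2 hul hur) hus) hlk).symm
      srl := (trans (m2 (m2 hur hus) huk) (m2 hul huk) (by rw [hrsk, ← mul_assoc, hlk]))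
      lrs := hlk.symm
      rsk := by rw [hrsk, ← mul_assoc, hlk]
      ksr' := (trans (m2 hul huk) (m2 (m2 hul hur') hus') hlk').symm
      srl' := (trans (m2 (m2 hur' hus') huk) (m2 hul huk) (by rw [hrsk2, ← mul_assoc, hlk']))
      lrs' := hlk'.symm
      rsk' := by rw [hrsk2, ← mul_assoc, hlk'] }

theorem BMWPair.symm {q μ : ℂ} {r s r' s' k l : S} (h : BMWPair q μ r s r' s' k l) :
    BMWPair q μ s r s' r' l k where
  r_mul_inv := h.s_mul_inv
  inv_mul_r := h.inv_mul_s
  s_mul_inv := h.r_mul_inv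
  inv_mul_s := h.inv_mul_r
  k_eq := h.l_eq
  l_eq := h.k_eq
  rk := h.sl
  kr := h.ls
  sl := h.rk
  ls := h.kr
  skein_r := h.skein_s
  skein_s := h.skein_r
  braid := h.braid.symm
  klk := h.lkl
  lkl := h.klk
  ksr := h.lrs
  srl := h.rsk
  lrs := h.ksr
  rsk := h.srl
  ksr' := h.lrs'
  srl' := h.rsk'
  lrs' := h.ksr'
  rsk' := h.srl'

end

section

section Words
variable {S : Type*} [Ring S] [Algebra ℂ S] {q μ : ℂ} {r s r' s' k l : S}

namespace BMWPair

variable (h : BMWPair q μ r s r' s' k l)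
include h

theorem rr : r * r = 1 + (q - q⁻¹) • r - ((q - q⁻¹) * μ) • k := by
  have := h.r_mul_inv
  rw [h.skein_r, mul_add, mul_sub, mul_smul_comm, mul_smul_comm, mul_one, h.rk, smul_smul] at this
  rw [← this]; abel

theorem kk : k * k = ((q - μ) * (q⁻¹ + μ) * (μ⁻¹ * (q - q⁻¹)⁻¹)) • k := by
  nth_rw 2 [h.k_eq]
  rw [mul_smul_comm, ← mul_assoc, mul_sub, h.kr, mul_smul_comm, mul_one, ← sub_smul,
    smul_mul_assoc, mul_add, h.kr, mul_smul_comm, mul_one, ← add_smul, smul_smul, smul_smul]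
  congr 1; ring

theorem ksk (hμ : μ ≠ 0) : k * s * k = μ⁻¹ • k := by
  have : μ • (k * s * k) = k := by
    rw [← mul_smul_comm, ← h.rk, ← mul_assoc, h.ksr, h.klk]
  rw [← this, smul_smul, this, inv_mul_cancel₀ hμ, one_smul]

theorem rlk : r * l * k = s' * k := by
  rw [mul_assoc, ← h.rsk', ← mul_assoc, ← mul_assoc, h.r_mul_inv, one_mul]

theorem inv_rlk : r' * l * k = s * k := by
  rw [mul_assoc, ← h.rsk, ← mul_assoc, ← mul_assoc, h.inv_mul_r, one_mul]

theorem klr : k * l * r = k * s' := by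
  rw [← h.ksr', mul_assoc, h.inv_mul_r, mul_one]

theorem skl : s * k * l = r' * l := by
  rw [mul_assoc, ← h.srl', ← mul_assoc, ← mul_assoc, h.s_mul_inv, one_mul]

theorem lks : l * k * s = l * r' := by
  rw [← h.lrs', mul_assoc, h.inv_mul_s, mul_one]

theorem sks_inv : s * k * s' = r' * l * r := by
  have e : r * (s * k) = l * r * s := by rw [← mul_assoc, h.rsk, h.lrs]
  rw [← one_mul (s * k), ← h.inv_mul_r, mul_assoc r', e]
  simp only [mul_assoc]
  rw [h.s_mul_inv, mul_one]

theorem sks : s * k * s = r' * l * r' := by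
  have e : s = s' + (q - q⁻¹) • (1 : S) - (q - q⁻¹) • l := by rw [h.skein_s]; abel
  have e2 : s * k * s = s * k * s' + (q - q⁻¹) • (s * k) - (q - q⁻¹) • (s * k * l) := by
    nth_rw 2 [e]
    rw [mul_sub, mul_add, mul_smul_comm, mul_smul_comm, mul_one]
  have e3 : r' * l * r' = r' * l * (r - (q - q⁻¹) • (1 : S) + (q - q⁻¹) • k) := by
    rw [← h.skein_r]
  rw [e2, e3, h.sks_inv, h.skl, ← h.inv_rlk, mul_add, mul_sub, mul_smul_comm, mul_smul_comm, mul_one]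
  abel

end BMWPair

/-- The baxterized generator with spectral parameter `x`. -/
def baxt (q μ : ℂ) (r k : S) (x : ℂ) : S :=
  1 + ((x - 1) / (q - q⁻¹)) • r + (μ * (x - 1) / (μ + q * x)) • k

theorem BMWPair.yang_baxter (h : BMWPair q μ r s r' s' k l) (hq : q ≠ 0) (hl : q - q⁻¹ ≠ 0)
    (hμ : μ ≠ 0) {x y : ℂ} (hx : μ + q * x ≠ 0) (hy : μ + q * y ≠ 0) (hxy : μ + q * (x * y) ≠ 0) :
    baxt q μ r k x * baxt q μ s l (x * y) * baxt q μ r k y =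
      baxt q μ s l y * baxt q μ r k (x * y) * baxt q μ s l x := by
  have h' := h.symm
  have rlk := h.rlk
  have klr := h.klr
  have skl := h.skl
  have lks := h.lks
  have sks := h.sks
  have rlk2 : r * l * k = s * k - (q - q⁻¹) • k + (q - q⁻¹) • (l * k) := by
    rw [rlk, h.skein_s]; simp [add_mul, sub_mul]
  have klr2 : k * l * r = k * s - (q - q⁻¹) • k + (q - q⁻¹) • (k * l) := by
    rw [klr, h.skein_s]; simp [mul_add, mul_sub]
  have skl2 : s * k * l = r * l - (q - q⁻¹) • l + (q - q⁻¹) • (k * l) := by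
    rw [skl, h.skein_r]; simp [add_mul, sub_mul]
  have lks2 : l * k * s = l * r - (q - q⁻¹) • l + (q - q⁻¹) • (l * k) := by
    rw [lks, h.skein_r]; simp [mul_add, mul_sub]
  have sks2 : s * k * s = r * l * r - (q - q⁻¹) • (r * l) + (q - q⁻¹) • (r * l * k)
      - (q - q⁻¹) • (l * r) + ((q - q⁻¹) * (q - q⁻¹)) • l - ((q - q⁻¹) * (q - q⁻¹)) • (l * k)
      + (q - q⁻¹) • (k * l * r) - ((q - q⁻¹) * (q - q⁻¹)) • (k * l)
      + ((q - q⁻¹) * (q - q⁻¹)) • (k * l * k) := by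
    rw [sks, h.skein_r]
    simp only [mul_add, mul_sub, add_mul, sub_mul, mul_smul_comm, smul_mul_assoc, smul_smul,
      mul_one, one_mul, smul_add, smul_sub]
    abel
  rw [rlk2, klr2, h.klk] at sks2
  unfold baxt
  generalize ha1 : (x - 1) / (q - q⁻¹) = a1
  generalize ha2 : (y - 1) / (q - q⁻¹) = a2
  generalize ha3 : (x * y - 1) / (q - q⁻¹) = a3
  generalize hb1 : μ * (x - 1) / (μ + q * x) = b1
  generalize hb2 : μ * (y - 1) / (μ + q * y) = b2
  generalize hb3 : μ * (x * y - 1) / (μ + q * (x * y)) = b3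
  simp only [mul_add, add_mul, mul_smul_comm, smul_mul_assoc, smul_smul, mul_one, one_mul,
    h.braid, h.rsk, h.ksr, h.ksk hμ, klr2, rlk2, h.klk, h.rr, h'.rr, h.rk, h.kr, h.sl, h.ls,
    h.kk, h'.kk, h.srl, h.lrs, h'.ksk hμ, skl2, lks2, h.lkl, sks2, smul_add, smul_sub]
  subst ha1 ha2 ha3 hb1 hb2 hb3
  match_scalars
  all_goals
    clear rlk klr skl lks sks rlk2 klr2 skl2 lks2 sks2 h h'
    have hq2 : q ^ 2 - 1 ≠ 0 := by
      intro e; apply hl; field_simp; linear_combination e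
    have hx' : μ + x * q ≠ 0 := by rwa [mul_comm x]
    have hy' : μ + y * q ≠ 0 := by rwa [mul_comm y]
    have hxy1 : μ + q * x * y ≠ 0 := by rwa [mul_assoc]
    have hxy2 : μ + x * q * y ≠ 0 := by rwa [mul_comm x]
    have hxy3 : μ + x * y * q ≠ 0 := by rwa [mul_comm _ q]
    have hxy4 : μ + y * x * q ≠ 0 := by rwa [mul_comm y]
    have hxy5 : μ + y * q * x ≠ 0 := by rwa [mul_comm, ← mul_assoc, mul_comm _ q]
    have hxy6 : μ + q * y * x ≠ 0 := by rwa [mul_comm q]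
    have hl2 : q - q⁻¹ = (q ^ 2 - 1) / q := by field_simp
    rw [hl2]
    try field_simp
    try ring
end Words

end

section

/-- A system of operators `r p, f p, k p` on strands `p, p + 1` of an infinite tensor power,
together with the quantum partial traces `E p` over strand `p`; `off p` consists of the elements
acting trivially on strand `p`. -/
structure Tower (q μ : ℂ) (S : Type*) [Ring S] [Algebra ℂ S] where
  off : ℕ → Subalgebra ℂ S
  r : ℕ → S
  r' : ℕ → S
  f : ℕ → S
  f' : ℕ → S
  k : ℕ → S
  E : ℕ → S →ₗ[ℂ] S
  r_off : ∀ {p t}, t ≠ p → t ≠ p + 1 → r p ∈ off t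
  r'_off : ∀ {p t}, t ≠ p → t ≠ p + 1 → r' p ∈ off t
  f_off : ∀ {p t}, t ≠ p → t ≠ p + 1 → f p ∈ off t
  f'_off : ∀ {p t}, t ≠ p → t ≠ p + 1 → f' p ∈ off t
  r_comm : ∀ {p x}, x ∈ off p → x ∈ off (p + 1) → Commute (r p) x
  f_comm : ∀ {p x}, x ∈ off p → x ∈ off (p + 1) → Commute (f p) x
  E_off_self : ∀ p x, E p x ∈ off p
  E_off : ∀ {p t x}, x ∈ off t → E p x ∈ off t
  E_mul_left : ∀ {p y} x, y ∈ off p → E p (y * x) = y * E p x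
  E_mul_right : ∀ {p y} x, y ∈ off p → E p (x * y) = E p x * y
  bmw : ∀ p, BMWPair q μ (r p) (r (p + 1)) (r' p) (r' (p + 1)) (k p) (k (p + 1))
  f_mul_inv : ∀ p, f p * f' p = 1
  inv_mul_f : ∀ p, f' p * f p = 1
  f_braid : ∀ p, f p * f (p + 1) * f p = f (p + 1) * f p * f (p + 1)
  twist : ∀ p, r p * f (p + 1) * f p = f (p + 1) * f p * r (p + 1)
  twist' : ∀ p, r (p + 1) * f p * f (p + 1) = f p * f (p + 1) * r p
  E_r : ∀ p, E (p + 1) (r p) = 1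
  E_cyclic : ∀ p y, E p (E (p + 1) (r p * y)) = E p (E (p + 1) (y * r p))
  E_conj_r : ∀ {p x}, x ∈ off (p + 1) → E (p + 1) (r p * x * r' p) = E p x
  E_conj_f : ∀ {p x}, x ∈ off (p + 1) → E (p + 1) (f p * x * f' p) = E p x
  k_sandwich : ∀ p y, k p * y * k p = (μ⁻¹ * μ⁻¹) • (E p (E (p + 1) (y * k p)) * k p)
  k_or : (∀ p, k p = 0) ∨ ∀ p, E (p + 1) (k p) = μ • (1 : S)

theorem commute_of_inv {S : Type*} [Monoid S] {v v' x : S} (h1 : v * v' = 1) (h2 : v' * v = 1)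
    (h : Commute v x) : Commute v' x := by
  have : v' * (v * x) * v' = v' * (x * v) * v' := by rw [h.eq]
  rw [← mul_assoc, h2, one_mul, mul_assoc, mul_assoc, h1, mul_one] at this
  exact this.symm

theorem conj_inv {S : Type*} [Monoid S] {v v' x y : S} (h1 : v * v' = 1) (h2 : v' * v = 1)
    (h : v * x = y * v) : x * v' = v' * y := by
  calc x * v' = v' * (v * x) * v' := by rw [← mul_assoc, h2, one_mul]
    _ = v' * y * (v * v') := by rw [h]; simp only [mul_assoc]
    _ = v' * y := by rw [h1, mul_one]

/-- The ordered product `v a * v (a + 1) * ⋯ * v (a + l - 1)`. -/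
def wordUp {S : Type*} [Monoid S] (v : ℕ → S) (a : ℕ) : ℕ → S
  | 0 => 1
  | l + 1 => wordUp v a l * v (a + l)

/-- The ordered product `v (a + l - 1) * ⋯ * v (a + 1) * v a`. -/
def wordDown {S : Type*} [Monoid S] (v : ℕ → S) (a : ℕ) : ℕ → S
  | 0 => 1
  | l + 1 => v (a + l) * wordDown v a l

section Word
variable {S : Type*} [Monoid S] {v v' : ℕ → S}

theorem wordUp_succ (v : ℕ → S) (a l : ℕ) : wordUp v a (l + 1) = v a * wordUp v (a + 1) l := by
  induction l with
  | zero => simp [wordUp]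
  | succ l ih => rw [wordUp, ih, wordUp, mul_assoc, add_right_comm a 1 l, ← add_assoc]

theorem wordUp_mul_wordDown (h : ∀ p, v p * v' p = 1) (a l : ℕ) :
    wordUp v a l * wordDown v' a l = 1 := by
  induction l with
  | zero => simp [wordUp, wordDown]
  | succ l ih =>
    rw [wordUp, wordDown, mul_assoc, ← mul_assoc (v _), h, one_mul, ih]

theorem wordDown_mul_wordUp (h : ∀ p, v' p * v p = 1) (a l : ℕ) :
    wordDown v' a l * wordUp v a l = 1 := by
  induction l with
  | zero => simp [wordUp, wordDown]
  | succ l ih =>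
    rw [wordUp, wordDown, mul_assoc, ← mul_assoc (wordDown v' a l), ih, one_mul, h]

theorem wordUp_induction {p : S → Prop} (h1 : p 1) (hm : ∀ x y, p x → p y → p (x * y)) (a l : ℕ)
    (h : ∀ j, a ≤ j → j < a + l → p (v j)) : p (wordUp v a l) := by
  induction l with
  | zero => exact h1
  | succ l ih =>
    exact hm _ _ (ih fun j h1 h2 => h j h1 (by omega)) (h _ (by omega) (by omega))

theorem wordDown_induction {p : S → Prop} (h1 : p 1) (hm : ∀ x y, p x → p y → p (x * y))
    (a l : ℕ) (h : ∀ j, a ≤ j → j < a + l → p (v j)) : p (wordDown v a l) := by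
  induction l with
  | zero => exact h1
  | succ l ih =>
    exact hm _ _ (h _ (by omega) (by omega)) (ih fun j h1 h2 => h j h1 (by omega))

theorem wordUp_commute {x : S} (a l : ℕ) (h : ∀ j, a ≤ j → j < a + l → Commute (v j) x) :
    Commute (wordUp v a l) x :=
  wordUp_induction (p := fun y => Commute y x) (Commute.one_left x)
    (fun _ _ h1 h2 => h1.mul_left h2) a l h

theorem wordDown_commute {x : S} (a l : ℕ) (h : ∀ j, a ≤ j → j < a + l → Commute (v j) x) :
    Commute (wordDown v a l) x :=
  wordDown_induction (p := fun y => Commute y x) (Commute.one_left x)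
    (fun _ _ h1 h2 => h1.mul_left h2) a l h

/-- A product of neighbours shifts the index of an intertwined family. -/
theorem wordUp_shift {w : ℕ → S} (hs : ∀ p, w (p + 1) * v p * v (p + 1) = v p * v (p + 1) * w p)
    (hlt : ∀ p t, t + 2 ≤ p → Commute (v t) (w p)) (hgt : ∀ p t, p + 2 ≤ t → Commute (v t) (w p))
    (a l j : ℕ) (hj : j < l) :
    wordUp v a (l + 1) * w (a + j) = w (a + j + 1) * wordUp v a (l + 1) := by
  induction l with
  | zero => omega
  | succ l ih =>
    rcases Nat.lt_succ_iff_lt_or_eq.1 hj with h | rfl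
    · rw [wordUp, mul_assoc, (hgt (a + j) (a + (l + 1)) (by omega)).eq, ← mul_assoc, ih h, mul_assoc]
    · have e : wordUp v a (j + 1 + 1) = wordUp v a j * (v (a + j) * v (a + j + 1)) := by
        rw [wordUp, wordUp, mul_assoc, ← add_assoc]
      have c : Commute (wordUp v a j) (w (a + j + 1)) :=
        wordUp_commute a j fun t h1 h2 => hlt _ _ (by omega)
      rw [e, mul_assoc, ← hs, ← mul_assoc, ← mul_assoc, c.eq]; simp only [mul_assoc]

end Word

namespace Tower

variable {S : Type*} [Ring S] [Algebra ℂ S] {q μ : ℂ} (T : Tower q μ S)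

theorem r_mul_inv (p : ℕ) : T.r p * T.r' p = 1 := (T.bmw p).r_mul_inv

theorem inv_mul_r (p : ℕ) : T.r' p * T.r p = 1 := (T.bmw p).inv_mul_r

theorem k_off {p t : ℕ} (h1 : t ≠ p) (h2 : t ≠ p + 1) : T.k p ∈ T.off t := by
  have h := T.r_off h1 h2
  rw [(T.bmw p).k_eq]
  exact Subalgebra.smul_mem _ (mul_mem
    (sub_mem (Subalgebra.smul_mem _ (one_mem _) _) h)
    (add_mem (Subalgebra.smul_mem _ (one_mem _) _) h)) _

theorem commute_k {p : ℕ} {x : S} (h : Commute (T.r p) x) : Commute (T.k p) x := by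
  have := comm_poly (u := x) (T.bmw p).k_eq (T.bmw p).k_eq h.eq.symm
  exact this.symm

theorem conj_k {p t : ℕ} {x : S} (h : x * T.r p = T.r t * x) : x * T.k p = T.k t * x :=
  comm_poly (T.bmw p).k_eq (T.bmw t).k_eq h

theorem commute_r' {p : ℕ} {x : S} (h : Commute (T.r p) x) : Commute (T.r' p) x :=
  commute_of_inv (T.r_mul_inv p) (T.inv_mul_r p) h

theorem commute_f' {p : ℕ} {x : S} (h : Commute (T.f p) x) : Commute (T.f' p) x :=
  commute_of_inv (T.f_mul_inv p) (T.inv_mul_f p) h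

theorem rr_comm {p t : ℕ} (h : p + 2 ≤ t ∨ t + 2 ≤ p) : Commute (T.r p) (T.r t) :=
  T.r_comm (T.r_off (by omega) (by omega)) (T.r_off (by omega) (by omega))

theorem fr_comm {p t : ℕ} (h : p + 2 ≤ t ∨ t + 2 ≤ p) : Commute (T.f p) (T.r t) :=
  T.f_comm (T.r_off (by omega) (by omega)) (T.r_off (by omega) (by omega))

theorem ff_comm {p t : ℕ} (h : p + 2 ≤ t ∨ t + 2 ≤ p) : Commute (T.f p) (T.f t) :=
  T.f_comm (T.f_off (by omega) (by omega)) (T.f_off (by omega) (by omega))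

theorem r_shift {a l j : ℕ} (hj : j < l) :
    wordUp T.r a (l + 1) * T.r (a + j) = T.r (a + j + 1) * wordUp T.r a (l + 1) :=
  wordUp_shift (fun p => by rw [← (T.bmw p).braid]) (fun _ _ h => T.rr_comm (.inl h))
    (fun _ _ h => T.rr_comm (.inr h)) a l j hj

theorem f_shift {a l j : ℕ} (hj : j < l) :
    wordUp T.f a (l + 1) * T.r (a + j) = T.r (a + j + 1) * wordUp T.f a (l + 1) :=
  wordUp_shift (fun p => T.twist' p) (fun _ _ h => T.fr_comm (.inl h))
    (fun _ _ h => T.fr_comm (.inr h)) a l j hj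

/-- `x` acts only on strand `0`. -/
def Loc (x : S) : Prop := ∀ t, 1 ≤ t → x ∈ T.off t

/-- The copies `f (j-1) ⋯ f 0 * x * f' 0 ⋯ f' (j-1)` of an element of strand `0`. -/
def bar (x : S) : ℕ → S
  | 0 => x
  | j + 1 => T.f j * bar x j * T.f' j

variable {T} {x y : S}

theorem bar_off (hx : T.Loc x) {j t : ℕ} (h : j < t) : T.bar x j ∈ T.off t := by
  induction j with
  | zero => exact hx t h
  | succ j ih =>
    exact mul_mem (mul_mem (T.f_off (by omega) (by omega)) (ih (by omega)))
      (T.f'_off (by omega) (by omega))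

theorem commute_f_bar_lt (hx : T.Loc x) {j t : ℕ} (h : t < j) : Commute (T.f j) (T.bar x t) :=
  T.f_comm (bar_off hx h) (bar_off hx (by omega))

theorem commute_r_bar_lt (hx : T.Loc x) {j t : ℕ} (h : t < j) : Commute (T.r j) (T.bar x t) :=
  T.r_comm (bar_off hx h) (bar_off hx (by omega))

theorem commute_bar_succ_succ {j : ℕ} {u w : S}
    (hu : u * T.f (j + 1) * T.f j = T.f (j + 1) * T.f j * w) (hw : Commute w (T.bar x j)) :
    Commute u (T.bar x (j + 2)) := by
  set V := T.f (j + 1) * T.f j with hV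
  set V' := T.f' j * T.f' (j + 1) with hV'
  have h1 : V * V' = 1 := by
    rw [hV, hV', mul_assoc, ← mul_assoc (T.f j), T.f_mul_inv, one_mul, T.f_mul_inv]
  have h2 : V' * V = 1 := by
    rw [hV, hV', mul_assoc, ← mul_assoc (T.f' (j + 1)), T.inv_mul_f, one_mul, T.inv_mul_f]
  have e : T.bar x (j + 2) = V * T.bar x j * V' := by
    simp only [bar, hV, hV', mul_assoc]
  have hu' : V * w = u * V := by rw [← hu, mul_assoc]
  have h3 := conj_inv h1 h2 hu'
  show u * _ = _ * u
  calc u * T.bar x (j + 2) = u * V * T.bar x j * V' := by rw [e]; simp only [mul_assoc]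
    _ = V * (w * T.bar x j) * V' := by rw [← hu']; simp only [mul_assoc]
    _ = V * T.bar x j * (w * V') := by rw [hw.eq]; simp only [mul_assoc]
    _ = _ := by rw [h3, e]; simp only [mul_assoc]

theorem commute_f_bar_gt (hx : T.Loc x) {j t : ℕ} (h : j + 2 ≤ t) :
    Commute (T.f j) (T.bar x t) := by
  induction t, h using Nat.le_induction with
  | base => exact commute_bar_succ_succ (T.f_braid j) (commute_f_bar_lt hx (by omega))
  | succ t h ih =>
    exact ((T.ff_comm (.inl h)).mul_right ih).mul_right
      (T.commute_f' (T.ff_comm (.inr h))).symm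

theorem commute_r_bar_gt (hx : T.Loc x) {j t : ℕ} (h : j + 2 ≤ t) :
    Commute (T.r j) (T.bar x t) := by
  induction t, h using Nat.le_induction with
  | base => exact commute_bar_succ_succ (T.twist j) (commute_r_bar_lt hx (by omega))
  | succ t h ih =>
    exact ((T.fr_comm (.inr h)).symm.mul_right ih).mul_right
      (T.commute_f' (T.fr_comm (.inr h))).symm

theorem commute_r_bar (hx : T.Loc x) {j t : ℕ} (h : t ≠ j) (h' : t ≠ j + 1) :
    Commute (T.r j) (T.bar x t) := by
  rcases lt_or_gt_of_ne h with h1 | h1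
  · exact commute_r_bar_lt hx h1
  · exact commute_r_bar_gt hx (by omega)

/-- Conjugation by `f a ⋯ f (a + l - 1)` shifts copies. -/
theorem f_word_bar (hx : T.Loc x) {a l j : ℕ} (hj : j < l) :
    wordUp T.f a l * T.bar x (a + j) = T.bar x (a + j + 1) * wordUp T.f a l := by
  induction l with
  | zero => omega
  | succ l ih =>
    rw [wordUp]
    rcases Nat.lt_succ_iff_lt_or_eq.1 hj with h | rfl
    · rw [mul_assoc, (commute_f_bar_lt hx (by omega)).eq, ← mul_assoc, ih h, mul_assoc]
    · have c : Commute (wordUp T.f a j) (T.bar x (a + j + 1)) :=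
        wordUp_commute a j fun t h1 h2 => commute_f_bar_gt hx (by omega)
      have e : T.f (a + j) * T.bar x (a + j) = T.bar x (a + j + 1) * T.f (a + j) := by
        rw [bar, mul_assoc, T.inv_mul_f, mul_one]
      rw [mul_assoc, e, ← mul_assoc, c.eq, mul_assoc]

theorem wordUp_bar_off (hx : T.Loc x) {a l t : ℕ} (h : a + l ≤ t) :
    wordUp (T.bar x) a l ∈ T.off t :=
  wordUp_induction (p := fun z => z ∈ T.off t) (one_mem _) (fun _ _ => mul_mem) a l
    fun _ _ h2 => bar_off hx (by omega)

theorem f_word_wordUp_bar (hx : T.Loc x) {a l i : ℕ} (hi : i ≤ l) :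
    wordUp T.f a l * wordUp (T.bar x) a i = wordUp (T.bar x) (a + 1) i * wordUp T.f a l := by
  induction i with
  | zero => simp [wordUp]
  | succ i ih =>
    simp only [wordUp]
    rw [← mul_assoc, ih (by omega), mul_assoc, f_word_bar hx (by omega), ← mul_assoc,
      add_right_comm]

variable (T) in
/-- `x` satisfies the defining relation of the quantum matrix algebra. -/
structure QM (x : S) : Prop where
  loc : T.Loc x
  rel : Commute (T.r 0) (x * T.bar x 1)

theorem QM.rel_succ (hx : T.QM x) (j : ℕ) : Commute (T.r j) (T.bar x j * T.bar x (j + 1)) := by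
  induction j with
  | zero => exact hx.rel
  | succ j ih =>
    set V := wordUp T.f j 2 with hV
    set V' := wordDown T.f' j 2 with hV'
    have h1 : V * V' = 1 := wordUp_mul_wordDown T.f_mul_inv j 2
    have h2 : V' * V = 1 := wordDown_mul_wordUp T.inv_mul_f j 2
    have e := f_word_wordUp_bar hx.loc (a := j) (le_refl 2)
    simp only [wordUp, one_mul, add_zero] at e
    have hV2 : T.f j * T.f (j + 1) = V := by simp [hV, wordUp]
    rw [hV2] at e
    have hr : V * T.r j = T.r (j + 1) * V := by
      have := T.f_shift (a := j) (l := 1) (j := 0) (by omega)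
      simpa using this
    set Y := T.bar x j * T.bar x (j + 1)
    set Y2 := T.bar x (j + 1) * T.bar x (j + 1 + 1)
    have e2 : Y2 = V * Y * V' := by rw [e, mul_assoc, h1, mul_one]
    have h3 := conj_inv h1 h2 hr
    show _ * Y2 = Y2 * _
    calc T.r (j + 1) * Y2 = T.r (j + 1) * V * Y * V' := by rw [e2]; simp only [mul_assoc]
      _ = V * (T.r j * Y) * V' := by rw [← hr]; simp only [mul_assoc]
      _ = V * Y * (T.r j * V') := by rw [ih.eq]; simp only [mul_assoc]
      _ = _ := by rw [h3, e2]; simp only [mul_assoc]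

theorem QM.commute_r_word (hx : T.QM x) {a l j : ℕ} (h1 : a ≤ j) (h2 : j + 2 ≤ a + l) :
    Commute (T.r j) (wordUp (T.bar x) a l) := by
  induction l with
  | zero => omega
  | succ l ih =>
    rcases eq_or_lt_of_le h2 with h | h
    · obtain ⟨l, rfl⟩ : ∃ l', l = l' + 1 := ⟨l - 1, by omega⟩
      have hj : j = a + l := by omega
      subst hj
      have c : Commute (T.r (a + l)) (wordUp (T.bar x) a l) :=
        (wordUp_commute a l fun t _ ht => (commute_r_bar hx.loc (by omega) (by omega)).symm).symm
      have := c.mul_right (hx.rel_succ (a + l))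
      rwa [← mul_assoc] at this
    · exact (ih (by omega)).mul_right (commute_r_bar hx.loc (by omega) (by omega))

end Tower

end

section

/-- Nondegeneracy of the parameters required by the antisymmetrizers up to order `n`. -/
structure Generic (q μ : ℂ) (n : ℕ) : Prop where
  q_ne : q ≠ 0
  lam_ne : q - q⁻¹ ≠ 0
  mu_ne : μ ≠ 0
  mu_ne_q : q - μ ≠ 0
  mu_ne_q' : q⁻¹ + μ ≠ 0
  nq_ne : ∀ i, 2 ≤ i → i ≤ n → nq q i ≠ 0
  den_ne : ∀ i : ℕ, 1 ≤ i → i + 1 ≤ n → μ + q * q ^ (-(2 * (i : ℤ))) ≠ 0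

theorem spec_succ {q : ℂ} (hq : q ≠ 0) (i : ℕ) :
    q ^ (-(2 * ((1 : ℕ) : ℤ))) * q ^ (-(2 * (i : ℤ))) = q ^ (-(2 * ((i + 1 : ℕ) : ℤ))) := by
  rw [← zpow_add₀ hq]; congr 1; push_cast; ring

theorem Generic.norm_scalar {q μ : ℂ} {n : ℕ} (h : Generic q μ n) {i : ℕ} (hi : 1 ≤ i)
    (hn : i + 1 ≤ n) :
    q ^ i / nq q (i + 1) * (1 + (q ^ (-(2 * (i : ℤ))) - 1) / (q - q⁻¹) * (-q⁻¹)) = 1 := by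
  have h1 := h.nq_ne (i + 1) (by omega) hn
  have hq := h.q_ne
  have hl := h.lam_ne
  rw [div_mul_eq_mul_div, div_eq_one_iff_eq h1, nq]
  have e1 : q ^ (((i + 1 : ℕ) : ℤ)) = q ^ i * q := by rw [zpow_natCast, pow_succ]
  have e2 : q ^ (-((i + 1 : ℕ) : ℤ)) = (q ^ i)⁻¹ * q⁻¹ := by
    rw [_root_.zpow_neg, e1, mul_inv]
  have e3 : q ^ (-(2 * (i : ℤ))) = (q ^ i)⁻¹ * (q ^ i)⁻¹ := by
    rw [_root_.zpow_neg, two_mul, zpow_add₀ hq, zpow_natCast, mul_inv]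
  rw [e1, e2, e3, eq_div_iff hl]
  have : q ^ i ≠ 0 := pow_ne_zero _ hq
  rw [mul_assoc, add_mul, one_mul, mul_right_comm, div_mul_cancel₀ _ hl]
  field_simp
  ring

theorem Generic.two_ne {q μ : ℂ} {n : ℕ} (h : Generic q μ n) (hn : 2 ≤ n) :
    1 + (q ^ (-(2 * ((1 : ℕ) : ℤ))) - 1) / (q - q⁻¹) * (-q⁻¹) ≠ 0 := by
  intro e
  have := h.norm_scalar (le_refl 1) hn
  rw [e, mul_zero] at this
  exact zero_ne_one this

section
variable {S : Type*} [Ring S] [Algebra ℂ S] {q μ : ℂ} {r s r' s' k l : S}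

theorem BMWPair.k_mul_antisym (h : BMWPair q μ r s r' s' k l) {a : S} (ha : r * a = (-q⁻¹) • a) :
    k * a = 0 := by
  rw [h.k_eq, smul_mul_assoc, mul_assoc, add_mul, ha, smul_mul_assoc, one_mul, ← add_smul,
    add_neg_cancel, zero_smul, mul_zero, smul_zero]

theorem quad_comm' : (q • (1 : S) - r) * (q⁻¹ • (1 : S) + r) =
    (q⁻¹ • (1 : S) + r) * (q • (1 : S) - r) := by
  simp only [mul_add, add_mul, sub_mul, mul_sub, smul_mul_assoc, mul_smul_comm, one_mul, mul_one]
  module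

theorem BMWPair.antisym_mul_k (h : BMWPair q μ r s r' s' k l) {a : S} (ha : a * r = (-q⁻¹) • a) :
    a * k = 0 := by
  rw [h.k_eq, mul_smul_comm, quad_comm', ← mul_assoc, mul_add, ha, mul_smul_comm, mul_one,
    ← add_smul, add_neg_cancel, zero_smul, zero_mul, smul_zero]

theorem BMWPair.baxt_mul_antisym (h : BMWPair q μ r s r' s' k l) {a : S}
    (ha : r * a = (-q⁻¹) • a) (x : ℂ) :
    baxt q μ r k x * a = (1 + (x - 1) / (q - q⁻¹) * (-q⁻¹)) • a := by
  rw [baxt, add_mul, add_mul, smul_mul_assoc, smul_mul_assoc, h.k_mul_antisym ha, ha, one_mul,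
    smul_zero, add_zero, smul_smul, add_smul, one_smul]

theorem BMWPair.antisym_mul_baxt (h : BMWPair q μ r s r' s' k l) {a : S}
    (ha : a * r = (-q⁻¹) • a) (x : ℂ) :
    a * baxt q μ r k x = (1 + (x - 1) / (q - q⁻¹) * (-q⁻¹)) • a := by
  rw [baxt, mul_add, mul_add, mul_smul_comm, mul_smul_comm, h.antisym_mul_k ha, ha, mul_one,
    smul_zero, add_zero, smul_smul, add_smul, one_smul]

theorem BMWPair.baxt_mul_comm (h : BMWPair q μ r s r' s' k l) (x : ℂ) :
    r * baxt q μ r k x = baxt q μ r k x * r := by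
  simp only [baxt, mul_add, add_mul, mul_smul_comm, smul_mul_assoc, h.rk, h.kr, mul_one, one_mul]

theorem BMWPair.r_mul_baxt {n : ℕ} (hg : Generic q μ n) (hn : 2 ≤ n)
    (h : BMWPair q μ r s r' s' k l) :
    r * baxt q μ r k (q ^ (-(2 * ((1 : ℕ) : ℤ)))) =
      (-q⁻¹) • baxt q μ r k (q ^ (-(2 * ((1 : ℕ) : ℤ)))) := by
  have hq := hg.q_ne
  have hl := hg.lam_ne
  have hd := hg.den_ne 1 le_rfl hn
  have e : q ^ (-(2 * ((1 : ℕ) : ℤ))) = q⁻¹ * q⁻¹ := by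
    rw [show -(2 * ((1 : ℕ) : ℤ)) = -1 + -1 by norm_num, zpow_add₀ hq, _root_.zpow_neg_one]
  rw [e] at hd ⊢
  rw [← mul_assoc, mul_inv_cancel₀ hq, one_mul] at hd
  have e1 : (q⁻¹ * q⁻¹ - 1) / (q - q⁻¹) = -q⁻¹ := by
    rw [div_eq_iff hl]; field_simp; ring
  rw [baxt, e1, ← mul_assoc q, mul_inv_cancel₀ hq, one_mul, mul_add, mul_add, mul_smul_comm,
    mul_smul_comm, h.rr, h.rk, mul_one]
  have hd1 : q * μ + 1 ≠ 0 := fun h0 => hd (by field_simp; linear_combination h0)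
  rw [show μ + q⁻¹ = (q * μ + 1) / q by field_simp]
  match_scalars
  · field_simp; ring
  · field_simp
  · field_simp
    ring

end

namespace Tower

variable {S : Type*} [Ring S] [Algebra ℂ S] {q μ : ℂ} (T : Tower q μ S)

/-- The baxterized generator on strands `p, p + 1` at the parameter `q ^ (-2 i)`. -/
def sig (p i : ℕ) : S := baxt q μ (T.r p) (T.k p) (q ^ (-(2 * (i : ℤ))))

/-- The antisymmetrizer on the strands `s, …, s + i - 1`. -/
def As (s : ℕ) : ℕ → S
  | 0 => 1
  | 1 => 1
  | i + 2 => (q ^ (i + 1) / nq q (i + 2)) • (As s (i + 1) * T.sig (s + i) (i + 1) * As s (i + 1))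

variable {T}

theorem sig_intertwine {p t i : ℕ} {u : S} (h : u * T.r p = T.r t * u) :
    u * T.sig p i = T.sig t i * u := by
  simp only [sig, baxt, mul_add, add_mul, mul_one, one_mul, mul_smul_comm, smul_mul_assoc, h,
    T.conj_k h]

theorem As_intertwine {s t i : ℕ} {u : S} (h : ∀ j, j + 2 ≤ i → u * T.r (s + j) = T.r (t + j) * u) :
    u * T.As s i = T.As t i * u := by
  induction i using Nat.strong_induction_on with
  | _ i ih =>
    match i with
    | 0 => simp [As]
    | 1 => simp [As]
    | i + 2 =>
      have e := ih (i + 1) (by omega) fun j hj => h j (by omega)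
      rw [As, As, mul_smul_comm, smul_mul_assoc, ← mul_assoc, ← mul_assoc, e, mul_assoc (T.As t _) u,
        sig_intertwine (h i le_rfl), ← mul_assoc, mul_assoc _ u, e, ← mul_assoc]

theorem As_commute {s i : ℕ} {u : S} (h : ∀ j, j + 2 ≤ i → Commute (T.r (s + j)) u) :
    Commute (T.As s i) u :=
  (As_intertwine (u := u) fun j hj => (h j hj).eq.symm).symm

theorem sig_commute {p i : ℕ} {u : S} (h : Commute (T.r p) u) : Commute (T.sig p i) u :=
  (sig_intertwine (u := u) h.eq.symm).symm

theorem sig_off {p t i : ℕ} (h1 : t ≠ p) (h2 : t ≠ p + 1) : T.sig p i ∈ T.off t :=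
  add_mem (add_mem (one_mem _) (Subalgebra.smul_mem _ (T.r_off h1 h2) _))
    (Subalgebra.smul_mem _ (T.k_off h1 h2) _)

theorem As_off {s i t : ℕ} (h : t < s ∨ s + i ≤ t) : T.As s i ∈ T.off t := by
  induction i using Nat.strong_induction_on with
  | _ i ih =>
    match i with
    | 0 => exact one_mem _
    | 1 => exact one_mem _
    | i + 2 =>
      have e := ih (i + 1) (by omega) (by omega)
      exact Subalgebra.smul_mem _ (mul_mem (mul_mem e (sig_off (by omega) (by omega))) e) _

private theorem As_aux {n : ℕ} (hg : Generic q μ n) (s i : ℕ) (hi : i ≤ n) :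
    T.As s i * T.As s i = T.As s i ∧ ∀ j, j + 2 ≤ i →
      T.r (s + j) * T.As s i = (-q⁻¹) • T.As s i ∧ T.As s i * T.r (s + j) = (-q⁻¹) • T.As s i := by
  induction i using Nat.strong_induction_on with
  | _ i ih =>
    match i with
    | 0 => exact ⟨by simp [As], fun j hj => by omega⟩
    | 1 => exact ⟨by simp [As], fun j hj => by omega⟩
    | i + 2 =>
      have key : ∀ j, j + 2 ≤ i + 2 → T.r (s + j) * T.As s (i + 2) = (-q⁻¹) • T.As s (i + 2) ∧
          T.As s (i + 2) * T.r (s + j) = (-q⁻¹) • T.As s (i + 2) := by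
        match i with
        | 0 =>
          intro j hj
          obtain rfl : j = 0 := by omega
          have := (T.bmw s).r_mul_baxt hg hi
          have h2 : T.As s 2 = (q ^ (0 + 1) / nq q (0 + 2)) • T.sig s 1 := by
            simp [As]
          rw [h2, add_zero]
          constructor
          · rw [mul_smul_comm, smul_comm (-q⁻¹)]
            exact congrArg _ this
          · rw [smul_mul_assoc, smul_comm (-q⁻¹), sig, ← (T.bmw s).baxt_mul_comm]
            exact congrArg _ this
        | i + 1 =>
          obtain ⟨hAA, hA⟩ := ih (i + 2) (by omega) (by omega)
          obtain ⟨hBB, hB⟩ := ih (i + 1) (by omega) (by omega)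
          have hAdef : T.As s (i + 2) = (q ^ (i + 1) / nq q (i + 2)) •
              (T.As s (i + 1) * T.sig (s + i) (i + 1) * T.As s (i + 1)) := rfl
          have hCdef : T.As s (i + 1 + 2) = (q ^ (i + 2) / nq q (i + 3)) •
              (T.As s (i + 2) * T.sig (s + i + 1) (i + 2) * T.As s (i + 2)) := rfl
          rw [hCdef]
          set A := T.As s (i + 2)
          set B := T.As s (i + 1)
          have hAB : A * B = A := by
            rw [hAdef, smul_mul_assoc, mul_assoc _ B, hBB]
          have hBA : B * A = A := by
            rw [hAdef, mul_smul_comm, ← mul_assoc, ← mul_assoc, hBB]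
          have hcB : Commute B (T.r (s + i + 1)) :=
            As_commute fun j hj => T.rr_comm (.inl (by omega))
          have hcBs : Commute B (T.sig (s + i + 1) (i + 2)) := (sig_commute hcB.symm).symm
          obtain ⟨hrA, hAr⟩ := hA i le_rfl
          set e := 1 + (q ^ (-(2 * ((1 : ℕ) : ℤ))) - 1) / (q - q⁻¹) * (-q⁻¹) with he
          have he0 : e ≠ 0 := hg.two_ne (by omega)
          have hsA : T.sig (s + i) 1 * A = e • A := (T.bmw _).baxt_mul_antisym hrA _
          have hAs : A * T.sig (s + i) 1 = e • A := (T.bmw _).antisym_mul_baxt hAr _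
          have d1 := hg.den_ne 1 le_rfl (by omega)
          have di := hg.den_ne (i + 1) (by omega) (by omega)
          have di2 := hg.den_ne (i + 2) (by omega) (by omega)
          have yb1 : T.sig (s + i) 1 * T.sig (s + i + 1) (i + 2) * T.sig (s + i) (i + 1) =
              T.sig (s + i + 1) (i + 1) * T.sig (s + i) (i + 2) * T.sig (s + i + 1) 1 := by
            have := (T.bmw (s + i)).yang_baxter hg.q_ne hg.lam_ne hg.mu_ne d1 di
              (by rwa [spec_succ hg.q_ne])
            rwa [spec_succ hg.q_ne] at this
          have yb2 : T.sig (s + i) (i + 1) * T.sig (s + i + 1) (i + 2) * T.sig (s + i) 1 =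
              T.sig (s + i + 1) 1 * T.sig (s + i) (i + 2) * T.sig (s + i + 1) (i + 1) := by
            have := (T.bmw (s + i)).yang_baxter hg.q_ne hg.lam_ne hg.mu_ne di d1
              (by rwa [mul_comm (q ^ _), spec_succ hg.q_ne])
            rwa [mul_comm (q ^ _) (q ^ (-(2 * ((1 : ℕ) : ℤ)))), spec_succ hg.q_ne] at this
          set c := q ^ (i + 1) / nq q (i + 2)
          have f1 : A * T.sig (s + i + 1) (i + 2) * A = (e⁻¹ * c) •
              (A * T.sig (s + i + 1) (i + 1) * T.sig (s + i) (i + 2) * T.sig (s + i + 1) 1 * B) := by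
            rw [mul_smul, eq_inv_smul_iff₀ he0]
            calc e • (A * T.sig (s + i + 1) (i + 2) * A)
                = e • (A * T.sig (s + i + 1) (i + 2) *
                    (c • (B * T.sig (s + i) (i + 1) * B))) := by rw [← hAdef]
              _ = c • ((e • A) * B * T.sig (s + i + 1) (i + 2) * T.sig (s + i) (i + 1) * B) := by
                rw [mul_smul_comm, smul_comm]
                simp only [smul_mul_assoc, mul_assoc]
                rw [← mul_assoc (T.sig (s + i + 1) (i + 2)) B, ← hcBs.eq, mul_assoc B]
              _ = c • (A * (T.sig (s + i) 1 * T.sig (s + i + 1) (i + 2) * T.sig (s + i) (i + 1)) *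
                    B) := by
                rw [smul_mul_assoc, hAB, ← hAs]; simp only [mul_assoc]
              _ = _ := by rw [yb1]; simp only [mul_assoc]
          have f2 : A * T.sig (s + i + 1) (i + 2) * A = (e⁻¹ * c) •
              (B * T.sig (s + i + 1) 1 * T.sig (s + i) (i + 2) * T.sig (s + i + 1) (i + 1) * A) := by
            rw [mul_smul, eq_inv_smul_iff₀ he0]
            calc e • (A * T.sig (s + i + 1) (i + 2) * A)
                = e • ((c • (B * T.sig (s + i) (i + 1) * B)) * T.sig (s + i + 1) (i + 2) * A) := by
                    rw [← hAdef]
              _ = c • (B * T.sig (s + i) (i + 1) * T.sig (s + i + 1) (i + 2) * (B * (e • A))) := by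
                rw [smul_mul_assoc, smul_mul_assoc, smul_comm]
                simp only [mul_smul_comm, mul_assoc]
                rw [← mul_assoc B (T.sig (s + i + 1) (i + 2)), hcBs.eq, mul_assoc _ B]
              _ = c • (B * (T.sig (s + i) (i + 1) * T.sig (s + i + 1) (i + 2) * T.sig (s + i) 1) *
                    A) := by
                rw [mul_smul_comm, hBA, ← hsA]; simp only [mul_assoc]
              _ = _ := by rw [yb2]; simp only [mul_assoc]
          intro j hj
          rcases Nat.lt_or_ge j (i + 1) with h | h
          · obtain ⟨h1, h2⟩ := hA j (by omega)
            constructor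
            · rw [mul_smul_comm, ← mul_assoc, ← mul_assoc, h1, smul_mul_assoc, smul_mul_assoc,
                smul_comm]
            · rw [smul_mul_assoc, mul_assoc, h2, mul_smul_comm, smul_comm]
          · obtain rfl : j = i + 1 := by omega
            have hb : T.r (s + i + 1) * T.sig (s + i + 1) 1 = (-q⁻¹) • T.sig (s + i + 1) 1 :=
              (T.bmw (s + i + 1)).r_mul_baxt hg (by omega)
            have hb' : T.sig (s + i + 1) 1 * T.r (s + i + 1) = (-q⁻¹) • T.sig (s + i + 1) 1 := by
              rw [← hb]; exact ((T.bmw (s + i + 1)).baxt_mul_comm _).symm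
            rw [← add_assoc]
            constructor
            · rw [mul_smul_comm, smul_comm (-q⁻¹)]
              congr 1
              rw [f2, mul_smul_comm, smul_comm (-q⁻¹)]
              congr 1
              simp only [← mul_assoc]
              rw [← hcB.eq, mul_assoc B, hb]
              simp only [smul_mul_assoc, mul_smul_comm]
            · rw [smul_mul_assoc, smul_comm (-q⁻¹)]
              congr 1
              rw [f1, smul_mul_assoc, smul_comm (-q⁻¹)]
              congr 1
              rw [mul_assoc, hcB.eq, ← mul_assoc, mul_assoc _ (T.sig (s + i + 1) 1), hb']
              simp only [smul_mul_assoc, mul_smul_comm]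
      refine ⟨?_, key⟩
      obtain ⟨hAA, -⟩ := ih (i + 1) (by omega) (by omega)
      obtain ⟨hr, -⟩ := key i le_rfl
      have hs : T.sig (s + i) (i + 1) * T.As s (i + 2) = _ := (T.bmw _).baxt_mul_antisym hr _
      have hAC : T.As s (i + 1) * T.As s (i + 2) = T.As s (i + 2) := by
        rw [As, mul_smul_comm, ← mul_assoc, ← mul_assoc, hAA]
      nth_rw 1 [As]
      rw [smul_mul_assoc, mul_assoc, hAC, mul_assoc, hs, mul_smul_comm, hAC, smul_smul,
        hg.norm_scalar (by omega) hi, one_smul]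

theorem As_idem {n : ℕ} (hg : Generic q μ n) {s i : ℕ} (hi : i ≤ n) :
    T.As s i * T.As s i = T.As s i := (As_aux hg s i hi).1

theorem r_mul_As {n : ℕ} (hg : Generic q μ n) {s i j : ℕ} (hi : i ≤ n) (hj : j + 2 ≤ i) :
    T.r (s + j) * T.As s i = (-q⁻¹) • T.As s i := ((As_aux hg s i hi).2 j hj).1

theorem As_mul_r {n : ℕ} (hg : Generic q μ n) {s i j : ℕ} (hi : i ≤ n) (hj : j + 2 ≤ i) :
    T.As s i * T.r (s + j) = (-q⁻¹) • T.As s i := ((As_aux hg s i hi).2 j hj).2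

theorem word_mul_As {n : ℕ} (hg : Generic q μ n) {s i a l : ℕ} (hi : i ≤ n)
    (h1 : s ≤ a) (h2 : a + l + 1 ≤ s + i) :
    wordUp T.r a l * T.As s i = (-q⁻¹) ^ l • T.As s i := by
  induction l with
  | zero => simp [wordUp]
  | succ l ih =>
    obtain ⟨j, hj⟩ : ∃ j, a + l = s + j := ⟨a + l - s, by omega⟩
    rw [wordUp, mul_assoc, hj, r_mul_As hg hi (by omega), mul_smul_comm, ih (by omega), smul_smul,
      pow_succ']

theorem As_mul_word {n : ℕ} (hg : Generic q μ n) {s i a l : ℕ} (hi : i ≤ n)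
    (h1 : s ≤ a) (h2 : a + l + 1 ≤ s + i) :
    T.As s i * wordUp T.r a l = (-q⁻¹) ^ l • T.As s i := by
  induction l with
  | zero => simp [wordUp]
  | succ l ih =>
    obtain ⟨j, hj⟩ : ∃ j, a + l = s + j := ⟨a + l - s, by omega⟩
    rw [wordUp, ← mul_assoc, ih (by omega), smul_mul_assoc, hj, As_mul_r hg hi (by omega),
      smul_smul, pow_succ]

end Tower

end

section

namespace Tower

variable {S : Type*} [Ring S] [Algebra ℂ S] {q μ : ℂ} (T : Tower q μ S)

theorem r_word_mul_inv (a l : ℕ) : wordUp T.r a l * wordDown T.r' a l = 1 :=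
  wordUp_mul_wordDown T.r_mul_inv a l

theorem r_inv_mul_word (a l : ℕ) : wordDown T.r' a l * wordUp T.r a l = 1 :=
  wordDown_mul_wordUp T.inv_mul_r a l

theorem As_succ_left {n : ℕ} (hg : Generic q μ n) (s i : ℕ) (hi : i + 2 ≤ n) :
    T.As s (i + 2) = (q ^ (i + 1) / nq q (i + 2)) •
      (T.As (s + 1) (i + 1) * T.sig s (i + 1) * T.As (s + 1) (i + 1)) := by
  have hA : wordUp T.r s (i + 1) * T.As s (i + 1) = T.As (s + 1) (i + 1) * wordUp T.r s (i + 1) :=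
    As_intertwine fun j hj => by rw [T.r_shift (by omega), add_right_comm]
  have hw : ∀ a l, wordUp T.r a (l + 1) = wordUp T.r a l * T.r (a + l) := fun _ _ => rfl
  have hD : wordUp T.r (s + 1) i * wordUp T.r s (i + 1) =
      wordUp T.r s (i + 1) * wordUp T.r s i := by
    have : ∀ m ≤ i, wordUp T.r (s + 1) m * wordUp T.r s (i + 1) =
        wordUp T.r s (i + 1) * wordUp T.r s m := by
      intro m hm
      induction m with
      | zero => simp [wordUp]
      | succ m ih =>
        rw [hw, hw s m, ← mul_assoc, ← ih (by omega), mul_assoc, mul_assoc, T.r_shift (by omega),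
          add_right_comm]
    exact this i le_rfl
  have hDC : (wordUp T.r (s + 1) i * wordUp T.r s (i + 1)) * T.sig (s + i) (i + 1) =
      T.sig s (i + 1) * (wordUp T.r (s + 1) i * wordUp T.r s (i + 1)) := by
    apply sig_intertwine
    rw [hD, mul_assoc, ← hw, ← hD, ← mul_assoc, ← wordUp_succ]
  set C := wordUp T.r s (i + 1)
  set D := wordUp T.r (s + 1) i
  set A := T.As s (i + 1)
  set B := T.As (s + 1) (i + 1)
  have hε : (-q⁻¹) ^ i ≠ 0 := pow_ne_zero _ (neg_ne_zero.2 (inv_ne_zero hg.q_ne))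
  have hB : B * D = (-q⁻¹) ^ i • B := As_mul_word hg (by omega) le_rfl (by omega)
  have hB' : D * B = (-q⁻¹) ^ i • B := word_mul_As hg (by omega) le_rfl (by omega)
  have h1 : B * C * T.sig (s + i) (i + 1) * A = B * T.sig s (i + 1) * B * C := by
    apply smul_right_injective S hε
    calc (-q⁻¹) ^ i • (B * C * T.sig (s + i) (i + 1) * A)
        = B * (D * C * T.sig (s + i) (i + 1)) * A := by
          simp only [← mul_assoc, hB, smul_mul_assoc]
      _ = B * T.sig s (i + 1) * (D * (B * C)) := by rw [hDC, ← hA]; simp only [mul_assoc]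
      _ = (-q⁻¹) ^ i • (B * T.sig s (i + 1) * B * C) := by
          rw [← mul_assoc D, hB', smul_mul_assoc, mul_smul_comm, mul_assoc (B * _)]
  have h2 : C * T.As s (i + 2) = T.As s (i + 2) * C := by
    rw [word_mul_As hg hi le_rfl (by omega), As_mul_word hg hi le_rfl (by omega)]
  have h3 : T.As s (i + 2) * C = (q ^ (i + 1) / nq q (i + 2)) • (B * T.sig s (i + 1) * B) * C := by
    rw [← h2, As, mul_smul_comm, smul_mul_assoc, ← h1, ← mul_assoc, ← mul_assoc, hA]
  have := congrArg (· * wordDown T.r' s (i + 1)) h3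
  simpa only [mul_assoc, C, T.r_word_mul_inv, mul_one] using this

/-- The iterated quantum trace over the strands `a, …, a + l - 1`. -/
def Et (a : ℕ) : ℕ → S →ₗ[ℂ] S
  | 0 => LinearMap.id
  | l + 1 => Et a l ∘ₗ T.E (a + l)

variable {T}

@[simp] theorem Et_zero (a : ℕ) (y : S) : T.Et a 0 y = y := rfl

theorem Et_succ (a l : ℕ) (y : S) : T.Et a (l + 1) y = T.Et a l (T.E (a + l) y) := rfl

theorem Et_succ' (a l : ℕ) (y : S) : T.Et a (l + 1) y = T.E a (T.Et (a + 1) l y) := by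
  induction l generalizing y with
  | zero => rfl
  | succ l ih => rw [Et_succ, ih, Et_succ, add_right_comm, add_assoc]

theorem Et_off {a l t : ℕ} {y : S} (h : y ∈ T.off t) : T.Et a l y ∈ T.off t := by
  induction l generalizing y with
  | zero => exact h
  | succ l ih => exact ih (T.E_off h)

theorem Et_off_self {a l t : ℕ} (h1 : a ≤ t) (h2 : t < a + l) (y : S) : T.Et a l y ∈ T.off t := by
  induction l generalizing y with
  | zero => omega
  | succ l ih =>
    rcases (by omega : t = a + l ∨ t < a + l) with h | h
    · rw [h, Et_succ]; exact Et_off (T.E_off_self _ _)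
    · exact ih h _

theorem Et_mul_left {a l : ℕ} {y : S} (x : S) (h : ∀ t, a ≤ t → t < a + l → y ∈ T.off t) :
    T.Et a l (y * x) = y * T.Et a l x := by
  induction l generalizing x with
  | zero => rfl
  | succ l ih =>
    rw [Et_succ, Et_succ, T.E_mul_left _ (h _ (by omega) (by omega)),
      ih _ fun t h1 h2 => h t h1 (by omega)]

theorem Et_mul_right {a l : ℕ} {y : S} (x : S) (h : ∀ t, a ≤ t → t < a + l → y ∈ T.off t) :
    T.Et a l (x * y) = T.Et a l x * y := by
  induction l generalizing x with
  | zero => rfl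
  | succ l ih =>
    rw [Et_succ, Et_succ, T.E_mul_right _ (h _ (by omega) (by omega)),
      ih _ fun t h1 h2 => h t h1 (by omega)]

variable (T) in
/-- `x` can be moved cyclically under the iterated trace. -/
def Cyc (a l : ℕ) (x : S) : Prop := ∀ y, T.Et a l (x * y) = T.Et a l (y * x)

section Cyc
variable {a l : ℕ} {x y : S}

theorem Cyc.one : T.Cyc a l 1 := fun y => by rw [one_mul, mul_one]

theorem Cyc.mul (hx : T.Cyc a l x) (hy : T.Cyc a l y) : T.Cyc a l (x * y) := fun z => by
  rw [mul_assoc, hx, mul_assoc, hy, mul_assoc]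

theorem Cyc.add (hx : T.Cyc a l x) (hy : T.Cyc a l y) : T.Cyc a l (x + y) := fun z => by
  rw [add_mul, mul_add, map_add, map_add, hx, hy]

theorem Cyc.sub (hx : T.Cyc a l x) (hy : T.Cyc a l y) : T.Cyc a l (x - y) := fun z => by
  rw [sub_mul, mul_sub, map_sub, map_sub, hx, hy]

theorem Cyc.smul (c : ℂ) (hx : T.Cyc a l x) : T.Cyc a l (c • x) := fun z => by
  rw [smul_mul_assoc, mul_smul_comm, map_smul, map_smul, hx]

theorem cyc_r {j : ℕ} (h1 : a ≤ j) (h2 : j + 1 < a + l) : T.Cyc a l (T.r j) := by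
  induction l with
  | zero => omega
  | succ l ih =>
    intro y
    rcases (by omega : j + 1 = a + l ∨ j + 1 < a + l) with h | h
    · obtain ⟨l, rfl⟩ : ∃ l', l = l' + 1 := ⟨l - 1, by omega⟩
      have hj : j = a + l := by omega
      subst hj
      rw [Et_succ, Et_succ, Et_succ, Et_succ, ← add_assoc, T.E_cyclic]
    · have ho : T.r j ∈ T.off (a + l) := T.r_off (by omega) (by omega)
      rw [Et_succ, Et_succ, T.E_mul_left _ ho, T.E_mul_right _ ho, ih h]

theorem cyc_k {j : ℕ} (h1 : a ≤ j) (h2 : j + 1 < a + l) : T.Cyc a l (T.k j) := by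
  have h : T.Cyc a l (T.r j) := cyc_r h1 h2
  rw [(T.bmw j).k_eq]
  exact Cyc.smul _ (((Cyc.one.smul _).sub h).mul ((Cyc.one.smul _).add h))

theorem cyc_sig {j i : ℕ} (h1 : a ≤ j) (h2 : j + 1 < a + l) : T.Cyc a l (T.sig j i) :=
  (Cyc.one.add ((cyc_r h1 h2).smul _)).add ((cyc_k h1 h2).smul _)

theorem cyc_As {s i : ℕ} (h1 : a ≤ s) (h2 : s + i ≤ a + l) : T.Cyc a l (T.As s i) := by
  induction i using Nat.strong_induction_on with
  | _ i ih =>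
    match i with
    | 0 => exact Cyc.one
    | 1 => exact Cyc.one
    | i + 2 =>
      have h := ih (i + 1) (by omega) (by omega)
      exact ((h.mul (cyc_sig (by omega) (by omega))).mul h).smul _

end Cyc

/-- Conjugation by a full word of strands shifts the iterated trace. -/
theorem Et_shift {v v' : ℕ → S} (ho : ∀ {p t}, t ≠ p → t ≠ p + 1 → v p ∈ T.off t)
    (ho' : ∀ {p t}, t ≠ p → t ≠ p + 1 → v' p ∈ T.off t)
    (hE : ∀ {p x}, x ∈ T.off (p + 1) → T.E (p + 1) (v p * x * v' p) = T.E p x)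
    (s l : ℕ) {y : S} (hy : ∀ t, s + l + 1 ≤ t → y ∈ T.off t) :
    T.Et (s + 2) l (wordUp v s (l + 1) * y * wordDown v' s (l + 1)) =
      v s * T.Et (s + 1) l y * v' s := by
  induction l generalizing y with
  | zero => simp [wordUp, wordDown]
  | succ l ih =>
    have h1 : wordUp v s (l + 1) ∈ T.off (s + (l + 1) + 1) :=
      wordUp_induction (p := fun z => z ∈ T.off _) (one_mem _) (fun _ _ => mul_mem) _ _
        fun j _ _ => ho (by omega) (by omega)
    have h2 : wordDown v' s (l + 1) ∈ T.off (s + (l + 1) + 1) :=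
      wordDown_induction (p := fun z => z ∈ T.off _) (one_mem _) (fun _ _ => mul_mem) _ _
        fun j _ _ => ho' (by omega) (by omega)
    have e : wordUp v s (l + 1 + 1) * y * wordDown v' s (l + 1 + 1) = wordUp v s (l + 1) *
        (v (s + (l + 1)) * y * v' (s + (l + 1))) * wordDown v' s (l + 1) := by
      rw [wordUp, wordDown]; simp only [mul_assoc]
    rw [Et_succ, Et_succ, e, show s + 2 + l = s + (l + 1) + 1 by ring, T.E_mul_right _ h2,
      T.E_mul_left _ h1, hE (hy _ (by omega)), show s + 1 + l = s + (l + 1) by ring, ih]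
    intro t ht
    rcases eq_or_lt_of_le ht with h | h
    · rw [← h]; exact T.E_off_self _ _
    · exact T.E_off (hy t (by omega))

theorem Et_shift_f (s l : ℕ) {y : S} (hy : ∀ t, s + l + 1 ≤ t → y ∈ T.off t) :
    T.Et (s + 2) l (wordUp T.f s (l + 1) * y * wordDown T.f' s (l + 1)) =
      T.f s * T.Et (s + 1) l y * T.f' s :=
  Et_shift T.f_off T.f'_off T.E_conj_f s l hy

theorem Et_shift_r (s l : ℕ) {y : S} (hy : ∀ t, s + l + 1 ≤ t → y ∈ T.off t) :
    T.Et (s + 2) l (wordUp T.r s (l + 1) * y * wordDown T.r' s (l + 1)) =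
      T.r s * T.Et (s + 1) l y * T.r' s :=
  Et_shift T.r_off T.r'_off T.E_conj_r s l hy

end Tower

end

section

namespace Tower

variable {S : Type*} [Ring S] [Algebra ℂ S] {q μ : ℂ} (T : Tower q μ S)

/-- `y` acts on no strand. -/
def Scal (y : S) : Prop := ∀ t, y ∈ T.off t

/-- The antisymmetrized product of `l + 1` copies of `x`, traced over all strands but the first. -/
def Wg (x : S) (s l : ℕ) : S := T.Et (s + 1) l (wordUp (T.bar x) s (l + 1) * T.As s (l + 1))

/-- The trace of the antisymmetrized product of `l` copies of `x`. -/
def aa (x : S) : ℕ → S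
  | 0 => 1
  | l + 1 => T.E 0 (T.Wg x 0 l)

/-- The contraction of two copies of `x`. -/
def gg (x : S) : S :=
  (μ * (q - q⁻¹) / ((q - μ) * (q⁻¹ + μ))) • T.E 0 (T.E 1 (x * T.bar x 1 * T.k 0))

variable {T} {x y : S}

theorem Scal.comm_r (hy : T.Scal y) (p : ℕ) : Commute (T.r p) y := T.r_comm (hy _) (hy _)

theorem Scal.comm_f (hy : T.Scal y) (p : ℕ) : Commute (T.f p) y := T.f_comm (hy _) (hy _)

theorem Scal.comm_f' (hy : T.Scal y) (p : ℕ) : Commute (T.f' p) y := T.commute_f' (hy.comm_f p)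

theorem Scal.comm_r' (hy : T.Scal y) (p : ℕ) : Commute (T.r' p) y := T.commute_r' (hy.comm_r p)

theorem Scal.comm_k (hy : T.Scal y) (p : ℕ) : Commute (T.k p) y := T.commute_k (hy.comm_r p)

theorem Scal.comm_As (hy : T.Scal y) (s i : ℕ) : Commute (T.As s i) y :=
  As_commute fun _ _ => hy.comm_r _

theorem Wg_loc (hx : T.Loc x) (l : ℕ) : T.Loc (T.Wg x 0 l) := by
  intro t ht
  rcases Nat.lt_or_ge t (l + 1) with h | h
  · exact Et_off_self (by omega) (by omega) _
  · exact Et_off (mul_mem (wordUp_bar_off hx (by omega)) (As_off (by omega)))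

theorem Wg_succ (hx : T.Loc x) (s l : ℕ) : T.Wg x (s + 1) l = T.f s * T.Wg x s l * T.f' s := by
  have hy : ∀ t, s + l + 1 ≤ t →
      wordUp (T.bar x) s (l + 1) * T.As s (l + 1) ∈ T.off t := fun t ht =>
    mul_mem (wordUp_bar_off hx (by omega)) (As_off (by omega))
  rw [Wg, Wg, ← Et_shift_f s l hy]
  have e : wordUp T.f s (l + 1) * T.As s (l + 1) = T.As (s + 1) (l + 1) * wordUp T.f s (l + 1) :=
    As_intertwine fun j hj => by rw [T.f_shift (by omega), add_right_comm]
  rw [← mul_assoc, f_word_wordUp_bar hx le_rfl, mul_assoc _ (wordUp T.f _ _), e, ← mul_assoc,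
    mul_assoc _ (wordUp T.f _ _), wordUp_mul_wordDown T.f_mul_inv, mul_one]

theorem Wg_eq_bar (hx : T.Loc x) (s l : ℕ) : T.Wg x s l = T.bar (T.Wg x 0 l) s := by
  induction s with
  | zero => rfl
  | succ s ih => rw [Wg_succ hx, ih, bar]

theorem E_bar (hx : T.Loc x) (s : ℕ) : T.E s (T.bar x s) = T.E 0 x := by
  induction s with
  | zero => rfl
  | succ s ih => rw [bar, T.E_conj_f (bar_off hx (by omega)), ih]

theorem E_scal (hx : T.Loc x) : T.Scal (T.E 0 x) := fun t => by
  rcases Nat.eq_zero_or_pos t with rfl | h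
  · exact T.E_off_self _ _
  · exact T.E_off (hx t h)

theorem aa_scal (hx : T.Loc x) (l : ℕ) : T.Scal (T.aa x l) := by
  cases l with
  | zero => exact fun t => one_mem _
  | succ l => exact E_scal (Wg_loc hx l)

theorem gg_scal (hx : T.Loc x) : T.Scal (T.gg x) := fun t => by
  refine Subalgebra.smul_mem _ ?_ _
  match t with
  | 0 => exact T.E_off_self _ _
  | 1 => exact T.E_off (T.E_off_self _ _)
  | t + 2 =>
    exact T.E_off (T.E_off (mul_mem (mul_mem (hx _ (by omega)) (bar_off hx (by omega)))
      (T.k_off (by omega) (by omega))))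

variable {n : ℕ}

theorem bar_bar_k (hg : Generic q μ n) (hx : T.QM x) (j : ℕ) :
    T.bar x j * T.bar x (j + 1) * T.k j = (μ⁻¹ * μ⁻¹) • (T.gg x * T.k j) := by
  induction j with
  | zero =>
    have hk := (T.bmw 0).kk
    have h0 : (q - μ) * (q⁻¹ + μ) * (μ⁻¹ * (q - q⁻¹)⁻¹) ≠ 0 :=
      mul_ne_zero (mul_ne_zero hg.mu_ne_q hg.mu_ne_q')
        (mul_ne_zero (inv_ne_zero hg.mu_ne) (inv_ne_zero hg.lam_ne))
    have hη : ((q - μ) * (q⁻¹ + μ) * (μ⁻¹ * (q - q⁻¹)⁻¹))⁻¹ =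
        μ * (q - q⁻¹) / ((q - μ) * (q⁻¹ + μ)) := by
      simp only [mul_inv, inv_inv, div_eq_mul_inv]; ring
    have hc : Commute (T.k 0) (x * T.bar x 1) := T.commute_k hx.rel
    have h1 := T.k_sandwich 0 (x * T.bar x 1)
    rw [hc.eq, mul_assoc _ (T.k 0), hk, mul_smul_comm] at h1
    show x * T.bar x 1 * T.k 0 = _
    rw [gg, ← hη, smul_mul_assoc, smul_comm, eq_inv_smul_iff₀ h0, h1, zero_add]
  | succ j ih =>
    set V := wordUp T.f j 2 with hV
    set V' := wordDown T.f' j 2 with hV'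
    have h1 : V * V' = 1 := wordUp_mul_wordDown T.f_mul_inv j 2
    have e := f_word_wordUp_bar hx.loc (a := j) (le_refl 2)
    simp only [wordUp, one_mul, add_zero] at e
    have hV2 : T.f j * T.f (j + 1) = V := by simp [hV, wordUp]
    rw [hV2] at e
    have hr : V * T.k j = T.k (j + 1) * V := T.conj_k (by
      have := T.f_shift (a := j) (l := 1) (j := 0) (by omega)
      simpa using this)
    have hG : Commute V (T.gg x) := by
      rw [← hV2]
      exact ((gg_scal hx.loc).comm_f _).mul_left ((gg_scal hx.loc).comm_f _)
    have h2 : V * (T.bar x j * T.bar x (j + 1) * T.k j) =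
        V * ((μ⁻¹ * μ⁻¹) • (T.gg x * T.k j)) := by rw [ih]
    rw [← mul_assoc, e, mul_assoc, hr, mul_smul_comm, ← mul_assoc V, hG.eq, mul_assoc _ V, hr] at h2
    have h3 := congrArg (· * V') h2
    simpa only [smul_mul_assoc, mul_assoc, h1, mul_one] using h3

theorem r_word_word (s i : ℕ) : wordUp T.r (s + 1) i * wordUp T.r s (i + 1) =
    wordUp T.r s (i + 1) * wordUp T.r s i := by
  have hw : ∀ a l, wordUp T.r a (l + 1) = wordUp T.r a l * T.r (a + l) := fun _ _ => rfl
  have : ∀ m ≤ i, wordUp T.r (s + 1) m * wordUp T.r s (i + 1) =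
      wordUp T.r s (i + 1) * wordUp T.r s m := by
    intro m hm
    induction m with
    | zero => simp [wordUp]
    | succ m ih =>
      rw [hw, hw s m, ← mul_assoc, ← ih (by omega), mul_assoc, mul_assoc, T.r_shift (by omega),
        add_right_comm]
  exact this i le_rfl

/-- The fundamental contraction identity for the antisymmetrized products. -/
theorem gg_k_Wg (hg : Generic q μ n) (hx : T.QM x) (l : ℕ) :
    T.gg x * (T.k 0 * T.Wg x 2 l) = T.k 0 * T.Wg x 0 l * T.k 1 * T.k 0 * T.gg x := by
  have hG := gg_scal hx.loc
  have hL := Wg_loc hx.loc l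
  have hw : ∀ (v : ℕ → S) (a l), wordUp v a (l + 1) = wordUp v a l * v (a + l) := fun _ _ _ => rfl
  set i := l + 1 with hi
  set U := wordUp T.r 1 i * wordUp T.r 0 i with hU
  set U' := wordDown T.r' 0 i * wordDown T.r' 1 i with hU'
  have hUU : U * U' = 1 := by
    rw [hU, hU', mul_assoc, ← mul_assoc (wordUp T.r 0 i), T.r_word_mul_inv, one_mul,
      T.r_word_mul_inv]
  have hUU' : U' * U = 1 := by
    rw [hU, hU', mul_assoc, ← mul_assoc (wordDown T.r' 1 i), T.r_inv_mul_word, one_mul,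
      T.r_inv_mul_word]
  have hUr : U * T.r i = T.r 0 * U := by
    have h1 : U * T.r i = wordUp T.r 1 i * wordUp T.r 0 (i + 1) := by
      rw [hU, hw T.r 0 i, zero_add, mul_assoc]
    rw [h1, r_word_word, wordUp_succ, hU, mul_assoc]
  have hUk : U * T.k i = T.k 0 * U := T.conj_k hUr
  have hUA : U * T.As 0 i = T.As 2 i * U := As_intertwine fun j hj => by
    have h1 := T.r_shift (a := 0) (l := l) (j := j) (by omega)
    have h2 := T.r_shift (a := 1) (l := l) (j := j) (by omega)
    rw [hU, mul_assoc, h1, ← mul_assoc, show 0 + j + 1 = 1 + j by ring, h2, mul_assoc,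
      show 1 + j + 1 = 2 + j by ring]
  have hUM : Commute U (wordUp (T.bar x) 0 (i + 2)) := by
    refine Commute.mul_left ?_ ?_ <;>
    exact wordUp_commute _ _ fun j h1 h2 => hx.commute_r_word (by omega) (by omega)
  have hkA : Commute (T.k i) (T.As 0 i) :=
    (As_commute fun j hj => (T.commute_k (T.rr_comm (.inr (by omega)))).symm).symm
  have hkA' : Commute (T.k 0) (T.As 2 i) :=
    (As_commute fun j hj => (T.commute_k (T.rr_comm (.inl (by omega)))).symm).symm
  have hkM : Commute (T.k 0) (wordUp (T.bar x) 2 i) :=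
    T.commute_k (wordUp_commute _ _ fun j h1 h2 =>
      (commute_r_bar hx.loc (by omega) (by omega)).symm).symm
  have hGU' : Commute U' (T.gg x) := by
    refine Commute.mul_left ?_ ?_ <;> exact wordDown_commute _ _ fun j _ _ => hG.comm_r' _
  set M := wordUp (T.bar x) 0 (i + 2) with hM
  set Y := wordUp (T.bar x) 0 i * T.As 0 i with hY
  have c1 : M * T.As 2 i * T.k 0 =
      (μ⁻¹ * μ⁻¹) • (T.gg x * T.k 0 * (wordUp (T.bar x) 2 i * T.As 2 i)) := by
    rw [hM, wordUp_succ, wordUp_succ, mul_assoc, ← hkA'.eq, ← mul_assoc, mul_assoc (T.bar x 0),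
      mul_assoc (T.bar x (0 + 1)), ← hkM.eq]
    have := bar_bar_k hg hx 0
    rw [← smul_mul_assoc, ← this]
    simp only [mul_assoc, zero_add]
  have c2 : M * T.As 2 i * T.k 0 = (μ⁻¹ * μ⁻¹) • (U * Y * U' * T.k 0 * T.gg x) := by
    have hA : T.As 2 i = U * T.As 0 i * U' := by rw [hUA, mul_assoc, hUU, mul_one]
    have hk' : T.k i * U' = U' * T.k 0 := conj_inv hUU hUU' hUk
    have hb := bar_bar_k hg hx i
    calc M * T.As 2 i * T.k 0 = U * M * (T.As 0 i * (U' * T.k 0)) := by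
          rw [hA, hUM.eq]; simp only [mul_assoc]
      _ = U * M * T.k i * (T.As 0 i * U') := by
          rw [← hk', ← mul_assoc (T.As 0 i), ← hkA.eq]; simp only [mul_assoc]
      _ = U * wordUp (T.bar x) 0 i * (T.bar x i * T.bar x (i + 1) * T.k i) * (T.As 0 i * U') := by
          rw [hM, hw, hw, zero_add, zero_add]; simp only [mul_assoc]
      _ = (μ⁻¹ * μ⁻¹) • (U * wordUp (T.bar x) 0 i * T.gg x * (T.k i * T.As 0 i * U')) := by
          rw [hb, mul_smul_comm, smul_mul_assoc]; simp only [mul_assoc]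
      _ = (μ⁻¹ * μ⁻¹) • (U * wordUp (T.bar x) 0 i * T.gg x * (T.As 0 i * U' * T.k 0)) := by
          rw [hkA.eq, mul_assoc (T.As 0 i), hk', mul_assoc (T.As 0 i)]
      _ = _ := by
          have : Commute (T.As 0 i * U' * T.k 0) (T.gg x) :=
            ((hG.comm_As _ _).mul_left hGU').mul_left (hG.comm_k _)
          rw [mul_assoc _ (T.gg x), ← this.eq, hY]; simp only [mul_assoc]
  have c3 : T.gg x * T.k 0 * (wordUp (T.bar x) 2 i * T.As 2 i) = U * Y * U' * T.k 0 * T.gg x := by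
    have hμ := hg.mu_ne
    exact smul_right_injective S (mul_ne_zero (inv_ne_zero hμ) (inv_ne_zero hμ)) (c1.symm.trans c2)
  have c4 := congrArg (T.Et 3 l) c3
  have hYo : ∀ t, i ≤ t → Y ∈ T.off t := fun t ht =>
    mul_mem (wordUp_bar_off hx.loc (by omega)) (As_off (by omega))
  rw [Et_mul_left _ fun t h1 _ => mul_mem (hG t) (T.k_off (by omega) (by omega)),
    Et_mul_right _ fun t h1 _ => hG t,
    Et_mul_right _ fun t h1 _ => T.k_off (by omega) (by omega)] at c4
  have c5 : T.Et 3 l (U * Y * U') = T.r 1 * (T.r 0 * T.Wg x 0 l * T.r' 0) * T.r' 1 := by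
    rw [Wg, ← Et_shift_r 0 l (fun t ht => hYo t (by omega)), ← Et_shift_r 1 l, hU, hU']
    · simp only [mul_assoc, ← hi]
    · intro t ht
      refine mul_mem (mul_mem ?_ (hYo t (by omega))) ?_
      · exact wordUp_induction (p := fun z => z ∈ T.off _) (one_mem _) (fun _ _ => mul_mem) _ _
          fun j _ _ => T.r_off (by omega) (by omega)
      · exact wordDown_induction (p := fun z => z ∈ T.off _) (one_mem _) (fun _ _ => mul_mem) _ _
          fun j _ _ => T.r'_off (by omega) (by omega)
  rw [c5] at c4
  have hb := T.bmw 0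
  have hkW : Commute (T.k 1) (T.Wg x 0 l) := T.commute_k (commute_r_bar hL (t := 0) (by omega)
    (by omega))
  rw [← mul_assoc (T.gg x)]
  refine c4.trans ?_
  congr 1
  calc T.r 1 * (T.r 0 * T.Wg x 0 l * T.r' 0) * T.r' 1 * T.k 0
      = T.r 1 * T.r 0 * T.Wg x 0 l * (T.r' 0 * T.r' 1 * T.k 0) := by simp only [mul_assoc]
    _ = T.r 1 * T.r 0 * (T.k 1 * T.Wg x 0 l) * T.k 0 := by
        rw [hb.rsk', hkW.eq]; simp only [mul_assoc, zero_add]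
    _ = T.k 0 * (T.k 1 * T.Wg x 0 l) * T.k 0 := by
        rw [← mul_assoc _ (T.k 1)]
        have := hb.srl
        rw [zero_add] at this
        rw [this]; simp only [mul_assoc]
    _ = _ := by rw [hkW.eq]; simp only [mul_assoc]

theorem gg_comm_aa (hg : Generic q μ n) (hx : T.QM x) (l : ℕ) : Commute (T.gg x) (T.aa x l) := by
  have hG := gg_scal hx.loc
  cases l with
  | zero => exact Commute.one_right _
  | succ l =>
    have hL := Wg_loc hx.loc l
    have ha : T.Scal (T.aa x (l + 1)) := aa_scal hx.loc _
    rcases T.k_or with hk | hk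
    · have : T.gg x = 0 := by rw [gg, hk, mul_zero, map_zero, map_zero, smul_zero]
      rw [this]; exact Commute.zero_left _
    · have h := congrArg (T.E 2) (gg_k_Wg hg hx l)
      have k2 : T.k 0 ∈ T.off 2 := T.k_off (by omega) (by omega)
      have e1 := hk 1
      rw [show 1 + 1 = 2 from rfl] at e1
      rw [T.E_mul_left _ (hG 2), T.E_mul_left _ k2, Wg_eq_bar hx.loc, E_bar hL,
        T.E_mul_right _ (hG 2), T.E_mul_right _ k2, T.E_mul_left _ (mul_mem k2 (hL 2 (by omega))),
        e1, mul_smul_comm, mul_one, smul_mul_assoc, T.k_sandwich,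
        T.E_mul_left _ (hL (0 + 1) (by omega)), hk, mul_smul_comm, mul_one, map_smul] at h
      simp only [smul_mul_assoc, smul_smul] at h
      rw [show μ * (μ⁻¹ * μ⁻¹ * μ) = 1 by have := hg.mu_ne; field_simp, one_smul] at h
      have h2 : T.gg x * T.aa x (l + 1) * T.k 0 = T.aa x (l + 1) * T.gg x * T.k 0 := by
        rw [mul_assoc, ← (ha.comm_k 0).eq, mul_assoc _ (T.gg x), ← (hG.comm_k 0).eq, ← mul_assoc]
        rw [← mul_assoc] at h
        exact h.trans (by rw [mul_assoc]; rfl)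
      have h3 := congrArg (T.E 1) h2
      have e0 := hk 0
      rw [zero_add] at e0
      rw [T.E_mul_left _ (mul_mem (hG 1) (ha 1)), T.E_mul_left _ (mul_mem (ha 1) (hG 1)), e0,
        mul_smul_comm, mul_smul_comm, mul_one, mul_one] at h3
      exact smul_right_injective S hg.mu_ne h3

end Tower

end

section

namespace Tower

variable {S : Type*} [Ring S] [Algebra ℂ S] {q μ : ℂ} (T : Tower q μ S)

/-- The map `φ` on elements of strand `0`. -/
def phiT : S →ₗ[ℂ] S :=
  T.E 1 ∘ₗ LinearMap.mulRight ℂ (T.r 0) ∘ₗ LinearMap.mulRight ℂ (T.f' 0) ∘ₗ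
    LinearMap.mulLeft ℂ (T.f 0)

/-- The map `ξ` on elements of strand `0`. -/
def xiT : S →ₗ[ℂ] S :=
  T.E 1 ∘ₗ LinearMap.mulRight ℂ (T.k 0) ∘ₗ LinearMap.mulRight ℂ (T.f' 0) ∘ₗ
    LinearMap.mulLeft ℂ (T.f 0)

/-- The map `y ↦ x * φ y`. -/
def LT (x : S) : S →ₗ[ℂ] S := LinearMap.mulLeft ℂ x ∘ₗ T.phiT

/-- The star powers of `x`. -/
def Ps (x : S) : ℕ → S
  | 0 => 1
  | n + 1 => T.LT x (Ps x n)

variable {T} {x y z : S}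

theorem phiT_apply (y : S) : T.phiT y = T.E 1 (T.f 0 * y * T.f' 0 * T.r 0) := rfl

theorem xiT_apply (y : S) : T.xiT y = T.E 1 (T.f 0 * y * T.f' 0 * T.k 0) := rfl

theorem LT_apply (x y : S) : T.LT x y = x * T.phiT y := rfl

theorem phiT_mul_scal (hz : T.Scal z) (y : S) : T.phiT (y * z) = T.phiT y * z := by
  have h : T.f 0 * (y * z) * T.f' 0 * T.r 0 = T.f 0 * y * T.f' 0 * T.r 0 * z := by
    have h1 := (hz.comm_r 0).eq
    have h2 := (hz.comm_f' 0).eq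
    rw [mul_assoc _ (T.r 0) z, h1, ← mul_assoc (T.f 0 * y * T.f' 0), mul_assoc _ (T.f' 0) z, h2]
    simp only [mul_assoc]
  rw [phiT_apply, h, T.E_mul_right _ (hz 1), phiT_apply]

theorem LT_mul_scal (hz : T.Scal z) (x y : S) : T.LT x (y * z) = T.LT x y * z := by
  rw [LT_apply, phiT_mul_scal hz, ← mul_assoc, LT_apply]

theorem LT_iter_mul_scal (hz : T.Scal z) (x : S) (m : ℕ) (y : S) :
    (T.LT x ^ m) (y * z) = (T.LT x ^ m) y * z := by
  induction m generalizing y with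
  | zero => rfl
  | succ m ih => rw [pow_succ, Module.End.mul_apply, LT_mul_scal hz, ih, Module.End.mul_apply]

theorem Ps_one (x : S) : T.Ps x 1 = x := by
  have := T.E_r 0
  rw [Ps, Ps, LT_apply, phiT_apply, mul_one, T.f_mul_inv, one_mul, ← zero_add 1, this, mul_one]

theorem LT_iter_self (x : S) (m : ℕ) : (T.LT x ^ m) x = T.Ps x (m + 1) := by
  induction m with
  | zero => exact (Ps_one x).symm
  | succ m ih => rw [pow_succ', Module.End.mul_apply, ih]; rfl

variable {n : ℕ}

theorem xiT_self (hg : Generic q μ n) (hx : T.QM x) : x * T.xiT x = μ⁻¹ • T.gg x := by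
  have h := bar_bar_k hg hx 0
  have e : x * T.xiT x = T.E 1 (T.bar x 0 * T.bar x (0 + 1) * T.k 0) := by
    rw [xiT_apply, ← T.E_mul_left _ (hx.loc 1 le_rfl), ← mul_assoc]; rfl
  have hG := gg_scal hx.loc
  rw [e, h, map_smul, T.E_mul_left _ (hG 1)]
  rcases T.k_or with hk | hk
  · have : T.gg x = 0 := by rw [gg, hk, mul_zero, map_zero, map_zero, smul_zero]
    rw [this, zero_mul, smul_zero, smul_zero]
  · have := hk 0
    rw [zero_add] at this
    rw [this, mul_smul_comm, mul_one, smul_smul, mul_assoc, inv_mul_cancel₀ hg.mu_ne, mul_one]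

theorem f_Wg (hx : T.Loc x) (l : ℕ) : T.Wg x 1 l = T.f 0 * T.Wg x 0 l * T.f' 0 := Wg_succ hx 0 l

theorem E_Wg_one (hx : T.Loc x) (l : ℕ) : T.E 1 (T.Wg x 1 l) = T.aa x (l + 1) := by
  rw [Wg_eq_bar hx, E_bar (Wg_loc hx l), aa]

/-- Recursion for the antisymmetrized products. -/
theorem Wg_rec (hg : Generic q μ n) (hx : T.QM x) (l : ℕ) (hn : l + 2 ≤ n) :
    T.Wg x 0 (l + 1) = (q ^ (l + 1) / nq q (l + 2)) • (x * T.aa x (l + 1) +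
      ((q ^ (-(2 * ((l + 1 : ℕ) : ℤ))) - 1) / (q - q⁻¹)) • (x * T.phiT (T.Wg x 0 l)) +
      (μ * (q ^ (-(2 * ((l + 1 : ℕ) : ℤ))) - 1) / (μ + q * q ^ (-(2 * ((l + 1 : ℕ) : ℤ))))) •
        (x * T.xiT (T.Wg x 0 l))) := by
  set M := wordUp (T.bar x) 0 (l + 2) with hM
  set B := T.As 1 (l + 1) with hB
  have hBM : Commute B M := As_commute fun j hj => hx.commute_r_word (by omega) (by omega)
  have hBc : T.Cyc 1 (l + 1) B := cyc_As le_rfl le_rfl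
  have hBB : B * B = B := As_idem hg (by omega)
  have h1 : T.Wg x 0 (l + 1) = (q ^ (l + 1) / nq q (l + 2)) •
      T.Et 1 (l + 1) (M * B * T.sig 0 (l + 1)) := by
    rw [Wg, T.As_succ_left hg 0 l hn, mul_smul_comm, map_smul, zero_add, ← mul_assoc, ← hBc,
      ← mul_assoc, ← mul_assoc, ← hM, hBM.eq, mul_assoc M B B, hBB]
  have h2 : T.Et 1 (l + 1) (M * B * T.sig 0 (l + 1)) = x * T.E 1 (T.Wg x 1 l * T.sig 0 (l + 1)) := by
    have e : M * B * T.sig 0 (l + 1) = x * (wordUp (T.bar x) 1 (l + 1) * B * T.sig 0 (l + 1)) := by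
      rw [hM, wordUp_succ]; simp only [mul_assoc, bar, zero_add]
    rw [e, Et_mul_left _ fun t h1 _ => hx.loc t h1, Et_succ',
      Et_mul_right _ fun t h1 _ => sig_off (by omega) (by omega)]
    rfl
  rw [h1, h2, sig, baxt, mul_add, mul_add, mul_one, map_add, map_add, E_Wg_one hx.loc,
    mul_smul_comm, mul_smul_comm, map_smul, map_smul, f_Wg hx.loc, mul_add, mul_add, mul_smul_comm,
    mul_smul_comm]
  rfl

theorem E_E_k_k (hk : ∀ p, T.E (p + 1) (T.k p) = μ • (1 : S)) (h2 : z ∈ T.off 2)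
    (h3 : z ∈ T.off 3) : T.E 2 (T.E 3 (z * T.k 2 * T.k 1)) = (μ * μ) • z := by
  rw [T.E_mul_right _ (T.k_off (by omega) (by omega)), T.E_mul_left _ h3, hk 2, mul_smul_comm,
    mul_one, smul_mul_assoc, map_smul, T.E_mul_left _ h2, hk 1, mul_smul_comm, mul_one, smul_smul]

theorem k_word_reduction (hg : Generic q μ n) (c d : ℂ) :
    T.k 2 * T.k 1 * T.r 0 * (1 + c • T.r 2 + d • T.k 2) * T.k 1 =
      (((1 + c * (q - q⁻¹)) * μ⁻¹) • 1 + c • T.k 0 + (d - c * (q - q⁻¹)) • T.r 0) *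
        T.k 2 * T.k 1 := by
  have b0 := T.bmw 0
  have b1 := T.bmw 1
  simp only [zero_add, show 1 + 1 = 2 from rfl] at b0 b1
  have c1 : T.k 1 * T.r 0 * T.k 1 = μ⁻¹ • T.k 1 := b0.symm.ksk hg.mu_ne
  have cr : Commute (T.r 2) (T.r 0) := T.rr_comm (.inr (by omega))
  have ckr : Commute (T.k 2) (T.r 0) := T.commute_k cr
  have ckk : Commute (T.k 2) (T.k 0) := (T.commute_k ckr.symm).symm
  have e1 : T.k 2 * T.k 1 * T.r 0 * T.k 1 = μ⁻¹ • (T.k 2 * T.k 1) := by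
    rw [mul_assoc, mul_assoc, ← mul_assoc (T.k 1), c1, mul_smul_comm]
  have e2 : T.k 2 * T.k 1 * T.r 0 * T.k 2 * T.k 1 = T.r 0 * T.k 2 * T.k 1 := by
    rw [mul_assoc _ (T.r 0), ← ckr.eq, ← mul_assoc, b1.lkl, ckr.eq]
  have e3 : T.k 2 * T.k 1 * T.r 0 * T.r 2 * T.k 1 = T.k 0 * T.k 2 * T.k 1 -
      (q - q⁻¹) • (T.r 0 * T.k 2 * T.k 1) + ((q - q⁻¹) * μ⁻¹) • (T.k 2 * T.k 1) := by
    have h := b0.srl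
    rw [mul_assoc _ (T.r 0), ← cr.eq, ← mul_assoc, b1.lks, b1.skein_r, mul_add, mul_sub,
      add_mul, add_mul, sub_mul, sub_mul, mul_assoc, mul_assoc, ← mul_assoc (T.r 1), h,
      mul_smul_comm, mul_smul_comm, mul_one, smul_mul_assoc, smul_mul_assoc, smul_mul_assoc,
      smul_mul_assoc, e1, smul_smul, ckr.eq, ← mul_assoc, ckk.eq]
  simp only [mul_add, add_mul, mul_smul_comm, smul_mul_assoc, mul_one, one_mul, e1, e2, e3]
  module

/-- Recursion for the contracted antisymmetrized products. -/
theorem xiT_rec (hg : Generic q μ n) (hx : T.QM x) (l : ℕ) (hn : l + 2 ≤ n) :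
    T.LT x (x * T.xiT (T.Wg x 0 (l + 1))) = (q ^ (l + 1) / nq q (l + 2)) • (x *
      ((μ⁻¹ * q ^ (-(2 * ((l + 1 : ℕ) : ℤ)))) • T.aa x (l + 1) +
      ((q ^ (-(2 * ((l + 1 : ℕ) : ℤ))) - 1) / (q - q⁻¹)) • T.xiT (T.Wg x 0 l) +
      (μ * (q ^ (-(2 * ((l + 1 : ℕ) : ℤ))) - 1) / (μ + q * q ^ (-(2 * ((l + 1 : ℕ) : ℤ)))) -
        (q ^ (-(2 * ((l + 1 : ℕ) : ℤ))) - 1)) • T.phiT (T.Wg x 0 l))) * T.gg x := by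
  have hG := gg_scal hx.loc
  rcases T.k_or with hk | hk
  · have h1 : T.gg x = 0 := by rw [gg, hk, mul_zero, map_zero, map_zero, smul_zero]
    rw [xiT_apply, hk, mul_zero, map_zero, mul_zero, map_zero, h1, mul_zero]
  set X := q ^ (-(2 * ((l + 1 : ℕ) : ℤ))) with hX
  set c := q ^ (l + 1) / nq q (l + 2) with hc
  set M := wordUp (T.bar x) 0 (l + 3) with hM
  set M2 := wordUp (T.bar x) 2 (l + 1) with hM2
  set B := T.As 1 (l + 2) with hB
  set A := T.As 2 (l + 1) with hA
  set W := T.Wg x 0 l with hW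
  have hL : T.Loc W := Wg_loc hx.loc l
  have hBM : Commute B M := As_commute fun j hj => hx.commute_r_word (by omega) (by omega)
  have hBc : T.Cyc 1 (l + 2) B := cyc_As le_rfl le_rfl
  have hAc : T.Cyc 1 (l + 2) A := cyc_As (by omega) (by omega)
  have hAA : A * A = A := As_idem hg (by omega)
  have hkA : Commute (T.k 0) A :=
    (As_commute fun j hj => (T.commute_k (T.rr_comm (.inl (by omega)))).symm).symm
  have hkM : Commute (T.k 0) M2 :=
    T.commute_k (wordUp_commute _ _ fun j h1 h2 =>
      (commute_r_bar hx.loc (by omega) (by omega)).symm).symm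
  have hAM : Commute A M2 := As_commute fun j hj => hx.commute_r_word (by omega) (by omega)
  have hMk : M * T.k 0 = (μ⁻¹ * μ⁻¹) • (T.gg x * (T.k 0 * M2)) := by
    have := bar_bar_k hg hx 0
    rw [← mul_assoc, ← smul_mul_assoc, ← this, hM, wordUp_succ, wordUp_succ]
    simp only [zero_add]
    rw [mul_assoc, mul_assoc, ← hkM.eq]
    simp only [mul_assoc]
  set Y := T.k 0 * W * T.k 1 * T.k 0 * T.sig 1 (l + 1) with hY
  have n1 : x * T.xiT (T.Wg x 0 (l + 1)) = T.Et 1 (l + 2) (M * B * T.k 0) := by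
    have e : M * B * T.k 0 = x * (wordUp (T.bar x) 1 (l + 2) * B * T.k 0) := by
      rw [hM, wordUp_succ]; simp only [mul_assoc, bar, zero_add]
    rw [e, Et_mul_left _ fun t h1 _ => hx.loc t h1, Et_succ',
      Et_mul_right _ fun t h1 _ => T.k_off (by omega) (by omega), xiT_apply, ← f_Wg hx.loc]
    rfl
  have n2 : T.Et 1 (l + 2) (M * B * T.k 0) = (c * (μ⁻¹ * μ⁻¹)) • (T.E 1 (T.E 2 Y) * T.gg x) := by
    have hBd : B = c • (A * T.sig 1 (l + 1) * A) := T.As_succ_left hg 1 l hn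
    have e1 : T.Et 1 (l + 2) (M * B * T.k 0) =
        (μ⁻¹ * μ⁻¹) • (T.gg x * T.Et 1 (l + 2) (T.k 0 * M2 * B)) := by
      rw [← hBM.eq, mul_assoc, hBc, hMk, smul_mul_assoc, map_smul, mul_assoc,
        Et_mul_left _ fun t _ _ => hG t]
    have e2 : T.Et 1 (l + 2) (T.k 0 * M2 * B) =
        c • T.Et 1 (l + 2) (T.k 0 * (M2 * A * T.sig 1 (l + 1))) := by
      rw [hBd, mul_smul_comm, map_smul, ← mul_assoc _ _ A, ← hAc]
      congr 2
      calc A * (T.k 0 * M2 * (A * T.sig 1 (l + 1)))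
          = A * T.k 0 * M2 * A * T.sig 1 (l + 1) := by simp only [mul_assoc]
        _ = T.k 0 * (A * M2) * A * T.sig 1 (l + 1) := by rw [← hkA.eq]; simp only [mul_assoc]
        _ = T.k 0 * M2 * (A * A) * T.sig 1 (l + 1) := by rw [hAM.eq]; simp only [mul_assoc]
        _ = _ := by rw [hAA]; simp only [mul_assoc]
    have e3 : T.gg x * T.Et 1 (l + 2) (T.k 0 * (M2 * A * T.sig 1 (l + 1))) =
        T.E 1 (T.E 2 Y) * T.gg x := by
      rw [Et_succ', Et_succ', show 1 + 1 = 2 from rfl, show 2 + 1 = 3 from rfl,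
        Et_mul_left _ fun t h1 _ => T.k_off (by omega) (by omega),
        Et_mul_right _ fun t h1 _ => sig_off (by omega) (by omega),
        ← T.E_mul_left _ (hG 1), ← T.E_mul_left _ (hG 2), ← mul_assoc, ← mul_assoc]
      have h : T.gg x * T.k 0 * T.Et 3 l (M2 * A) = T.k 0 * W * T.k 1 * T.k 0 * T.gg x := by
        rw [mul_assoc]; exact gg_k_Wg hg hx l
      have hs : Commute (T.sig 1 (l + 1)) (T.gg x) := sig_commute (hG.comm_r 1)
      rw [h, mul_assoc _ (T.gg x), ← hs.eq, ← mul_assoc, T.E_mul_right _ (hG 2),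
        T.E_mul_right _ (hG 1)]
    rw [e1, e2, mul_smul_comm, smul_smul, mul_comm c, e3]
  set V := wordUp T.f 0 3 with hV
  set V' := wordDown T.f' 0 3 with hV'
  have hVV : V * V' = 1 := wordUp_mul_wordDown T.f_mul_inv 0 3
  have hYo : ∀ t, 3 ≤ t → Y ∈ T.off t := fun t ht =>
    mul_mem (mul_mem (mul_mem (mul_mem (T.k_off (by omega) (by omega)) (hL t (by omega)))
      (T.k_off (by omega) (by omega))) (T.k_off (by omega) (by omega)))
      (sig_off (by omega) (by omega))
  have n3 : T.f 0 * T.E 1 (T.E 2 Y) * T.f' 0 = T.E 2 (T.E 3 (V * Y * V')) :=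
    (Et_shift_f 0 2 (fun t ht => hYo t (by omega))).symm
  have vr0 : V * T.r 0 = T.r 1 * V := T.f_shift (a := 0) (l := 2) (j := 0) (by omega)
  have vr1 : V * T.r 1 = T.r 2 * V := T.f_shift (a := 0) (l := 2) (j := 1) (by omega)
  set W1 := T.f 0 * W * T.f' 0 with hW1
  have hVW : V * W = W1 * V := by
    have c1 : Commute (T.f 1) W := T.f_comm (hL 1 (by omega)) (hL 2 (by omega))
    have c2 : Commute (T.f 2) W := T.f_comm (hL 2 (by omega)) (hL 3 (by omega))
    have : V = T.f 0 * (T.f 1 * T.f 2) := by simp [hV, wordUp, mul_assoc]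
    rw [this, hW1, mul_assoc, (c1.mul_left c2).eq, ← mul_assoc (T.f 0 * W * T.f' 0),
      mul_assoc _ (T.f' 0), T.inv_mul_f, mul_one]
    simp only [mul_assoc]
  have n4 : V * Y * V' = T.k 1 * (W1 * T.k 2 * T.k 1 * T.sig 2 (l + 1)) := by
    have k0 := T.conj_k vr0
    have k1 := T.conj_k vr1
    have s1 : V * T.sig 1 (l + 1) = T.sig 2 (l + 1) * V := sig_intertwine vr1
    have : V * Y = T.k 1 * (W1 * T.k 2 * T.k 1 * T.sig 2 (l + 1)) * V := by
      rw [hY]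
      simp only [← mul_assoc]
      rw [k0, mul_assoc _ V, hVW, ← mul_assoc, mul_assoc _ V, k1, ← mul_assoc, mul_assoc _ V, k0,
        ← mul_assoc, mul_assoc _ V, s1, ← mul_assoc]
    rw [this, mul_assoc _ V, hVV, mul_one]
  have W1o : ∀ t, 2 ≤ t → W1 ∈ T.off t := fun t ht =>
    mul_mem (mul_mem (T.f_off (by omega) (by omega)) (hL t (by omega)))
      (T.f'_off (by omega) (by omega))
  have n5 : T.phiT (T.E 1 (T.E 2 Y)) = (μ * μ) • (((1 + (X - 1) / (q - q⁻¹) * (q - q⁻¹)) * μ⁻¹) •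
      T.aa x (l + 1) + ((X - 1) / (q - q⁻¹)) • T.xiT W +
      (μ * (X - 1) / (μ + q * X) - (X - 1) / (q - q⁻¹) * (q - q⁻¹)) • T.phiT W) := by
    have hcy : T.Cyc 1 3 (T.k 1) := cyc_k le_rfl (by omega)
    have hr2 : T.r 0 ∈ T.off 2 := T.r_off (by omega) (by omega)
    have hr3 : T.r 0 ∈ T.off 3 := T.r_off (by omega) (by omega)
    have e1 : T.phiT (T.E 1 (T.E 2 Y)) =
        T.Et 1 3 (T.k 1 * (W1 * T.k 2 * T.k 1 * T.sig 2 (l + 1)) * T.r 0) := by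
      rw [phiT_apply, n3, n4, ← T.E_mul_right _ hr2, ← T.E_mul_right _ hr3]; rfl
    have hsr : Commute (T.sig 2 (l + 1)) (T.r 0) := sig_commute (T.rr_comm (.inr (by omega)))
    have e2 : W1 * T.k 2 * T.k 1 * T.sig 2 (l + 1) * T.r 0 * T.k 1 = W1 *
        (T.k 2 * T.k 1 * T.r 0 * T.sig 2 (l + 1) * T.k 1) := by
      rw [mul_assoc _ _ (T.r 0), hsr.eq]; simp only [mul_assoc]
    have e3 : ∀ Z, T.Et 1 3 Z = T.E 1 (T.E 2 (T.E 3 Z)) := fun _ => rfl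
    have zo : ∀ t, 2 ≤ t → ∀ c1 c2 c3 : ℂ,
        W1 * (c1 • 1 + c2 • T.k 0 + c3 • T.r 0) ∈ T.off t := fun t ht c1 c2 c3 =>
      mul_mem (W1o t ht) (add_mem (add_mem (Subalgebra.smul_mem _ (one_mem _) _)
        (Subalgebra.smul_mem _ (T.k_off (by omega) (by omega)) _))
        (Subalgebra.smul_mem _ (T.r_off (by omega) (by omega)) _))
    rw [e1, mul_assoc, hcy, e2, sig, baxt, k_word_reduction hg, ← mul_assoc, ← mul_assoc, e3,
      E_E_k_k hk (zo 2 le_rfl _ _ _) (zo 3 (by omega) _ _ _), map_smul, mul_add, mul_add,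
      mul_smul_comm, mul_smul_comm, mul_smul_comm, map_add, map_add, map_smul, map_smul, map_smul,
      mul_one, ← E_Wg_one hx.loc, f_Wg hx.loc]
    rfl
  have hμ := hg.mu_ne
  rw [n1, n2, map_smul, LT_mul_scal hG, LT_apply, n5, ← smul_mul_assoc]
  congr 1
  rw [mul_smul_comm, smul_smul, div_mul_cancel₀ _ hg.lam_ne,
    show c * (μ⁻¹ * μ⁻¹) * (μ * μ) = c by field_simp]
  congr 5
  ring

end Tower

end

section

theorem Generic.theta_ne {q μ : ℂ} {n : ℕ} (h : Generic q μ n) {l : ℕ} (hl : l + 2 ≤ n) :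
    1 + μ * q ^ (2 * l + 1) ≠ 0 := by
  intro h0
  apply h.den_ne (l + 1) (by omega) (by omega)
  have hq := h.q_ne
  have e : q * q ^ (-(2 * ((l + 1 : ℕ) : ℤ))) = (q ^ (2 * l + 1))⁻¹ := by
    rw [← zpow_natCast, ← _root_.zpow_neg, ← zpow_one_add₀ hq]; congr 1
  rw [e, ← mul_right_inj' (pow_ne_zero (2 * l + 1) hq), mul_zero, mul_add,
    mul_inv_cancel₀ (pow_ne_zero _ hq), mul_comm, add_comm]
  exact h0

/-- The scalar in front of the inner sums of the Cayley–Hamilton–Newton expansions. -/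
def kap (q μ : ℂ) (i : ℕ) : ℂ := (1 - q ^ (-2 : ℤ)) / (1 + μ * q ^ (2 * (i : ℤ) - 3))

theorem kap_add_two (q μ : ℂ) (l : ℕ) :
    kap q μ (l + 2) = (1 - (q ^ 2)⁻¹) / (1 + μ * q ^ (2 * l + 1)) := by
  have : 2 * ((l + 2 : ℕ) : ℤ) - 3 = ((2 * l + 1 : ℕ) : ℤ) := by push_cast; ring
  rw [kap, this, zpow_natCast, _root_.zpow_neg]
  rfl

section Inner
variable {S : Type*} [Ring S] [Algebra ℂ S]

/-- The inner sum of the Cayley–Hamilton–Newton expansions. -/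
def innerSum (q : ℂ) (P : ℕ → S) (G : S) (M D : ℕ) : S :=
  ∑ r ∈ Finset.Icc 1 D, P (M - 2 * r) * (q ^ 2 • G) ^ r

variable (q : ℂ) (P : ℕ → S) (G : S)

theorem innerSum_zero (M : ℕ) : innerSum q P G M 0 = 0 := by simp [innerSum]

theorem innerSum_succ (M D : ℕ) : innerSum q P G M (D + 1) =
    innerSum q P G M D + q ^ (2 * (D + 1)) • (P (M - 2 * (D + 1)) * G ^ (D + 1)) := by
  rw [innerSum, Finset.sum_Icc_succ_top (by omega), smul_pow, mul_smul_comm, ← pow_mul]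
  rfl

theorem innerSum_shift (M D : ℕ) : innerSum q P G (M + 2) (D + 1) =
    q ^ 2 • (P M * G + innerSum q P G M D * G) := by
  induction D with
  | zero => simp [innerSum]
  | succ D ih =>
    rw [innerSum_succ, ih, innerSum_succ q P G M D, show M + 2 - 2 * (D + 1 + 1) = M - 2 * (D + 1) by omega,
      add_mul, smul_mul_assoc, mul_assoc (P _), ← pow_succ, ← add_assoc, smul_add _ _ (_ • _),
      smul_smul, ← pow_add]
    congr 3
    omega

variable {q} {μ : ℂ} {n : ℕ}

theorem innerSum_recursion_A (hg : Generic q μ n) (j D m : ℕ) (hn : j + D + 2 ≤ n) :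
    P (m + D + 2) + kap q μ (j + D + 2) • innerSum q P G (m + D + 2) (D + 1) =
      P (m + D + 2) + kap q μ (j + D + 1) • innerSum q P G (m + D + 2) D +
      ((q - q⁻¹) * μ * q ^ (2 * (j + D) + 1) / (1 + μ * q ^ (2 * (j + D) + 1))) •
        ((μ⁻¹ * q ^ (-(2 * (j : ℤ)))) • (P (m - D) * G ^ (D + 1)) -
          (q⁻¹ * kap q μ (j + D + 1)) • innerSum q P G (m + D + 2) D) := by
  have hq := hg.q_ne
  have hμ := hg.mu_ne
  have hθ := hg.theta_ne hn
  have h1 : kap q μ (j + D + 2) * q ^ (2 * (D + 1)) =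
      (q - q⁻¹) * μ * q ^ (2 * (j + D) + 1) / (1 + μ * q ^ (2 * (j + D) + 1)) *
        (μ⁻¹ * q ^ (-(2 * (j : ℤ)))) := by
    have : q ^ (-(2 * (j : ℤ))) = (q ^ (2 * j))⁻¹ := by
      rw [_root_.zpow_neg]; norm_cast
    rw [kap_add_two, this]
    field_simp
    ring
  have h2 : kap q μ (j + D + 2) • innerSum q P G (m + D + 2) D =
      (kap q μ (j + D + 1) - (q - q⁻¹) * μ * q ^ (2 * (j + D) + 1) /
        (1 + μ * q ^ (2 * (j + D) + 1)) * (q⁻¹ * kap q μ (j + D + 1))) •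
        innerSum q P G (m + D + 2) D := by
    rcases D with _ | D
    · rw [innerSum_zero, smul_zero, smul_zero]
    · congr 1
      have hθ' := hg.theta_ne (l := j + D) (by omega)
      rw [show j + (D + 1) + 1 = j + D + 2 by omega, kap_add_two, kap_add_two]
      rw [show 2 * (j + (D + 1)) + 1 = 2 * (j + D) + 1 + 2 by omega, pow_add q (2 * (j + D) + 1) 2] at hθ ⊢
      generalize q ^ (2 * (j + D) + 1) = u at hθ hθ' ⊢
      have hθ₁ : 1 + q ^ 2 * μ * u ≠ 0 := by convert hθ using 2; ring
      field_simp
      ring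
  rw [innerSum_succ, show m + D + 2 - 2 * (D + 1) = m - D by omega, smul_add, h2]
  linear_combination (norm := module) h1 • (P (m - D) * G ^ (D + 1))

theorem innerSum_recursion_B (hg : Generic q μ n) (j D m : ℕ) (hn : j + D + 2 ≤ n) :
    (μ⁻¹ * q ^ (-(2 * (j : ℤ)))) • (P (m - D) * G ^ (D + 2)) -
      (q⁻¹ * kap q μ (j + D + 2)) • innerSum q P G (m + D + 4) (D + 1) =
    (-((q - q⁻¹) / (1 + μ * q ^ (2 * (j + D) + 1))) •
      (P (m + D + 2) + kap q μ (j + D + 1) • innerSum q P G (m + D + 2) D) +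
      ((μ⁻¹ * q ^ (-(2 * (j : ℤ)))) • (P (m - D) * G ^ (D + 1)) -
        (q⁻¹ * kap q μ (j + D + 1)) • innerSum q P G (m + D + 2) D)) * G := by
  have hq := hg.q_ne
  have hθ := hg.theta_ne hn
  have h1 : q⁻¹ * kap q μ (j + D + 2) * q ^ 2 = (q - q⁻¹) / (1 + μ * q ^ (2 * (j + D) + 1)) := by
    rw [kap_add_two]
    field_simp
  have h2 : (q⁻¹ * kap q μ (j + D + 2) * q ^ 2) • innerSum q P G (m + D + 2) D =
      ((q - q⁻¹) / (1 + μ * q ^ (2 * (j + D) + 1)) * kap q μ (j + D + 1) +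
        q⁻¹ * kap q μ (j + D + 1)) • innerSum q P G (m + D + 2) D := by
    rcases D with _ | D
    · rw [innerSum_zero, smul_zero, smul_zero]
    · congr 1
      have hθ' := hg.theta_ne (l := j + D) (by omega)
      rw [show j + (D + 1) + 1 = j + D + 2 by omega, kap_add_two, kap_add_two]
      rw [show 2 * (j + (D + 1)) + 1 = 2 * (j + D) + 1 + 2 by omega, pow_add q (2 * (j + D) + 1) 2] at hθ ⊢
      generalize q ^ (2 * (j + D) + 1) = u at hθ hθ' ⊢
      have hθ₁ : 1 + q ^ 2 * μ * u ≠ 0 := by convert hθ using 2; ring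
      field_simp
      ring
  have h3 := congrArg (· * G) h2
  simp only [smul_mul_assoc] at h3
  rw [innerSum_shift]
  simp only [smul_add, add_mul, sub_mul, smul_mul_assoc, mul_assoc (P _), ← pow_succ]
  linear_combination (norm := module) -h3 - h1 • (P (m + D + 2) * G)

end Inner

namespace Tower

variable {S : Type*} [Ring S] [Algebra ℂ S] {q μ : ℂ} {T : Tower q μ S} {x : S} {n : ℕ}

theorem nq_one (hg : Generic q μ n) : nq q 1 = 1 := by
  have := hg.lam_ne
  simp [nq, div_self this]

variable (T) in
/-- The descendants `A`. -/
def dA (x : S) (m l : ℕ) : S := nq q (l + 1) • (T.LT x ^ m) (T.Wg x 0 l)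

variable (T) in
/-- The descendants `B`. -/
def dB (x : S) (m l : ℕ) : S := nq q (l + 1) • (T.LT x ^ m) (x * T.xiT (T.Wg x 0 l))

theorem Wg_zero (x : S) : T.Wg x 0 0 = x := by
  simp [Wg, Et, wordUp, As, bar]

theorem dA_zero (hg : Generic q μ n) (x : S) (m : ℕ) : T.dA x m 0 = T.Ps x (m + 1) := by
  rw [dA, nq_one hg, one_smul, Wg_zero, LT_iter_self]

theorem dB_zero (hg : Generic q μ n) (hx : T.QM x) (m : ℕ) :
    T.dB x m 0 = μ⁻¹ • (T.Ps x m * T.gg x) := by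
  have h : ∀ m, (T.LT x ^ m) 1 = T.Ps x m := by
    intro m
    induction m with
    | zero => rfl
    | succ m ih => rw [pow_succ', Module.End.mul_apply, ih]; rfl
  rw [dB, nq_one hg, one_smul, Wg_zero, xiT_self hg hx, map_smul, ← one_mul (T.gg x),
    LT_iter_mul_scal (gg_scal hx.loc), h, one_mul]

theorem scal_unit (hg : Generic q μ n) (l : ℕ) :
    q ^ (l + 1) * (μ⁻¹ * q ^ (-(2 * ((l + 1 : ℕ) : ℤ)))) = μ⁻¹ * (q ^ (l + 1))⁻¹ := by
  have e : q ^ (-(2 * ((l + 1 : ℕ) : ℤ))) = (q ^ (l + 1))⁻¹ * (q ^ (l + 1))⁻¹ := by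
    rw [_root_.zpow_neg, ← mul_inv, ← pow_add]; norm_cast; congr 2; ring
  have hq := pow_ne_zero (l + 1) hg.q_ne
  rw [e]
  field_simp

theorem scal_r (hg : Generic q μ n) (l : ℕ) :
    q ^ (l + 1) * ((q ^ (-(2 * ((l + 1 : ℕ) : ℤ))) - 1) / (q - q⁻¹)) = -nq q (l + 1) := by
  have e : q ^ (-(2 * ((l + 1 : ℕ) : ℤ))) = (q ^ (l + 1))⁻¹ * (q ^ (l + 1))⁻¹ := by
    rw [_root_.zpow_neg, ← mul_inv, ← pow_add]; norm_cast; congr 2; ring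
  have hq := pow_ne_zero (l + 1) hg.q_ne
  have hl := hg.lam_ne
  rw [e, nq, _root_.zpow_neg, zpow_natCast]
  generalize q - q⁻¹ = t at hl
  field_simp
  ring

theorem scal_k (hg : Generic q μ n) (l : ℕ) (hn : l + 2 ≤ n) :
    q ^ (l + 1) * (μ * (q ^ (-(2 * ((l + 1 : ℕ) : ℤ))) - 1) /
      (μ + q * q ^ (-(2 * ((l + 1 : ℕ) : ℤ))))) =
      -((q - q⁻¹) * μ * q ^ (2 * l + 1) / (1 + μ * q ^ (2 * l + 1)) * nq q (l + 1)) := by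
  have h := scal_r hg l
  have hq := hg.q_ne
  have hl := hg.lam_ne
  have hθ := hg.theta_ne hn
  have e : q * q ^ (-(2 * ((l + 1 : ℕ) : ℤ))) = (q ^ (2 * l + 1))⁻¹ := by
    rw [← zpow_natCast, ← _root_.zpow_neg, ← zpow_one_add₀ hq]; congr 1
  have e' : μ + (q ^ (2 * l + 1))⁻¹ = (1 + μ * q ^ (2 * l + 1)) / q ^ (2 * l + 1) := by
    field_simp
    ring
  rw [e, e', ← neg_eq_iff_eq_neg.2 h]
  generalize q - q⁻¹ = t at hl
  generalize 1 + μ * q ^ (2 * l + 1) = v at hθ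
  field_simp

theorem dA_succ (hg : Generic q μ n) (hx : T.QM x) (m l : ℕ) (hn : l + 2 ≤ n) :
    T.dA x m (l + 1) = q ^ (l + 1) • (T.Ps x (m + 1) * T.aa x (l + 1)) - T.dA x (m + 1) l -
      ((q - q⁻¹) * μ * q ^ (2 * l + 1) / (1 + μ * q ^ (2 * l + 1))) • T.dB x m l := by
  have hN := hg.nq_ne (l + 2) (by omega) hn
  rw [dA, Wg_rec hg hx l hn, map_smul, map_add, map_add, map_smul, map_smul,
    LT_iter_mul_scal (aa_scal hx.loc _), LT_iter_self, ← LT_apply, ← Module.End.mul_apply,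
    ← pow_succ, smul_smul, mul_div_cancel₀ _ hN, dA, dB]
  have h1 := scal_r hg l
  have h2 := scal_k hg l hn
  linear_combination (norm := module) h1 • (T.LT x ^ (m + 1)) (T.Wg x 0 l) +
    h2 • (T.LT x ^ m) (x * T.xiT (T.Wg x 0 l))

theorem dB_succ (hg : Generic q μ n) (hx : T.QM x) (m l : ℕ) (hn : l + 2 ≤ n) :
    T.dB x (m + 1) (l + 1) = ((μ⁻¹ * (q ^ (l + 1))⁻¹) • (T.Ps x (m + 1) * T.aa x (l + 1)) +
      ((q - q⁻¹) / (1 + μ * q ^ (2 * l + 1))) • T.dA x (m + 1) l - T.dB x m l) * T.gg x := by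
  have hN := hg.nq_ne (l + 2) (by omega) hn
  rw [dB, pow_succ, Module.End.mul_apply, xiT_rec hg hx l hn, LT_iter_mul_scal (gg_scal hx.loc),
    map_smul, mul_add, mul_add, map_add, map_add, mul_smul_comm, mul_smul_comm, mul_smul_comm,
    map_smul, map_smul, map_smul,
    LT_iter_mul_scal (aa_scal hx.loc _), LT_iter_self, ← LT_apply, ← Module.End.mul_apply,
    ← pow_succ, ← smul_mul_assoc, smul_smul, mul_div_cancel₀ _ hN, dA, dB]
  have h0 := scal_unit hg l
  have h1 := scal_r hg l
  have h2 : q ^ (l + 1) * (μ * (q ^ (-(2 * ((l + 1 : ℕ) : ℤ))) - 1) /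
      (μ + q * q ^ (-(2 * ((l + 1 : ℕ) : ℤ)))) - (q ^ (-(2 * ((l + 1 : ℕ) : ℤ))) - 1)) =
      (q - q⁻¹) / (1 + μ * q ^ (2 * l + 1)) * nq q (l + 1) := by
    have h3 := scal_k hg l hn
    have hθ := hg.theta_ne hn
    have e : (q - q⁻¹) / (1 + μ * q ^ (2 * l + 1)) = (q - q⁻¹) -
        (q - q⁻¹) * μ * q ^ (2 * l + 1) / (1 + μ * q ^ (2 * l + 1)) := by
      field_simp
      ring
    have hl := hg.lam_ne
    rw [mul_sub, h3, e, sub_mul, ← neg_eq_iff_eq_neg.2 h1]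
    generalize q - q⁻¹ = t at hl ⊢
    field_simp
    ring
  congr 1
  linear_combination (norm := module) h0 • (T.Ps x (m + 1) * T.aa x (l + 1)) +
    h2 • (T.LT x ^ (m + 1)) (T.Wg x 0 l) + h1 • (T.LT x ^ m) (x * T.xiT (T.Wg x 0 l))

/-- The Cayley–Hamilton–Newton expansions. -/
theorem dA_dB_expansion (hg : Generic q μ n) (hx : T.QM x) (l : ℕ) (hn : l + 1 ≤ n) (m : ℕ) :
    (l ≤ m + 1 → T.dA x m l = (-1 : ℂ) ^ l • ∑ j ∈ Finset.range (l + 1), (-q) ^ j •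
      ((T.Ps x (m + (l + 1) - j) + kap q μ (l + 1) •
        innerSum q (T.Ps x) (T.gg x) (m + (l + 1) - j) (l - j)) * T.aa x j)) ∧
    (l ≤ m → T.dB x m l = (-1 : ℂ) ^ l • ∑ j ∈ Finset.range (l + 1), (-q) ^ j •
      (((μ⁻¹ * q ^ (-(2 * (j : ℤ)))) • (T.Ps x (m + j - l) * T.gg x ^ (l + 1 - j)) -
        (q⁻¹ * kap q μ (l + 1)) •
        innerSum q (T.Ps x) (T.gg x) (m + (l + 2) - j) (l - j)) * T.aa x j)) := by
  induction l generalizing m with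
  | zero => 
    simp [dA_zero hg, dB_zero hg hx, innerSum_zero, aa]
  | succ l ih =>
    have hc := fun j => gg_comm_aa hg hx j
    constructor
    · intro hm
      rw [dA_succ hg hx m l hn, (ih (by omega) (m + 1)).1 (by omega),
        (ih (by omega) m).2 (by omega), Finset.sum_range_succ _ (l + 1), Nat.sub_self,
        innerSum_zero, smul_zero, add_zero, show m + (l + 1 + 1) - (l + 1) = m + 1 by omega]
      have e : ∀ j ∈ Finset.range (l + 1), (-q) ^ j • ((T.Ps x (m + (l + 1 + 1) - j) +
          kap q μ (l + 1 + 1) • innerSum q (T.Ps x) (T.gg x) (m + (l + 1 + 1) - j) (l + 1 - j)) *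
            T.aa x j) = (-q) ^ j • ((T.Ps x (m + 1 + (l + 1) - j) + kap q μ (l + 1) •
          innerSum q (T.Ps x) (T.gg x) (m + 1 + (l + 1) - j) (l - j)) * T.aa x j) +
          ((q - q⁻¹) * μ * q ^ (2 * l + 1) / (1 + μ * q ^ (2 * l + 1))) •
          ((-q) ^ j • (((μ⁻¹ * q ^ (-(2 * (j : ℤ)))) • (T.Ps x (m + j - l) *
            T.gg x ^ (l + 1 - j)) - (q⁻¹ * kap q μ (l + 1)) •
            innerSum q (T.Ps x) (T.gg x) (m + (l + 2) - j) (l - j)) * T.aa x j)) := by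
        intro j hj
        obtain ⟨D, rfl⟩ := Nat.exists_eq_add_of_le (Nat.lt_succ_iff.1 (Finset.mem_range.1 hj))
        have h := innerSum_recursion_A (T.Ps x) (T.gg x) hg j D m hn
        rw [show m + (j + D + 1 + 1) - j = m + D + 2 by omega, show j + D + 1 - j = D + 1 by omega,
          show m + 1 + (j + D + 1) - j = m + D + 2 by omega, show j + D - j = D by omega,
          show m + j - (j + D) = m - D by omega, h,
          add_mul, smul_add, smul_mul_assoc, smul_comm ((-q) ^ j)]
      rw [Finset.sum_congr rfl e, Finset.sum_add_distrib, ← Finset.smul_sum]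
      have hs : (-1 : ℂ) ^ (l + 1) * (-q) ^ (l + 1) = q ^ (l + 1) := by
        rw [← mul_pow, neg_one_mul, neg_neg]
      rw [smul_add, smul_smul _ _ (T.Ps x (m + 1) * _), hs, pow_succ]
      module
    · intro hm
      obtain ⟨m, rfl⟩ : ∃ m', m = m' + 1 := ⟨m - 1, by omega⟩
      rw [dB_succ hg hx m l hn, (ih (by omega) (m + 1)).1 (by omega),
        (ih (by omega) m).2 (by omega), Finset.sum_range_succ _ (l + 1), Nat.sub_self,
        innerSum_zero, smul_zero, sub_zero, show m + 1 + (l + 1) - (l + 1) = m + 1 by omega,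
        show l + 1 + 1 - (l + 1) = 1 by omega, pow_one]
      have e : ∀ j ∈ Finset.range (l + 1), (-q) ^ j • (((μ⁻¹ * q ^ (-(2 * (j : ℤ)))) •
          (T.Ps x (m + 1 + j - (l + 1)) * T.gg x ^ (l + 1 + 1 - j)) - (q⁻¹ * kap q μ (l + 1 + 1)) •
          innerSum q (T.Ps x) (T.gg x) (m + 1 + (l + 1 + 2) - j) (l + 1 - j)) * T.aa x j) =
          (-((q - q⁻¹) / (1 + μ * q ^ (2 * l + 1))) •
          ((-q) ^ j • ((T.Ps x (m + 1 + (l + 1) - j) + kap q μ (l + 1) •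
          innerSum q (T.Ps x) (T.gg x) (m + 1 + (l + 1) - j) (l - j)) * T.aa x j)) +
          (-q) ^ j • (((μ⁻¹ * q ^ (-(2 * (j : ℤ)))) • (T.Ps x (m + j - l) *
            T.gg x ^ (l + 1 - j)) - (q⁻¹ * kap q μ (l + 1)) •
            innerSum q (T.Ps x) (T.gg x) (m + (l + 2) - j) (l - j)) * T.aa x j)) * T.gg x := by
        intro j hj
        obtain ⟨D, rfl⟩ := Nat.exists_eq_add_of_le (Nat.lt_succ_iff.1 (Finset.mem_range.1 hj))
        have h := innerSum_recursion_B (T.Ps x) (T.gg x) hg j D m hn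
        rw [show m + 1 + j - (j + D + 1) = m - D by omega,
          show m + 1 + (j + D + 1 + 2) - j = m + D + 4 by omega,
          show j + D + 1 + 1 - j = D + 2 by omega, show j + D + 1 - j = D + 1 by omega,
          show m + 1 + (j + D + 1) - j = m + D + 2 by omega, show j + D - j = D by omega,
          show m + j - (j + D) = m - D by omega,
          show m + (j + D + 2) - j = m + D + 2 by omega, h,
          mul_assoc _ (T.gg x), (hc j).eq, ← mul_assoc, add_mul _ _ (T.aa x j), smul_mul_assoc _ _ (T.aa x j),
          ← smul_comm ((-q) ^ j), ← smul_add, smul_mul_assoc]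
      rw [Finset.sum_congr rfl e, ← Finset.sum_mul, Finset.sum_add_distrib, ← Finset.smul_sum]
      have hs : (-1 : ℂ) ^ (l + 1) * ((-q) ^ (l + 1) * (μ⁻¹ * q ^ (-(2 * ((l + 1 : ℕ) : ℤ))))) =
          μ⁻¹ * (q ^ (l + 1))⁻¹ := by
        rw [← scal_unit hg, ← mul_assoc, ← mul_pow, neg_one_mul, neg_neg]
      have e2 : (μ⁻¹ * q ^ (-(2 * ((l + 1 : ℕ) : ℤ)))) • (T.Ps x (m + 1) * T.gg x) *
          T.aa x (l + 1) = ((μ⁻¹ * q ^ (-(2 * ((l + 1 : ℕ) : ℤ)))) •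
            (T.Ps x (m + 1) * T.aa x (l + 1))) * T.gg x := by
        rw [smul_mul_assoc, smul_mul_assoc, mul_assoc, (hc _).eq, mul_assoc]
      rw [e2, ← smul_mul_assoc ((-q) ^ (l + 1)), ← add_mul, ← smul_mul_assoc _ _ (T.gg x)]
      congr 1
      linear_combination (norm := module) -hs • (T.Ps x (m + 1) * T.aa x (l + 1))

end Tower

end

section

theorem unitsHom_mul {J A S : Type*} [Fintype J] [DecidableEq J] [Ring A] [Algebra ℂ A] [Ring S]
    [Algebra ℂ S] (α : A →ₐ[ℂ] S) (v : J → J → S)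
    (hv : ∀ a b c d, v a b * v c d = if b = c then v a d else 0)
    (hα : ∀ x a b, Commute (α x) (v a b)) (X Y : Matrix J J A) :
    ∑ a, ∑ b, α ((X * Y) a b) * v a b =
      (∑ a, ∑ b, α (X a b) * v a b) * ∑ a, ∑ b, α (Y a b) * v a b := by
  simp only [Matrix.mul_apply, map_sum, map_mul, Finset.sum_mul]
  refine Finset.sum_congr rfl fun a _ => ?_
  have h : ∀ b c d, α (X a b) * v a b * (α (Y c d) * v c d) =
      if b = c then α (X a b) * α (Y b d) * v a d else 0 := by
    intro b c d
    rw [mul_assoc, ← mul_assoc (v a b), ← (hα (Y c d) a b).eq, mul_assoc, hv]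
    split_ifs with h
    · subst h; rw [mul_assoc]
    · simp
  rw [Finset.sum_comm]
  refine Finset.sum_congr rfl fun b _ => ?_
  simp only [Finset.mul_sum, h]
  rw [Finset.sum_comm]
  refine Finset.sum_congr rfl fun c _ => ?_
  rw [Finset.sum_ite_eq, if_pos (Finset.mem_univ _)]

/-- The algebra homomorphism `X ↦ ∑ α (X a b) * v a b` attached to a system of matrix units. -/
def unitsHom {J A S : Type*} [Fintype J] [DecidableEq J] [Ring A] [Algebra ℂ A] [Ring S]
    [Algebra ℂ S] (α : A →ₐ[ℂ] S) (v : J → J → S)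
    (hv : ∀ a b c d, v a b * v c d = if b = c then v a d else 0) (h1 : ∑ a, v a a = 1)
    (hα : ∀ x a b, Commute (α x) (v a b)) : Matrix J J A →ₐ[ℂ] S :=
  AlgHom.ofLinearMap
    { toFun := fun X => ∑ a, ∑ b, α (X a b) * v a b
      map_add' := fun X Y => by
        simp only [Matrix.add_apply, map_add, add_mul, Finset.sum_add_distrib]
      map_smul' := fun c X => by
        simp only [Matrix.smul_apply, map_smul, smul_mul_assoc, Finset.smul_sum, RingHom.id_apply] }
    (by
      simp only [LinearMap.coe_mk, AddHom.coe_mk, Matrix.one_apply]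
      rw [← h1]
      refine Finset.sum_congr rfl fun a _ => ?_
      rw [Finset.sum_eq_single a]
      · simp
      · intro b _ hb
        simp [Ne.symm hb]
      · simp)
    (unitsHom_mul α v hv hα)

/-- Commuting systems of matrix units `e p` indexed by the strands `p`, together with a
homomorphism from an algebra of coefficients commuting with them. -/
structure Strands (N : ℕ) (A S : Type*) [Ring A] [Algebra ℂ A] [Ring S] [Algebra ℂ S] where
  e : ℕ → Fin N → Fin N → S
  α : A →ₐ[ℂ] S
  e_mul : ∀ p a b c d, e p a b * e p c d = if b = c then e p a d else 0
  e_one : ∀ p, ∑ a, e p a a = 1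
  e_comm : ∀ {p t}, p ≠ t → ∀ a b c d, Commute (e p a b) (e t c d)
  α_comm : ∀ x p a b, Commute (α x) (e p a b)

namespace Strands
variable {N : ℕ} {A S : Type*} [Ring A] [Algebra ℂ A] [Ring S] [Algebra ℂ S] (W : Strands N A S)

/-- The elements acting trivially on strand `p`. -/
def off (p : ℕ) : Subalgebra ℂ S :=
  Subalgebra.centralizer ℂ (Set.range fun ab : Fin N × Fin N => W.e p ab.1 ab.2)

/-- The matrix entries of an element with respect to strand `p`. -/
def coef (p : ℕ) (a b : Fin N) : S →ₗ[ℂ] S :=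
  ∑ k, LinearMap.mulLeft ℂ (W.e p k a) ∘ₗ LinearMap.mulRight ℂ (W.e p b k)

/-- The weighted trace over strand `p`. -/
def E (D : Matrix (Fin N) (Fin N) ℂ) (p : ℕ) : S →ₗ[ℂ] S :=
  ∑ m, ∑ c, D m c • W.coef p c m

/-- The matrix units on the strands `p, …, p + n - 1`. -/
def u (p : ℕ) : (n : ℕ) → (Fin n → Fin N) → (Fin n → Fin N) → S
  | 0, _, _ => 1
  | n + 1, a, b => u p n (fun t => a t.castSucc) (fun t => b t.castSucc) *
      W.e (p + n) (a (Fin.last n)) (b (Fin.last n))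

variable {W} {p t n : ℕ} {x y : S} {D : Matrix (Fin N) (Fin N) ℂ}

theorem mem_off : x ∈ W.off p ↔ ∀ a b, Commute (W.e p a b) x := by
  simp only [off, Subalgebra.mem_centralizer_iff, Set.mem_range, Prod.exists, forall_exists_index,
    Commute, SemiconjBy]
  constructor
  · intro h a b
    exact h _ a b rfl
  · rintro h _ a b rfl
    exact h a b

theorem e_off (h : t ≠ p) (a b : Fin N) : W.e p a b ∈ W.off t :=
  mem_off.2 fun c d => W.e_comm h c d a b

theorem α_off (x : A) (t : ℕ) : W.α x ∈ W.off t := mem_off.2 fun _ _ => (W.α_comm _ _ _ _).symm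

theorem coef_apply (a b : Fin N) (x : S) :
    W.coef p a b x = ∑ k, W.e p k a * (x * W.e p b k) := by
  simp [coef]

theorem coef_mem_off (a b : Fin N) (x : S) : W.coef p a b x ∈ W.off p := by
  rw [mem_off]
  intro i j
  rw [coef_apply, Commute, SemiconjBy, Finset.mul_sum, Finset.sum_mul, Finset.sum_eq_single j,
    Finset.sum_eq_single i]
  · rw [← mul_assoc, W.e_mul, mul_assoc, mul_assoc, W.e_mul]; simp
  · intro k _ hk
    rw [mul_assoc, mul_assoc, W.e_mul, if_neg hk]; simp
  · simp
  · intro k _ hk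
    rw [← mul_assoc, W.e_mul, if_neg hk.symm]; simp
  · simp

theorem coef_off (hx : x ∈ W.off t) (a b : Fin N) : W.coef p a b x ∈ W.off t := by
  by_cases h : t = p
  · subst h; exact coef_mem_off a b x
  · rw [coef_apply]
    exact sum_mem fun k _ => mul_mem (e_off h _ _) (mul_mem hx (e_off h _ _))

theorem coef_mul_left (hy : y ∈ W.off p) (a b : Fin N) (x : S) :
    W.coef p a b (y * x) = y * W.coef p a b x := by
  rw [coef_apply, coef_apply, Finset.mul_sum]
  refine Finset.sum_congr rfl fun k _ => ?_
  rw [← mul_assoc, ← mul_assoc, (mem_off.1 hy _ _).eq]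
  simp only [mul_assoc]

theorem coef_mul_right (hy : y ∈ W.off p) (a b : Fin N) (x : S) :
    W.coef p a b (x * y) = W.coef p a b x * y := by
  rw [coef_apply, coef_apply, Finset.sum_mul]
  refine Finset.sum_congr rfl fun k _ => ?_
  rw [mul_assoc x, ← (mem_off.1 hy _ _).eq]
  simp only [mul_assoc]

theorem sum_coef (p : ℕ) (x : S) : ∑ a, ∑ b, W.coef p a b x * W.e p a b = x := by
  have h : ∀ a b, W.coef p a b x * W.e p a b = W.e p a a * x * W.e p b b := by
    intro a b
    rw [coef_apply, Finset.sum_mul, Finset.sum_eq_single a]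
    · rw [mul_assoc, mul_assoc, W.e_mul, if_pos rfl, mul_assoc]
    · intro k _ hk
      rw [mul_assoc, mul_assoc, W.e_mul, if_neg hk]; simp
    · simp
  simp only [h, ← Finset.mul_sum, ← Finset.sum_mul, W.e_one, one_mul, mul_one]

theorem coef_e (a b c d : Fin N) :
    W.coef p a b (W.e p c d) = if a = c ∧ b = d then 1 else 0 := by
  rw [coef_apply, ← W.e_one p]
  by_cases h1 : a = c
  · by_cases h2 : b = d
    · subst h1 h2
      simp [W.e_mul]
    · simp [W.e_mul, h2, Ne.symm h2]
  · have : ∀ k, W.e p k a * (W.e p c d * W.e p b k) = 0 := fun k => by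
      rw [← mul_assoc, W.e_mul, if_neg h1, zero_mul]
    simp [this, h1]

theorem coef_mul_e (hx : x ∈ W.off p) (a b c d : Fin N) :
    W.coef p a b (x * W.e p c d) = if a = c ∧ b = d then x else 0 := by
  rw [coef_mul_left hx, coef_e, mul_ite, mul_one, mul_zero]

theorem E_apply (x : S) : W.E D p x = ∑ m, ∑ c, D m c • W.coef p c m x := by
  simp [E]

theorem E_mem_off (x : S) : W.E D p x ∈ W.off p := by
  rw [E_apply]
  exact sum_mem fun m _ => sum_mem fun c _ => Subalgebra.smul_mem _ (coef_mem_off _ _ _) _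

theorem E_off (hx : x ∈ W.off t) : W.E D p x ∈ W.off t := by
  rw [E_apply]
  exact sum_mem fun m _ => sum_mem fun c _ => Subalgebra.smul_mem _ (coef_off hx _ _) _

theorem E_mul_left (hy : y ∈ W.off p) (x : S) : W.E D p (y * x) = y * W.E D p x := by
  simp only [E_apply, coef_mul_left hy, Finset.mul_sum, mul_smul_comm]

theorem E_mul_right (hy : y ∈ W.off p) (x : S) : W.E D p (x * y) = W.E D p x * y := by
  simp only [E_apply, coef_mul_right hy, Finset.sum_mul, smul_mul_assoc]

theorem E_e (a b : Fin N) : W.E D p (W.e p a b) = D b a • 1 := by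
  rw [E_apply, Finset.sum_eq_single b, Finset.sum_eq_single a]
  · simp [coef_e]
  · intro c _ hc; simp [coef_e, hc]
  · simp
  · intro m _ hm; simp [coef_e, hm]
  · simp

theorem sum_snoc {M : Type*} [AddCommMonoid M] (f : (Fin (n + 1) → Fin N) → M) :
    ∑ a, f a = ∑ a : Fin n → Fin N, ∑ c, f (Fin.snoc a c) := by
  rw [← (Fin.snocEquiv fun _ => Fin N).sum_comp, Fintype.sum_prod_type, Finset.sum_comm]
  rfl

theorem u_snoc (a b : Fin n → Fin N) (c d : Fin N) :
    W.u p (n + 1) (Fin.snoc a c) (Fin.snoc b d) = W.u p n a b * W.e (p + n) c d := by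
  simp [u]

theorem u_off (h : t < p ∨ p + n ≤ t) (a b : Fin n → Fin N) : W.u p n a b ∈ W.off t := by
  induction n with
  | zero => exact one_mem _
  | succ n ih => exact mul_mem (ih (by omega) _ _) (e_off (by omega) _ _)

theorem u_mul (a b c d : Fin n → Fin N) :
    W.u p n a b * W.u p n c d = if b = c then W.u p n a d else 0 := by
  induction n with
  | zero => simp [u, Subsingleton.elim b c]
  | succ n ih =>
    have hc := mem_off.1 (u_off (W := W) (p := p) (t := p + n) (.inr le_rfl)
      (fun t : Fin n => c t.castSucc) (fun t => d t.castSucc)) (a (Fin.last n)) (b (Fin.last n))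
    have hbc : b = c ↔ (fun t : Fin n => b t.castSucc) = (fun t => c t.castSucc) ∧
        b (Fin.last n) = c (Fin.last n) := by
      constructor
      · rintro rfl; exact ⟨rfl, rfl⟩
      · rintro ⟨h1, h2⟩
        funext t
        refine Fin.lastCases h2 (fun t => ?_) t
        exact congrFun h1 t
    rw [u, u, mul_assoc, ← mul_assoc (W.e _ _ _), hc.eq, mul_assoc, ← mul_assoc, ih, W.e_mul, u,
      ite_mul, mul_ite, zero_mul, mul_zero, ← ite_and]
    simp only [hbc]

theorem u_one (p n : ℕ) : ∑ a, W.u p n a a = 1 := by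
  induction n with
  | zero => simp [u]
  | succ n ih =>
    rw [sum_snoc]
    simp only [u_snoc, ← Finset.mul_sum, W.e_one, mul_one, ih]

theorem α_comm_u (x : A) (a b : Fin n → Fin N) : Commute (W.α x) (W.u p n a b) := by
  induction n with
  | zero => exact Commute.one_right _
  | succ n ih => exact (ih _ _).mul_right (W.α_comm _ _ _ _)

variable (W) in
/-- The realization of operators on `n` tensor factors on the strands `p, …, p + n - 1`. -/
def emb (p n : ℕ) : MatV N n A →ₐ[ℂ] S :=
  unitsHom W.α (W.u p n) u_mul (u_one p n) fun _ _ _ => α_comm_u _ _ _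

theorem emb_apply (X : MatV N n A) :
    W.emb p n X = ∑ a, ∑ b, W.α (X a b) * W.u p n a b := rfl

variable (W) in
/-- The realization of a matrix on strand `p`. -/
def one (p : ℕ) : Matrix (Fin N) (Fin N) A →ₐ[ℂ] S :=
  unitsHom W.α (W.e p) (W.e_mul p) (W.e_one p) fun _ _ _ => W.α_comm _ _ _ _

theorem one_apply (X : Matrix (Fin N) (Fin N) A) :
    W.one p X = ∑ a, ∑ b, W.α (X a b) * W.e p a b := rfl

theorem coef_one (X : Matrix (Fin N) (Fin N) A) (a b : Fin N) :
    W.coef p a b (W.one p X) = W.α (X a b) := by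
  simp only [one_apply, map_sum, coef_mul_e (α_off _ _)]
  rw [Finset.sum_eq_single a, Finset.sum_eq_single b]
  · simp
  · intro c _ hc; simp [hc.symm]
  · simp
  · intro c _ hc; simp [hc.symm]
  · simp

theorem one_injective (h : Function.Injective W.α) (p : ℕ) : Function.Injective (W.one p) := by
  intro X Y hXY
  ext a b
  apply h
  rw [← coef_one (p := p), hXY, coef_one]

theorem one_off (h : t ≠ p) (X : Matrix (Fin N) (Fin N) A) : W.one p X ∈ W.off t := by
  rw [one_apply]
  exact sum_mem fun a _ => sum_mem fun b _ => mul_mem (α_off _ _) (e_off h _ _)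

theorem one_rmulE (X : Matrix (Fin N) (Fin N) A) (c : A) :
    W.one p (rmulE X c) = W.one p X * W.α c := by
  simp only [one_apply, rmulE, map_mul, Finset.sum_mul, mul_assoc, (W.α_comm c _ _ _).eq]

theorem emb_ext1 (X : MatV N n A) : W.emb p (n + 1) (ext1 X) = W.emb p n X := by
  rw [emb_apply, emb_apply, sum_snoc]
  refine Finset.sum_congr rfl fun a _ => ?_
  simp only [sum_snoc, u_snoc, ext1, Fin.snoc_last, Fin.snoc_castSucc]
  rw [Finset.sum_comm]
  refine Finset.sum_congr rfl fun b _ => ?_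
  have : ∀ c d, W.α (if c = d then X a b else 0) * (W.u p n a b * W.e (p + n) c d) =
      if c = d then W.α (X a b) * W.u p n a b * W.e (p + n) c c else 0 := by
    intro c d
    split_ifs with h
    · rw [h, mul_assoc]
    · simp
  simp only [this, Finset.sum_ite_eq, Finset.mem_univ, if_true, ← Finset.mul_sum, W.e_one, mul_one]

theorem emb_ptrace (X : MatV N (n + 1) A) :
    W.emb p n (ptrace (cmap D) X) = W.E D (p + n) (W.emb p (n + 1) X) := by
  rw [emb_apply, emb_apply, sum_snoc]
  simp only [sum_snoc, u_snoc, map_sum, ptrace, ← mul_assoc]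
  refine Finset.sum_congr rfl fun a _ => ?_
  rw [Finset.sum_comm]
  refine Finset.sum_congr rfl fun b _ => ?_
  rw [Finset.sum_comm, Finset.sum_mul]
  refine Finset.sum_congr rfl fun c _ => ?_
  rw [Finset.sum_mul]
  refine Finset.sum_congr rfl fun d _ => ?_
  rw [E_mul_left (mul_mem (α_off _ _) (u_off (.inr le_rfl) _ _)), E_e, mul_smul_comm, mul_one,
    cmap, Matrix.map_apply, ← Algebra.smul_def, map_smul, smul_mul_assoc]

theorem sum_fin_succ {k : ℕ} {M : Type*} [AddCommMonoid M] (f : (Fin (k + 1) → Fin N) → M) :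
    ∑ a, f a = ∑ c, ∑ a : Fin k → Fin N, f (Fin.cons c a) := by
  rw [← (Fin.consEquiv fun _ => Fin N).sum_comp, Fintype.sum_prod_type]
  rfl

theorem emb_one (X : MatV N 1 A) : W.emb p 1 X = W.one p (toN X) := by
  have h (a : Fin 0 → Fin N) (c : Fin N) : (Fin.cons c a : Fin 1 → Fin N) = fun _ => c := by
    funext t; rw [Fin.fin_one_eq_zero t]; rfl
  simp only [emb_apply, sum_fin_succ, Finset.univ_unique, Finset.sum_singleton, one_apply, toN, h,
    u, one_mul, add_zero]

variable (W) in
/-- The realization of a complex operator on the strands `p, …, p + n - 1`. -/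
def scal (p n : ℕ) : MatV N n ℂ →ₐ[ℂ] S :=
  (W.emb p n).comp (Algebra.ofId ℂ A).mapMatrix

theorem scal_eq_emb (X : MatV N n ℂ) : W.scal p n X = W.emb p n (cmap X) := rfl

variable (W) in
/-- The realization of an operator on two tensor factors on the strands `p, p + 1`. -/
def two (p : ℕ) : MatV N 2 ℂ →ₐ[ℂ] S :=
  W.scal p 2

theorem two_eq_emb (X : MatV N 2 ℂ) : W.two p X = W.emb p 2 (cmap X) := rfl

theorem two_apply (X : MatV N 2 ℂ) : W.two p X =
    ∑ a, ∑ b, ∑ c, ∑ d, X ![a, b] ![c, d] • (W.e p a c * W.e (p + 1) b d) := by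
  have h (a : Fin 0 → Fin N) (b c : Fin N) :
      (Fin.cons b (Fin.cons c a) : Fin 2 → Fin N) = ![b, c] := by
    rw [Subsingleton.elim a (![] : Fin 0 → Fin N)]; rfl
  simp only [two_eq_emb, emb_apply, sum_fin_succ, Finset.univ_unique, Finset.sum_singleton, h,
    u, one_mul, add_zero]
  refine Finset.sum_congr rfl fun a _ => Finset.sum_congr rfl fun b _ =>
    Finset.sum_congr rfl fun c _ => Finset.sum_congr rfl fun d _ => ?_
  rw [cmap, Matrix.map_apply, AlgHom.commutes, ← Algebra.smul_def]
  rfl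

theorem cmap_ext1 (X : MatV N n ℂ) : cmap (A := A) (ext1 X) = ext1 (cmap X) := by
  ext a b
  simp only [cmap, ext1, Matrix.map_apply]
  split_ifs <;> simp

theorem scal_ext1 (p : ℕ) (X : MatV N n ℂ) : W.scal p (n + 1) (ext1 X) = W.scal p n X := by
  rw [scal_eq_emb, cmap_ext1, emb_ext1, scal_eq_emb]

section Lift
variable {A : Type*} [Ring A] [NeZero N]

theorem toN_lift1 (X : Matrix (Fin N) (Fin N) A) : toN (lift1 (n := 1) 0 X) = X := by
  ext a b
  simp [toN, lift1, idx]

theorem lift1_succ (X : Matrix (Fin N) (Fin N) A) :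
    lift1 (n := n + 1 + 1) 0 X = ext1 (lift1 (n := n + 1) 0 X) := by
  ext a b
  have h : (∀ m : Fin (n + 1 + 1), (m : ℕ) = 0 ∨ a m = b m) ↔ a (Fin.last _) = b (Fin.last _) ∧
      ∀ m : Fin (n + 1), (m : ℕ) = 0 ∨ a m.castSucc = b m.castSucc := by
    rw [Fin.forall_fin_succ', and_comm]
    simp
  simp only [lift1, ext1, h, ite_and]
  rfl

theorem lift2_succ {r : ℕ} (h : r + 2 ≤ n) (X : MatV N 2 A) :
    lift2 (n := n + 1) r X = ext1 (lift2 (n := n) r X) := by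
  ext a b
  have h' : (∀ m : Fin (n + 1), (m : ℕ) = r ∨ (m : ℕ) = r + 1 ∨ a m = b m) ↔
      a (Fin.last _) = b (Fin.last _) ∧
        ∀ m : Fin n, (m : ℕ) = r ∨ (m : ℕ) = r + 1 ∨ a m.castSucc = b m.castSucc := by
    rw [Fin.forall_fin_succ', and_comm]
    simp only [Fin.val_castSucc, Fin.val_last, show ¬ n = r by omega, show ¬ n = r + 1 by omega,
      false_or]
  have hr (c : Fin (n + 1) → Fin N) (j : ℕ) (hj : j < n) :
      idx c j = idx (fun t : Fin n => c t.castSucc) j := by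
    rw [idx, idx, dif_pos hj, dif_pos (by omega)]
    rfl
  simp only [lift2, ext1, h', ite_and, hr _ r (by omega), hr _ (r + 1) (by omega)]

end Lift

variable [NeZero N]

theorem emb_lift1 (X : Matrix (Fin N) (Fin N) A) :
    W.emb p (n + 1) (lift1 0 X) = W.one p X := by
  induction n with
  | zero => rw [zero_add, emb_one, toN_lift1]
  | succ n ih => rw [lift1_succ, emb_ext1, ih]

theorem emb_lift2 (X : MatV N 2 ℂ) (r : ℕ) (h : r + 2 ≤ n) :
    W.emb p n (cmap (lift2 r X)) = W.two (p + r) X := by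
  obtain ⟨k, rfl⟩ := Nat.exists_eq_add_of_le h
  induction k with
  | zero =>
    have h2 (a b : Fin r → Fin N) (c d c' d' : Fin N) :
        W.α (cmap (A := A) (lift2 (n := r + 2) r X) (Fin.snoc (Fin.snoc a c) d)
          (Fin.snoc (Fin.snoc b c') d')) =
        if a = b then algebraMap ℂ S (X ![c, d] ![c', d']) else 0 := by
      have h1 : (∀ m : Fin (r + 2), (m : ℕ) = r ∨ (m : ℕ) = r + 1 ∨
          (Fin.snoc (Fin.snoc a c : Fin (r + 1) → Fin N) d : Fin (r + 2) → Fin N) m =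
            (Fin.snoc (Fin.snoc b c' : Fin (r + 1) → Fin N) d' : Fin (r + 2) → Fin N) m) ↔
          a = b := by
        rw [Fin.forall_fin_succ', Fin.forall_fin_succ', funext_iff]
        simp [fun i : Fin r => i.2.ne, fun i : Fin r => (i.2.trans (Nat.lt_succ_self r)).ne]
      have h3 (a : Fin r → Fin N) (c d : Fin N) :
          idx (Fin.snoc (Fin.snoc a c : Fin (r + 1) → Fin N) d : Fin (r + 2) → Fin N) r = c := by
        rw [idx, dif_pos (by omega)]
        simp [Fin.snoc]
      have h4 (a : Fin r → Fin N) (c d : Fin N) :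
          idx (Fin.snoc (Fin.snoc a c : Fin (r + 1) → Fin N) d : Fin (r + 2) → Fin N) (r + 1) =
            d := by
        rw [idx, dif_pos (by omega)]
        simp [Fin.snoc]
      rw [cmap, Matrix.map_apply, AlgHom.commutes, lift2]
      simp only [h1, h3, h4, apply_ite (algebraMap ℂ S), map_zero]
    simp only [emb_apply, sum_snoc, h2, u_snoc, ite_mul, zero_mul, Finset.sum_ite_irrel,
      Finset.sum_const_zero, Finset.sum_ite_eq, Finset.mem_univ, if_true]
    have h5 (a : Fin r → Fin N) (c d c' d' : Fin N) : algebraMap ℂ S (X ![c, d] ![c', d']) *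
        (W.u p r a a * W.e (p + r) c c' * W.e (p + (r + 1)) d d') =
        W.u p r a a * (X ![c, d] ![c', d'] • (W.e (p + r) c c' * W.e (p + r + 1) d d')) := by
      rw [← Algebra.smul_def, mul_assoc, mul_smul_comm, add_assoc]
    simp only [h5, ← Finset.mul_sum, ← Finset.sum_mul, u_one, one_mul, two_apply]
  | succ k ih =>
    rw [← add_assoc, lift2_succ (by omega), cmap_ext1, emb_ext1, ih (by omega)]

theorem scal_lift2 (X : MatV N 2 ℂ) (r : ℕ) (h : r + 2 ≤ n) :
    W.scal p n (lift2 r X) = W.two (p + r) X :=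
  (scal_eq_emb _).trans (emb_lift2 X r h)

end Strands

end

section

namespace Strands
variable {N : ℕ} {A S : Type*} [Ring A] [Algebra ℂ A] [Ring S] [Algebra ℂ S] {W : Strands N A S}
  {p t n : ℕ} {x y : S} {D : Matrix (Fin N) (Fin N) ℂ} {q μ : ℂ} {R F Ψ X : MatV N 2 ℂ}

theorem two_off (h1 : t ≠ p) (h2 : t ≠ p + 1) (X : MatV N 2 ℂ) : W.two p X ∈ W.off t := by
  rw [two_apply]
  exact sum_mem fun _ _ => sum_mem fun _ _ => sum_mem fun _ _ => sum_mem fun _ _ =>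
    Subalgebra.smul_mem _ (mul_mem (e_off h1 _ _) (e_off h2 _ _)) _

theorem two_comm (h1 : x ∈ W.off p) (h2 : x ∈ W.off (p + 1)) (X : MatV N 2 ℂ) :
    Commute (W.two p X) x := by
  rw [two_apply]
  exact Commute.sum_left _ _ _ fun _ _ => Commute.sum_left _ _ _ fun _ _ =>
    Commute.sum_left _ _ _ fun _ _ => Commute.sum_left _ _ _ fun _ _ =>
      ((mem_off.1 h1 _ _).mul_left (mem_off.1 h2 _ _)).smul_left _

theorem two_mul_inv (h : IsUnit X.det) (p : ℕ) : W.two p X * W.two p X⁻¹ = 1 := by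
  rw [← map_mul, Matrix.mul_nonsing_inv _ h, map_one]

theorem two_inv_mul (h : IsUnit X.det) (p : ℕ) : W.two p X⁻¹ * W.two p X = 1 := by
  rw [← map_mul, Matrix.nonsing_inv_mul _ h, map_one]

theorem coef_two_right (a b : Fin N) (X : MatV N 2 ℂ) :
    W.coef (p + 1) a b (W.two p X) = ∑ c, ∑ d, X ![c, a] ![d, b] • W.e p c d := by
  simp only [two_apply, map_sum, map_smul, coef_mul_e (e_off (Nat.succ_ne_self p) _ _)]
  refine Finset.sum_congr rfl fun c _ => ?_
  rw [Finset.sum_comm]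
  refine Finset.sum_congr rfl fun d _ => ?_
  simp [ite_and]

theorem coef_two_left (a b : Fin N) (X : MatV N 2 ℂ) :
    W.coef p a b (W.two p X) = ∑ c, ∑ d, X ![a, c] ![b, d] • W.e (p + 1) c d := by
  have h (a c b d : Fin N) := W.e_comm (Nat.succ_ne_self p).symm a c b d
  simp only [two_apply, (h _ _ _ _).eq, map_sum, map_smul,
    coef_mul_e (e_off (Nat.succ_ne_self p).symm _ _)]
  rw [Finset.sum_comm]
  refine Finset.sum_congr rfl fun c _ => ?_
  simp [ite_and]

theorem E_two (X : MatV N 2 ℂ) : W.E D (p + 1) (W.two p X) =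
    ∑ a, ∑ b, (∑ m, ∑ c, X ![a, c] ![b, m] * D m c) • W.e p a b := by
  simp only [E_apply, coef_two_right, Finset.smul_sum, smul_smul, Finset.sum_smul]
  rw [Finset.sum_comm_cycle]
  refine Finset.sum_congr rfl fun a _ => ?_
  rw [Finset.sum_comm_cycle]
  simp only [mul_comm (D _ _)]

theorem E_skew (h : SkewPair R Ψ) (p : ℕ) : W.E (Dof Ψ) (p + 1) (W.two p R) = 1 := by
  rw [E_two, ← W.e_one p]
  refine Finset.sum_congr rfl fun a _ => ?_
  have (b : Fin N) : ∑ m, ∑ c, R ![a, c] ![b, m] * Dof Ψ m c = if a = b then 1 else 0 := by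
    simp only [Dof, Finset.mul_sum]
    rw [Finset.sum_comm_cycle]
    have h' (k : Fin N) := (Finset.sum_comm.trans (h.1 a k b k))
    simp only [h', ite_and, Finset.sum_ite_eq, Finset.mem_univ, if_true]
  simp [this]

/-- Skew invertibility recovers the matrix units on strand `p + 1` from the entries of `R`. -/
theorem e_eq_sum_coef (h : SkewPair R Ψ) (p : ℕ) (a b : Fin N) :
    W.e (p + 1) b a = ∑ m, ∑ c, Ψ ![a, m] ![b, c] • W.coef p c m (W.two p R) := by
  simp only [coef_two_left, Finset.smul_sum, smul_smul]
  rw [Finset.sum_comm_cycle, Finset.sum_eq_single b]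
  · rw [Finset.sum_comm_cycle, Finset.sum_eq_single a]
    · simp only [← Finset.sum_smul, h.2]
      simp
    · intro d _ hd
      simp only [← Finset.sum_smul, h.2]
      simp [hd.symm]
    · simp
  · intro c _ hc
    rw [Finset.sum_comm_cycle]
    simp only [← Finset.sum_smul, h.2]
    simp [hc]
  · simp

/-- A map linear over the matrix units on strand `p` and killing `R` kills the matrix units on
strand `p + 1`. -/
theorem map_e_eq_zero (h : SkewPair R Ψ) (Φ : S →ₗ[ℂ] S)
    (hl : ∀ a b x, Φ (W.e p a b * x) = W.e p a b * Φ x)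
    (hr : ∀ a b x, Φ (x * W.e p a b) = Φ x * W.e p a b) (h0 : Φ (W.two p R) = 0) (a b : Fin N) :
    Φ (W.e (p + 1) a b) = 0 := by
  simp only [e_eq_sum_coef h, coef_apply, map_sum, map_smul, hl, hr, h0, zero_mul, mul_zero,
    Finset.sum_const_zero, smul_zero]

theorem E_conj {V : MatV N 2 ℂ} (h : SkewPair R Ψ) (hV : IsUnit V.det)
    (hb : W.two (p + 1) R * W.two p V * W.two (p + 1) V =
      W.two p V * W.two (p + 1) V * W.two p R) (hx : x ∈ W.off (p + 2)) :
    W.E (Dof Ψ) (p + 2) (W.two (p + 1) V * x * W.two (p + 1) V⁻¹) = W.E (Dof Ψ) (p + 1) x := by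
  set v := W.two (p + 1) V with hv
  set v' := W.two (p + 1) V⁻¹ with hv'
  let Φ : S →ₗ[ℂ] S := W.E (Dof Ψ) (p + 2) ∘ₗ LinearMap.mulRight ℂ v' ∘ₗ LinearMap.mulLeft ℂ v -
    W.E (Dof Ψ) (p + 1)
  have hΦ (x : S) : Φ x = W.E (Dof Ψ) (p + 2) (v * x * v') - W.E (Dof Ψ) (p + 1) x := rfl
  have hl {c : S} (x : S) (h1 : c ∈ W.off (p + 1)) (h2 : c ∈ W.off (p + 2)) :
      Φ (c * x) = c * Φ x := by
    rw [hΦ, hΦ, mul_sub, ← E_mul_left h1, ← E_mul_left h2, ← mul_assoc, ← mul_assoc, ← mul_assoc,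
      (two_comm h1 h2 V).eq]
  have hr {c : S} (x : S) (h1 : c ∈ W.off (p + 1)) (h2 : c ∈ W.off (p + 2)) :
      Φ (x * c) = Φ x * c := by
    have hc : Commute v' c := two_comm h1 h2 V⁻¹
    rw [hΦ, hΦ, sub_mul, ← E_mul_right h1, ← E_mul_right h2, mul_assoc _ v', hc.eq]
    simp only [mul_assoc]
  have h0 : Φ (W.two p R) = 0 := by
    have e : v * W.two p R * v' = W.two p V⁻¹ * W.two (p + 1) R * W.two p V := by
      calc _ = W.two p V⁻¹ * (W.two p V * v * W.two p R) * v' := by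
            rw [mul_assoc (W.two p V), ← mul_assoc (W.two p V⁻¹), two_inv_mul hV, one_mul]
        _ = W.two p V⁻¹ * W.two (p + 1) R * W.two p V * (v * v') := by
            rw [← hb]; simp only [mul_assoc]
        _ = _ := by rw [two_mul_inv hV, mul_one]
    rw [hΦ, e, E_mul_right (two_off (by omega) (by omega) _),
      E_mul_left (two_off (by omega) (by omega) _), E_skew h, E_skew h, mul_one, two_inv_mul hV,
      sub_self]
  have he (a b : Fin N) : Φ (W.e (p + 1) a b) = 0 :=
    map_e_eq_zero h Φ (fun a b x => hl x (e_off (by omega) _ _) (e_off (by omega) _ _))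
      (fun a b x => hr x (e_off (by omega) _ _) (e_off (by omega) _ _)) h0 a b
  rw [← sub_eq_zero, ← hΦ, ← W.sum_coef (p + 1) x]
  simp only [map_sum, hl _ (coef_mem_off _ _ _) (coef_off hx _ _), he, mul_zero,
    Finset.sum_const_zero]

/-- A map linear over the operators away from strands `p + 2, p + 3` vanishes once it kills the
double crossing. -/
theorem map_eq_zero (h : SkewPair R Ψ) (Φ : S →ₗ[ℂ] S)
    (hl : ∀ {y}, y ∈ W.off (p + 2) → y ∈ W.off (p + 3) → ∀ x, Φ (y * x) = y * Φ x)
    (hr : ∀ {y}, y ∈ W.off (p + 2) → y ∈ W.off (p + 3) → ∀ x, Φ (x * y) = Φ x * y)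
    (h0 : Φ (W.two (p + 1) R * W.two p R * W.two (p + 2) R * W.two (p + 1) R) = 0) (x : S) :
    Φ x = 0 := by
  set s := W.two (p + 1) R with hs
  set w := W.two (p + 2) R with hw
  have h1 (a b : Fin N) : Φ (s * W.e (p + 1) a b * w * s) = 0 := by
    have hc {c d} : Commute (W.e p c d) s := mem_off.1 (two_off (by omega) (by omega) _) _ _
    have hd {c d} : Commute (W.e p c d) w := mem_off.1 (two_off (by omega) (by omega) _) _ _
    refine map_e_eq_zero h (Φ ∘ₗ LinearMap.mulRight ℂ s ∘ₗ LinearMap.mulRight ℂ w ∘ₗ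
      LinearMap.mulLeft ℂ s) (fun c d x => ?_) (fun c d x => ?_) h0 a b
    · change Φ (s * (W.e p c d * x) * w * s) = W.e p c d * Φ (s * x * w * s)
      rw [← hl (e_off (by omega) _ _) (e_off (by omega) _ _), ← mul_assoc, ← hc.eq]
      simp only [mul_assoc]
    · change Φ (s * (x * W.e p c d) * w * s) = Φ (s * x * w * s) * W.e p c d
      rw [← hr (e_off (by omega) _ _) (e_off (by omega) _ _), mul_assoc _ s, ← hc.eq,
        ← mul_assoc (s * x * w), mul_assoc _ w (W.e p c d), ← hd.eq]
      simp only [mul_assoc]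
  have h2 (c m c' m' : Fin N) : Φ (W.coef (p + 1) c m s * w * W.coef (p + 1) c' m' s) = 0 := by
    have hc {c d} : Commute (W.e (p + 1) c d) w := mem_off.1 (two_off (by omega) (by omega) _) _ _
    have : W.coef (p + 1) c m s * w * W.coef (p + 1) c' m' s =
        ∑ k, W.e (p + 1) k c * (s * W.e (p + 1) m c' * w * s) * W.e (p + 1) m' k := by
      rw [coef_apply, coef_apply, Finset.sum_mul, Finset.sum_mul]
      refine Finset.sum_congr rfl fun k _ => ?_
      rw [Finset.mul_sum, Finset.sum_eq_single k]
      · calc _ = W.e (p + 1) k c * s * (W.e (p + 1) m k * w) * W.e (p + 1) k c' *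
              s * W.e (p + 1) m' k := by simp only [mul_assoc]
          _ = W.e (p + 1) k c * s * (w * (W.e (p + 1) m k * W.e (p + 1) k c')) *
              s * W.e (p + 1) m' k := by rw [hc.eq]; simp only [mul_assoc]
          _ = _ := by rw [W.e_mul, if_pos rfl, ← hc.eq]; simp only [mul_assoc]
      · intro j _ hj
        calc _ = W.e (p + 1) k c * s * (W.e (p + 1) m k * w) * W.e (p + 1) j c' *
              s * W.e (p + 1) m' j := by simp only [mul_assoc]
          _ = W.e (p + 1) k c * s * (w * (W.e (p + 1) m k * W.e (p + 1) j c')) *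
              s * W.e (p + 1) m' j := by rw [hc.eq]; simp only [mul_assoc]
          _ = _ := by rw [W.e_mul, if_neg hj.symm]; simp
      · simp
    simp only [this, map_sum, hr (e_off (show p + 2 ≠ p + 1 by omega) _ _) (e_off (by omega) _ _),
      hl (e_off (show p + 2 ≠ p + 1 by omega) _ _) (e_off (by omega) _ _), h1, mul_zero, zero_mul,
      Finset.sum_const_zero]
  have h3 (a b c d : Fin N) : Φ (W.e (p + 2) a b * w * W.e (p + 2) c d) = 0 := by
    simp only [e_eq_sum_coef h (p + 1), Finset.sum_mul, Finset.mul_sum, map_sum, smul_mul_assoc,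
      mul_smul_comm, map_smul, ← hs, h2, smul_zero, Finset.sum_const_zero]
  have h4 (a b c d : Fin N) : Φ (W.e (p + 2) a b * W.e (p + 3) c d) = 0 := by
    have h5 (k c m : Fin N) :
        Φ (W.e (p + 2) a b * (W.e (p + 2) k c * (w * W.e (p + 2) m k))) = 0 := by
      rw [← mul_assoc, W.e_mul]
      split_ifs
      · rw [← mul_assoc, h3]
      · simp
    simp only [e_eq_sum_coef h (p + 2), ← hw, coef_apply, Finset.mul_sum, map_sum, mul_smul_comm,
      map_smul, h5, smul_zero, Finset.sum_const_zero]
  rw [← W.sum_coef (p + 3) x]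
  simp only [map_sum]
  refine Finset.sum_eq_zero fun a _ => Finset.sum_eq_zero fun b _ => ?_
  rw [← W.sum_coef (p + 2) (W.coef (p + 3) a b x)]
  simp only [map_sum, Finset.sum_mul, mul_assoc,
    hl (coef_mem_off _ _ _) (coef_off (coef_mem_off _ _ _) _ _), h4, mul_zero,
    Finset.sum_const_zero]

end Strands

end

section

namespace Strands
variable {N : ℕ} {A S : Type*} [Ring A] [Algebra ℂ A] [Ring S] [Algebra ℂ S] {W : Strands N A S}
  {p t n : ℕ} {x y : S} {D : Matrix (Fin N) (Fin N) ℂ} {q μ : ℂ} {R F Ψ X : MatV N 2 ℂ}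

section
variable [NeZero N]

theorem scal_three_lift2_zero (p : ℕ) (X : MatV N 2 ℂ) : W.scal p 3 (lift2 0 X) = W.two p X :=
  scal_lift2 X 0 (by omega)

theorem scal_three_lift2_one (p : ℕ) (X : MatV N 2 ℂ) :
    W.scal p 3 (lift2 1 X) = W.two (p + 1) X :=
  scal_lift2 X 1 (by omega)

theorem two_braid (h : IsBraid R) (p : ℕ) : W.two p R * W.two (p + 1) R * W.two p R =
    W.two (p + 1) R * W.two p R * W.two (p + 1) R := by
  simpa only [map_mul, scal_three_lift2_zero, scal_three_lift2_one] using congrArg (W.scal p 3) h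

theorem two_twist (h : Compatible R F) (p : ℕ) : W.two p R * W.two (p + 1) F * W.two p F =
    W.two (p + 1) F * W.two p F * W.two (p + 1) R := by
  simpa only [map_mul, scal_three_lift2_zero, scal_three_lift2_one] using congrArg (W.scal p 3) h.1

theorem two_twist' (h : Compatible R F) (p : ℕ) : W.two (p + 1) R * W.two p F * W.two (p + 1) F =
    W.two p F * W.two (p + 1) F * W.two p R := by
  simpa only [map_mul, scal_three_lift2_zero, scal_three_lift2_one] using congrArg (W.scal p 3) h.2

variable (W q μ R) in
/-- The relations of the Birman–Murakami–Wenzl algebra on the strands `p, p + 1, p + 2`. -/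
abbrev BMWAt (p : ℕ) : Prop :=
  BMWPair q μ (W.two p R) (W.two (p + 1) R) (W.two p R⁻¹) (W.two (p + 1) R⁻¹)
    (W.two p (bmwK q μ R)) (W.two (p + 1) (bmwK q μ R))

theorem bmwAt (hq : q ≠ 0) (hl : q - q⁻¹ ≠ 0) (hμ : μ ≠ 0) (hdet : IsUnit R.det)
    (hb : IsBraid R) (h : IsBMW q μ R) (p : ℕ) : W.BMWAt q μ R p := by
  have hk (p : ℕ) : W.two p (bmwK q μ R) = (μ⁻¹ * (q - q⁻¹)⁻¹) •
      ((q • (1 : S) - W.two p R) * (q⁻¹ • (1 : S) + W.two p R)) := by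
    simp only [bmwK, map_smul, map_mul, map_sub, map_add, map_one]
  have hc (p : ℕ) : (q • (1 : S) - W.two p R) * (q⁻¹ • (1 : S) + W.two p R) *
      (μ • (1 : S) - W.two p R) = 0 := by
    simpa only [map_smul, map_mul, map_sub, map_add, map_one, map_zero] using
      congrArg (W.two p) h.1
  obtain ⟨-, h1, h2, h3⟩ := h
  have h1' := congrArg (W.scal p 3) h1
  have h2' := congrArg (W.scal p 3) h2
  have h3' := congrArg (W.scal p 3) h3
  simp only [map_mul, scal_three_lift2_zero, scal_three_lift2_one] at h1' h2' h3'
  exact BMWPair.of_relations hq hl hμ (two_mul_inv hdet _) (two_inv_mul hdet _)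
    (two_mul_inv hdet _) (two_inv_mul hdet _) (hk _) (hk _) (hc _) (hc _) (two_braid hb p)
    h1' h2' h3'

end

theorem two_commute_far (X Y : MatV N 2 ℂ) (h : p + 2 ≤ t) : Commute (W.two p X) (W.two t Y) :=
  two_comm (two_off (by omega) (by omega) _) (two_off (by omega) (by omega) _) X

theorem E_E_mul_left (h2 : y ∈ W.off p) (h3 : y ∈ W.off t) (x : S) :
    W.E D p (W.E D t (y * x)) = y * W.E D p (W.E D t x) := by
  rw [E_mul_left h3, E_mul_left h2]

theorem E_E_mul_right (h2 : y ∈ W.off p) (h3 : y ∈ W.off t) (x : S) :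
    W.E D p (W.E D t (x * y)) = W.E D p (W.E D t x) * y := by
  rw [E_mul_right h3, E_mul_right h2]

variable (hB : ∀ p, BMWPair q μ (W.two p R) (W.two (p + 1) R) (W.two p R⁻¹) (W.two (p + 1) R⁻¹)
    (W.two p (bmwK q μ R)) (W.two (p + 1) (bmwK q μ R)))
include hB

variable (W R) in
/-- The double crossing of the strands `p, p + 1` with the strands `p + 2, p + 3`. -/
def cross (p : ℕ) : S := W.two (p + 1) R * W.two p R * W.two (p + 2) R * W.two (p + 1) R

theorem mul_cross (p : ℕ) : W.two (p + 2) R * W.cross R p = W.cross R p * W.two p R := by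
  have h1 := (hB p).braid
  have h2 := (hB (p + 1)).braid
  have h3 : Commute (W.two p R) (W.two (p + 2) R) := two_commute_far R R le_rfl
  calc _ = W.two (p + 2) R * W.two (p + 1) R * (W.two p R * W.two (p + 2) R) * W.two (p + 1) R := by
        rw [cross]; simp only [mul_assoc]
    _ = (W.two (p + 2) R * W.two (p + 1) R * W.two (p + 2) R) * W.two p R * W.two (p + 1) R := by
        rw [h3.eq]; simp only [mul_assoc]
    _ = W.two (p + 1) R * W.two (p + 2) R * (W.two (p + 1) R * W.two p R * W.two (p + 1) R) := by
        rw [← h2]; simp only [mul_assoc]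
    _ = W.two (p + 1) R * (W.two (p + 2) R * W.two p R) * W.two (p + 1) R * W.two p R := by
        rw [← h1]; simp only [mul_assoc]
    _ = _ := by rw [← h3.eq, cross]; simp only [mul_assoc]

theorem cross_mul (p : ℕ) : W.cross R p * W.two (p + 2) R = W.two p R * W.cross R p := by
  have h1 := (hB p).braid
  have h2 := (hB (p + 1)).braid
  have h3 : Commute (W.two p R) (W.two (p + 2) R) := two_commute_far R R le_rfl
  calc _ = W.two (p + 1) R * W.two p R * (W.two (p + 2) R * W.two (p + 1) R * W.two (p + 2) R) := by
        rw [cross]; simp only [mul_assoc]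
    _ = W.two (p + 1) R * W.two p R * W.two (p + 1) R * (W.two (p + 2) R * W.two (p + 1) R) := by
        rw [← h2]; simp only [mul_assoc]
    _ = _ := by rw [← h1, cross]; simp only [mul_assoc]

theorem E_E_cross (h : SkewPair R Ψ) (p : ℕ) :
    W.E (Dof Ψ) (p + 2) (W.E (Dof Ψ) (p + 3) (W.cross R p)) = W.two p R * W.two p R := by
  rw [cross, E_mul_right (two_off (by omega) (by omega) _),
    E_mul_left (mul_mem (two_off (by omega) (by omega) _) (two_off (by omega) (by omega) _)),
    E_skew h, mul_one, ← (hB p).braid, E_mul_right (two_off (by omega) (by omega) _),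
    E_mul_left (two_off (by omega) (by omega) _), E_skew h, mul_one]

theorem E_E_cyclic (h : SkewPair R Ψ) (p : ℕ) (y : S) :
    W.E (Dof Ψ) (p + 2) (W.E (Dof Ψ) (p + 3) (W.two (p + 2) R * y)) =
      W.E (Dof Ψ) (p + 2) (W.E (Dof Ψ) (p + 3) (y * W.two (p + 2) R)) := by
  set w := W.two (p + 2) R with hw
  set w' := W.two (p + 2) R⁻¹ with hw'
  let EE : S →ₗ[ℂ] S := W.E (Dof Ψ) (p + 2) ∘ₗ W.E (Dof Ψ) (p + 3)
  let Φ : S →ₗ[ℂ] S := EE ∘ₗ LinearMap.mulRight ℂ w' ∘ₗ LinearMap.mulLeft ℂ w - EE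
  have hΦ (x : S) : Φ x = EE (w * x * w') - EE x := rfl
  have hw1 : w * w' = 1 := (hB (p + 1)).s_mul_inv
  have hw2 : w' * w = 1 := (hB (p + 1)).inv_mul_s
  have key : Φ (y * w) = 0 := by
    refine map_eq_zero (W := W) (p := p) h Φ (fun {c} h1 h2 x => ?_) (fun {c} h1 h2 x => ?_) ?_ _
    · have hc : Commute w c := two_comm h1 h2 R
      rw [hΦ, hΦ, ← mul_assoc, hc.eq, mul_sub]
      congr 1
      · rw [mul_assoc c, mul_assoc c]; exact E_E_mul_left h1 h2 _
      · exact E_E_mul_left h1 h2 _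
    · have hc : Commute w' c := two_comm h1 h2 R⁻¹
      rw [hΦ, hΦ, sub_mul]
      congr 1
      · rw [← mul_assoc, mul_assoc _ c, ← hc.eq, ← mul_assoc]; exact E_E_mul_right h1 h2 _
      · exact E_E_mul_right h1 h2 _
    · change Φ (W.cross R p) = 0
      have e : w * W.cross R p * w' = W.two p R⁻¹ * W.cross R p * W.two p R := by
        have h1 : W.cross R p * w' = W.two p R⁻¹ * W.cross R p := by
          calc _ = W.two p R⁻¹ * (W.two p R * W.cross R p) * w' := by
                rw [← mul_assoc (W.two p R⁻¹), (hB p).inv_mul_r, one_mul]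
            _ = _ := by rw [← cross_mul hB, mul_assoc, mul_assoc, hw1, mul_one]
        have h2 : Commute (W.two p R) w' := two_commute_far R R⁻¹ le_rfl
        rw [mul_cross hB, mul_assoc, h2.eq, ← mul_assoc, h1]
      rw [hΦ, e, sub_eq_zero]
      change W.E _ _ (W.E _ _ _) = W.E _ _ (W.E _ _ _)
      rw [E_E_mul_right (two_off (by omega) (by omega) _) (two_off (by omega) (by omega) _),
        E_E_mul_left (two_off (by omega) (by omega) _) (two_off (by omega) (by omega) _),
        E_E_cross hB h, ← mul_assoc, (hB p).inv_mul_r, one_mul]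
  rw [hΦ, sub_eq_zero, mul_assoc, mul_assoc, hw1, mul_one] at key
  exact key

theorem two_sandwich (h : SkewPair R Ψ) (hμ : μ ≠ 0) (p : ℕ) (y : S) :
    W.two (p + 2) (bmwK q μ R) * y * W.two (p + 2) (bmwK q μ R) = (μ⁻¹ * μ⁻¹) •
      (W.E (Dof Ψ) (p + 2) (W.E (Dof Ψ) (p + 3) (y * W.two (p + 2) (bmwK q μ R))) *
        W.two (p + 2) (bmwK q μ R)) := by
  set w := W.two (p + 2) (bmwK q μ R) with hw
  let EE : S →ₗ[ℂ] S := W.E (Dof Ψ) (p + 2) ∘ₗ W.E (Dof Ψ) (p + 3)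
  let Φ : S →ₗ[ℂ] S := LinearMap.mulRight ℂ w ∘ₗ LinearMap.mulLeft ℂ w -
    (μ⁻¹ * μ⁻¹) • LinearMap.mulRight ℂ w ∘ₗ EE ∘ₗ LinearMap.mulRight ℂ w
  have hΦ (x : S) : Φ x = w * x * w - (μ⁻¹ * μ⁻¹) • (EE (x * w) * w) := rfl
  have key : Φ y = 0 := by
    refine map_eq_zero (W := W) (p := p) h Φ (fun {c} h1 h2 x => ?_) (fun {c} h1 h2 x => ?_) ?_ _
    · have hc : Commute w c := two_comm h1 h2 _
      have e : EE (c * x * w) = c * EE (x * w) := by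
        rw [mul_assoc]; exact E_E_mul_left h1 h2 _
      rw [hΦ, hΦ, ← mul_assoc, hc.eq, mul_sub, e, mul_smul_comm]
      simp only [mul_assoc]
    · have hc : Commute w c := two_comm h1 h2 _
      have e : EE (x * c * w) = EE (x * w) * c := by
        rw [mul_assoc, ← hc.eq, ← mul_assoc]; exact E_E_mul_right h1 h2 _
      rw [hΦ, hΦ, sub_mul, e, smul_mul_assoc, mul_assoc _ c, ← hc.eq, ← mul_assoc w x c,
        mul_assoc _ c, ← hc.eq]
      simp only [mul_assoc]
    · change Φ (W.cross R p) = 0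
      have h1 : w * W.cross R p = W.cross R p * W.two p (bmwK q μ R) := by
        exact (comm_poly (hB p).k_eq (hB (p + 1)).l_eq (mul_cross hB p).symm).symm
      have h2 : W.cross R p * w = W.two p (bmwK q μ R) * W.cross R p := by
        exact comm_poly (hB (p + 1)).l_eq (hB p).k_eq (cross_mul hB p)
      have h3 : w * W.cross R p * w = W.two p (bmwK q μ R) * w := by
        have hc : Commute (W.two p (bmwK q μ R)) w := two_commute_far _ _ le_rfl
        rw [h1, mul_assoc, hc.eq, ← mul_assoc, cross]
        calc _ = W.two (p + 1) R * W.two p R * (W.two (p + 2) R * W.two (p + 1) R * w) *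
              W.two p (bmwK q μ R) := by simp only [mul_assoc]
          _ = W.two (p + 1) R * W.two p R * W.two (p + 1) (bmwK q μ R) * w *
              W.two p (bmwK q μ R) := by rw [(hB (p + 1)).srl]; simp only [mul_assoc]; rfl
          _ = W.two p (bmwK q μ R) * W.two (p + 1) (bmwK q μ R) * (w *
              W.two p (bmwK q μ R)) := by rw [(hB p).srl]; simp only [mul_assoc]
          _ = _ := by rw [← hc.eq, ← mul_assoc, (hB p).klk]
      have h4 : EE (W.cross R p * w) = (μ * μ) • W.two p (bmwK q μ R) := by
        rw [h2]
        change W.E _ _ (W.E _ _ _) = _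
        rw [E_E_mul_left (two_off (by omega) (by omega) _) (two_off (by omega) (by omega) _),
          E_E_cross hB h, ← mul_assoc, (hB p).kr, smul_mul_assoc, (hB p).kr, smul_smul]
      rw [hΦ, h3, h4, smul_mul_assoc, smul_smul]
      have : μ⁻¹ * μ⁻¹ * (μ * μ) = 1 := by field_simp
      rw [this, one_smul, sub_self]
  exact sub_eq_zero.1 key

theorem two_contraction_cases (h : SkewPair R Ψ) :
    (∀ p, W.two p (bmwK q μ R) = 0) ∨
      ∀ p, W.E (Dof Ψ) (p + 1) (W.two p (bmwK q μ R)) = μ • (1 : S) := by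
  let Y : Matrix (Fin N) (Fin N) ℂ := fun a b =>
    (∑ m, ∑ c, bmwK q μ R ![a, c] ![b, m] * Dof Ψ m c)
  let Z : Matrix (Fin N) (Fin N) A := cmap (Y - μ • 1)
  have hY (p : ℕ) : W.one p Z = W.E (Dof Ψ) (p + 1) (W.two p (bmwK q μ R)) - μ • (1 : S) := by
    have hZ (a b : Fin N) : W.α (Z a b) * W.e p a b = Y a b • W.e p a b -
        (if a = b then μ • W.e p a b else 0) := by
      change W.α (algebraMap ℂ A ((Y - μ • 1) a b)) * _ = _
      rw [AlgHom.commutes, ← Algebra.smul_def, Matrix.sub_apply, Matrix.smul_apply,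
        Matrix.one_apply, sub_smul]
      split_ifs <;> simp
    rw [E_two, ← W.e_one p, one_apply]
    simp only [hZ, Finset.sum_sub_distrib, Finset.smul_sum, Finset.sum_ite_eq, Finset.mem_univ,
      if_true, Y]
  have h1 (p : ℕ) : W.two p (bmwK q μ R) * W.one (p + 1) Z = 0 := by
    rw [hY, mul_sub, ← E_mul_left (two_off (by omega) (by omega) _), ← (hB p).ksr,
      E_mul_right (two_off (by omega) (by omega) _),
      E_mul_left (two_off (by omega) (by omega) _), E_skew h, mul_one, (hB p).kr, mul_smul_comm,
      mul_one, sub_self]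
  have h2 (p : ℕ) : W.two p (bmwK q μ R) * W.one (p + 2) Z = 0 := by
    have hc : Commute (W.two p (bmwK q μ R)) (W.one (p + 2) Z) :=
      two_comm (one_off (by omega) _) (one_off (by omega) _) _
    rw [← (hB p).klk, mul_assoc, hc.eq, ← mul_assoc, mul_assoc _ _ (W.one _ _), h1, mul_zero,
      zero_mul]
  have h3 (p : ℕ) (a b : Fin N) : (Y - μ • 1) a b • W.two p (bmwK q μ R) = 0 := by
    have := congrArg (W.coef (p + 2) a b) (h2 p)
    rw [coef_mul_left (two_off (by omega) (by omega) _), coef_one, map_zero] at this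
    change _ * W.α (algebraMap ℂ A ((Y - μ • 1) a b)) = 0 at this
    rwa [AlgHom.commutes, ← Algebra.commutes, ← Algebra.smul_def] at this
  by_cases hZ : Y - μ • 1 = 0
  · right
    intro p
    rw [← sub_eq_zero, ← hY]
    simp [one_apply, Z, hZ, cmap]
  · left
    intro p
    by_contra hp
    exact hZ (by ext a b; exact (smul_eq_zero.1 (h3 p a b)).resolve_right hp)

end Strands

end

section

/-- The standing assumptions on a compatible pair. -/
structure PairData {N : ℕ} [NeZero N] (q μ : ℂ) (R F Ψ : MatV N 2 ℂ) : Prop where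
  q_ne : q ≠ 0
  lam_ne : q - q⁻¹ ≠ 0
  mu_ne : μ ≠ 0
  R_det : IsUnit R.det
  R_braid : IsBraid R
  R_bmw : IsBMW q μ R
  skew : SkewPair R Ψ
  F_det : IsUnit F.det
  F_braid : IsBraid F
  compatible : Compatible R F

namespace Strands

/-- Strand operators on functions of infinitely many indices with values in `A`. -/
def standard (N : ℕ) (A : Type*) [Ring A] [Algebra ℂ A] :
    Strands N A (Module.End ℂ ((ℕ → Fin N) → A)) where
  e p a b :=
    { toFun := fun f s => if s p = a then f (Function.update s p b) else 0
      map_add' := fun f g => by ext s; simp only [Pi.add_apply]; split_ifs <;> simp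
      map_smul' := fun c f => by ext s; simp }
  α := Algebra.lsmul ℂ ℂ ((ℕ → Fin N) → A)
  e_mul p a b c d := by
    ext f s
    by_cases h : b = c
    · subst h; simp
    · by_cases h' : s p = a <;> simp [h]
  e_one p := by
    ext f s
    simp [LinearMap.sum_apply]
  e_comm := by
    intro p t h a b c d
    ext f s
    simp only [Module.End.mul_apply, LinearMap.coe_mk, AddHom.coe_mk,
      Function.update_of_ne h, Function.update_of_ne h.symm, Function.update_comm h]
    split_ifs <;> rfl
  α_comm x p a b := by
    ext f s
    simp

theorem standard_α_injective (N : ℕ) [NeZero N] (A : Type*) [Ring A] [Algebra ℂ A] :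
    Function.Injective (standard N A).α := by
  intro x y h
  have := congrFun (LinearMap.congr_fun h fun _ => 1) fun _ => 0
  simpa [standard] using this

variable {N : ℕ} [NeZero N] {A S : Type*} [Ring A] [Algebra ℂ A] [Ring S] [Algebra ℂ S] (W : Strands N A S)

/-- The tower of the strands `2, 3, …` attached to a compatible pair. -/
def tower {q μ : ℂ} {R F Ψ : MatV N 2 ℂ} (h : PairData q μ R F Ψ) : Tower q μ S where
  off p := W.off (p + 2)
  r p := W.two (p + 2) R
  r' p := W.two (p + 2) R⁻¹
  f p := W.two (p + 2) F
  f' p := W.two (p + 2) F⁻¹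
  k p := W.two (p + 2) (bmwK q μ R)
  E p := W.E (Dof Ψ) (p + 2)
  r_off h1 h2 := two_off (by omega) (by omega) _
  r'_off h1 h2 := two_off (by omega) (by omega) _
  f_off h1 h2 := two_off (by omega) (by omega) _
  f'_off h1 h2 := two_off (by omega) (by omega) _
  r_comm h1 h2 := two_comm h1 h2 _
  f_comm h1 h2 := two_comm h1 h2 _
  E_off_self _ x := E_mem_off x
  E_off hx := E_off hx
  E_mul_left x hy := E_mul_left hy x
  E_mul_right x hy := E_mul_right hy x
  bmw p := bmwAt h.q_ne h.lam_ne h.mu_ne h.R_det h.R_braid h.R_bmw (p + 2)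
  f_mul_inv p := two_mul_inv h.F_det (p + 2)
  inv_mul_f p := two_inv_mul h.F_det (p + 2)
  f_braid p := two_braid h.F_braid (p + 2)
  twist p := two_twist h.compatible (p + 2)
  twist' p := two_twist' h.compatible (p + 2)
  E_r p := E_skew h.skew (p + 2)
  E_cyclic p y := E_E_cyclic (bmwAt h.q_ne h.lam_ne h.mu_ne h.R_det h.R_braid h.R_bmw) h.skew p y
  E_conj_r {p x} hx := E_conj (p := p + 1) h.skew h.R_det (two_braid h.R_braid (p + 1)).symm hx
  E_conj_f {p x} hx := E_conj (p := p + 1) h.skew h.F_det (two_twist' h.compatible (p + 1)) hx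
  k_sandwich p y := two_sandwich (bmwAt h.q_ne h.lam_ne h.mu_ne h.R_det h.R_braid h.R_bmw) h.skew h.mu_ne p y
  k_or := by
    rcases two_contraction_cases (bmwAt (W := W) h.q_ne h.lam_ne h.mu_ne h.R_det h.R_braid h.R_bmw) h.skew with hk | hk
    · exact .inl fun p => hk (p + 2)
    · exact .inr fun p => hk (p + 2)

end Strands

theorem Generic.of_ne {q μ : ℂ} {n : ℕ} (hq0 : q ≠ 0) (hq1 : q ≠ 1) (hqm : q ≠ -1)
    (hμ0 : μ ≠ 0) (hμq : μ ≠ q) (hμq' : μ ≠ -q⁻¹)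
    (hiq : ∀ i : ℕ, 2 ≤ i → i ≤ n → nq q i ≠ 0)
    (hμi : ∀ i : ℕ, 1 ≤ i → i ≤ n - 1 → μ ≠ -q ^ (1 - 2 * (i : ℤ))) : Generic q μ n where
  q_ne := hq0
  lam_ne h := by
    have h2 : q * q = 1 := by
      rw [sub_eq_zero] at h; nth_rewrite 2 [h]; exact mul_inv_cancel₀ hq0
    rcases mul_self_eq_one_iff.1 h2 with h | h
    · exact hq1 h
    · exact hqm h
  mu_ne := hμ0
  mu_ne_q := sub_ne_zero.2 hμq.symm
  mu_ne_q' h := hμq' (eq_neg_of_add_eq_zero_right h)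
  nq_ne := hiq
  den_ne i h1 h2 h := by
    refine hμi i h1 (by omega) ?_
    rw [sub_eq_add_neg, zpow_add₀ hq0, zpow_one]
    exact eq_neg_of_add_eq_zero_left h

end

section

namespace Strands
variable {N : ℕ} [NeZero N] {A S : Type*} [Ring A] [Algebra ℂ A] [Ring S] [Algebra ℂ S]
  {W : Strands N A S} {q μ : ℂ} {R F Ψ : MatV N 2 ℂ} {n : ℕ}

theorem emb_Mcopy (h : PairData q μ R F Ψ) (M : Matrix (Fin N) (Fin N) A) {j : ℕ} (hj : j < n) :
    W.emb 2 n (Mcopy F M j) = (W.tower h).bar (W.one 2 M) j := by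
  induction j with
  | zero =>
    obtain ⟨n, rfl⟩ : ∃ m, n = m + 1 := ⟨n - 1, by omega⟩
    exact emb_lift1 M
  | succ j ih =>
    rw [Mcopy, map_mul, map_mul, emb_lift2 _ _ (by omega), emb_lift2 _ _ (by omega),
      ih (by omega), add_comm 2 j]
    rfl

theorem emb_Mprod (h : PairData q μ R F Ψ) (M : Matrix (Fin N) (Fin N) A) {j : ℕ} (hj : j ≤ n) :
    W.emb 2 n (Mprod F M j) = wordUp ((W.tower h).bar (W.one 2 M)) 0 j := by
  induction j with
  | zero => exact map_one _
  | succ j ih => rw [Mprod, map_mul, ih (by omega), emb_Mcopy h M (by omega), wordUp, zero_add]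

theorem scal_asym (h : PairData q μ R F Ψ) :
    (n : ℕ) → W.scal 2 n (asym q μ R n) = (W.tower h).As 0 n
  | 0 => map_one _
  | 1 => map_one _
  | n + 2 => by
    have e : q ^ (1 - 2 * ((n : ℤ) + 1)) = q * q ^ (-(2 * ((n : ℤ) + 1))) := by
      rw [sub_eq_add_neg, zpow_add₀ h.q_ne, zpow_one]
    rw [asym, map_smul, map_mul, map_mul, scal_ext1, scal_asym h (n + 1), map_add, map_add,
      map_smul, map_smul, map_one, scal_lift2 _ _ le_rfl, scal_lift2 _ _ le_rfl, Tower.As,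
      Tower.sig, baxt, zero_add, e, add_comm 2 n]
    push_cast
    rfl

theorem one_toN_trTail (h : PairData q μ R F Ψ) {j : ℕ} (X : MatV N (j + 1) A) :
    W.one 2 (toN (trTail (cmap (Dof Ψ)) j X)) = (W.tower h).Et 1 j (W.emb 2 (j + 1) X) := by
  induction j with
  | zero => exact (emb_one X).symm
  | succ j ih =>
    rw [trTail, ih, emb_ptrace, Tower.Et_succ, show 2 + (j + 1) = 1 + j + 2 by omega]
    rfl

theorem α_trAll (h : PairData q μ R F Ψ) (X : MatV N n A) :
    W.α (trAll (cmap (Dof Ψ)) n X) = (W.tower h).Et 0 n (W.emb 2 n X) := by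
  induction n with
  | zero =>
    rw [emb_apply, Tower.Et_zero, Finset.univ_unique, Finset.sum_singleton, Finset.sum_singleton,
      u, mul_one, trAll]
    congr
  | succ n ih =>
    rw [trAll, ih, emb_ptrace, Tower.Et_succ, zero_add, add_comm 2 n]
    rfl

theorem one_phi (h : PairData q μ R F Ψ) (X : Matrix (Fin N) (Fin N) A) :
    W.one 2 (phi R F Ψ X) = (W.tower h).phiT (W.one 2 X) := by
  rw [phi, ← emb_one, emb_ptrace, map_mul (W.emb 2 _), map_mul (W.emb 2 _),
    map_mul (W.emb 2 _), emb_lift1,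
    emb_lift2 _ _ le_rfl, emb_lift2 _ _ le_rfl, emb_lift2 _ _ le_rfl]
  rfl

theorem one_xi (h : PairData q μ R F Ψ) (X : Matrix (Fin N) (Fin N) A) :
    W.one 2 (xi q μ R F Ψ X) = (W.tower h).xiT (W.one 2 X) := by
  rw [xi, ← emb_one, emb_ptrace, map_mul (W.emb 2 _), map_mul (W.emb 2 _),
    map_mul (W.emb 2 _), emb_lift1,
    emb_lift2 _ _ le_rfl, emb_lift2 _ _ le_rfl, emb_lift2 _ _ le_rfl]
  rfl

theorem one_Lmap_iterate (h : PairData q μ R F Ψ) (M X : Matrix (Fin N) (Fin N) A) (m : ℕ) :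
    W.one 2 ((Lmap R F Ψ M)^[m] X) = ((W.tower h).LT (W.one 2 M) ^ m) (W.one 2 X) := by
  induction m with
  | zero => rfl
  | succ m ih =>
    rw [Function.iterate_succ_apply', Lmap, map_mul, one_phi h, ih, pow_succ',
      Module.End.mul_apply, Tower.LT_apply]

theorem one_starPow (h : PairData q μ R F Ψ) (M : Matrix (Fin N) (Fin N) A) (m : ℕ) :
    W.one 2 (starPow R F Ψ M m) = (W.tower h).Ps (W.one 2 M) m := by
  induction m with
  | zero => exact map_one _
  | succ m ih => rw [starPow, map_mul, one_phi h, ih, Tower.Ps, Tower.LT_apply]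

theorem emb_Mprod_asym (h : PairData q μ R F Ψ) (M : Matrix (Fin N) (Fin N) A) (n : ℕ) :
    W.emb 2 n (Mprod F M n * cmap (asym q μ R n)) =
      wordUp ((W.tower h).bar (W.one 2 M)) 0 n * (W.tower h).As 0 n := by
  rw [map_mul, emb_Mprod h M le_rfl, ← scal_eq_emb, scal_asym h]

theorem one_Mwedge (h : PairData q μ R F Ψ) (M : Matrix (Fin N) (Fin N) A) (l : ℕ) :
    W.one 2 (Mwedge q μ R F Ψ M (l + 1)) = (W.tower h).Wg (W.one 2 M) 0 l := by
  rw [Mwedge, one_toN_trTail h, emb_Mprod_asym h]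
  rfl

theorem α_aElt (h : PairData q μ R F Ψ) (M : Matrix (Fin N) (Fin N) A) (l : ℕ) :
    W.α (aElt q μ R F Ψ M l) = (W.tower h).aa (W.one 2 M) l := by
  cases l with
  | zero => exact map_one _
  | succ l =>
    rw [aElt, α_trAll h, emb_Mprod_asym h, Tower.Et_succ']
    rfl

theorem α_gElt (h : PairData q μ R F Ψ) (M : Matrix (Fin N) (Fin N) A) :
    W.α (gElt q μ R F Ψ M) = (W.tower h).gg (W.one 2 M) := by
  rw [gElt, map_smul, α_trAll h, map_mul, emb_Mprod h M le_rfl, emb_lift2 _ _ le_rfl,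
    Tower.Et_succ', wordUp, wordUp, wordUp, one_mul]
  rfl

theorem tower_QM (h : PairData q μ R F Ψ) {M : Matrix (Fin N) (Fin N) A} (hM : QMArel R F M) :
    (W.tower h).QM (W.one 2 M) where
  loc t ht := one_off (by omega) M
  rel := by
    have := congrArg (W.emb 2 2) hM
    simp only [map_mul, emb_Mcopy h M (show 0 < 2 by omega), emb_Mcopy h M (show 1 < 2 by omega),
      emb_lift2 R 0 le_rfl, mul_assoc] at this
    rw [Commute, SemiconjBy, mul_assoc]
    exact this

theorem one_inner (h : PairData q μ R F Ψ) (M : Matrix (Fin N) (Fin N) A) (m d : ℕ) :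
    W.one 2 (∑ r ∈ Finset.Icc 1 d,
        rmulE (starPow R F Ψ M (m - 2 * r)) ((q ^ 2 • gElt q μ R F Ψ M) ^ r)) =
      innerSum q ((W.tower h).Ps (W.one 2 M)) ((W.tower h).gg (W.one 2 M)) m d := by
  simp only [map_sum, one_rmulE, one_starPow h, map_pow, map_smul, α_gElt h, innerSum]

end Strands

end

section

namespace Strands
variable {N : ℕ} [NeZero N] {A S : Type*} [Ring A] [Algebra ℂ A] [Ring S] [Algebra ℂ S]
  {W : Strands N A S} {q μ : ℂ} {R F Ψ : MatV N 2 ℂ} {n : ℕ}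

theorem one_Ad (h : PairData q μ R F Ψ) (M : Matrix (Fin N) (Fin N) A) (m l : ℕ) :
    W.one 2 (Ad q μ R F Ψ M m (l + 1)) = (W.tower h).dA (W.one 2 M) m l := by
  rw [Ad, map_smul, one_Lmap_iterate h, one_Mwedge h, Tower.dA]

theorem one_Bd (h : PairData q μ R F Ψ) (ΨF ΨFinv ΨRinv : MatV N 2 ℂ)
    (M : Matrix (Fin N) (Fin N) A) (m l : ℕ) :
    W.one 2 (Bd q μ R F Ψ ΨF ΨFinv ΨRinv M (m + 1) (l + 1)) =
      (W.tower h).dB (W.one 2 M) m l := by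
  rw [Bd, map_smul, one_Lmap_iterate h, map_mul, one_xi h, one_Mwedge h, Tower.dB]

end Strands

variable {N : ℕ} [NeZero N] {A : Type*} [Ring A] [Algebra ℂ A]
  {q μ : ℂ} {R F Ψ : MatV N 2 ℂ} {n : ℕ} {M : Matrix (Fin N) (Fin N) A}

theorem Ad_expansion (h : PairData q μ R F Ψ) (hg : Generic q μ n) (hM : QMArel R F M)
    {i m : ℕ} (hi : 1 ≤ i) (hn : i ≤ n) (hm : i ≤ m + 2) :
    Ad q μ R F Ψ M m i = (-1 : ℂ) ^ (i - 1) • ∑ j ∈ Finset.range i, (-q) ^ j •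
      rmulE (starPow R F Ψ M (m + i - j) +
        ((1 - q ^ (-2 : ℤ)) / (1 + μ * q ^ (2 * (i : ℤ) - 3))) •
          ∑ r ∈ Finset.Icc 1 (i - j - 1), rmulE (starPow R F Ψ M (m + i - j - 2 * r))
            ((q ^ 2 • gElt q μ R F Ψ M) ^ r)) (aElt q μ R F Ψ M j) := by
  obtain ⟨l, rfl⟩ := Nat.exists_eq_add_of_le' hi
  apply Strands.one_injective (Strands.standard_α_injective N A) 2
  rw [Strands.one_Ad h, (Tower.dA_dB_expansion hg (Strands.tower_QM h hM) l hn m).1 (by omega)]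
  simp only [map_smul, map_sum, Strands.one_rmulE, map_add, Strands.one_inner h,
    Strands.one_starPow h, Strands.α_aElt h, Nat.add_sub_cancel, Nat.sub_right_comm _ _ 1, kap]

theorem Bd_expansion (h : PairData q μ R F Ψ) (hg : Generic q μ n) (hM : QMArel R F M)
    (ΨF ΨFinv ΨRinv : MatV N 2 ℂ) {i m : ℕ} (hi : 1 ≤ i) (hn : i ≤ n) (hm : i ≤ m) :
    Bd q μ R F Ψ ΨF ΨFinv ΨRinv M m i = (-1 : ℂ) ^ (i - 1) • ∑ j ∈ Finset.range i, (-q) ^ j •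
      rmulE ((μ⁻¹ * q ^ (-(2 * (j : ℤ)))) •
          rmulE (starPow R F Ψ M (m + j - i)) (gElt q μ R F Ψ M ^ (i - j)) -
        (q⁻¹ * (1 - q ^ (-2 : ℤ)) / (1 + μ * q ^ (2 * (i : ℤ) - 3))) •
          ∑ r ∈ Finset.Icc 1 (i - j - 1), rmulE (starPow R F Ψ M (m + i - j - 2 * r))
            ((q ^ 2 • gElt q μ R F Ψ M) ^ r)) (aElt q μ R F Ψ M j) := by
  obtain ⟨l, rfl⟩ := Nat.exists_eq_add_of_le' hi
  obtain ⟨m, rfl⟩ := Nat.exists_eq_add_of_le' (hi.trans hm)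
  apply Strands.one_injective (Strands.standard_α_injective N A) 2
  have e (j : ℕ) : m + 1 + j - (l + 1) = m + j - l := by omega
  have e' (j : ℕ) : m + 1 + (l + 1) - j = m + (l + 2) - j := by omega
  rw [Strands.one_Bd h, (Tower.dA_dB_expansion hg (Strands.tower_QM h hM) l hn m).2 (by omega)]
  simp only [map_smul, map_sum, Strands.one_rmulE, map_sub, Strands.one_inner h,
    Strands.one_starPow h, Strands.α_aElt h, Strands.α_gElt h, map_pow, Nat.add_sub_cancel,
    Nat.sub_right_comm _ _ 1, kap, e, e', mul_div_assoc]

end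

/-- **Cayley–Hamilton–Newton type expansions of the descendants**
(Proposition 4.2 of Ogievetsky–Pyatov).

For a compatible pair `{R,F}` with `F` strict skew invertible and `R` skew invertible of BMW
type, with antisymmetrizers defined for `1 ≤ i ≤ n`: for `1 ≤ i ≤ n` and `m ≥ i - 2`,
`A^{(m,i)} = (-1)^{i-1} ∑_{j=0}^{i-1} (-q)^j (M^{[m+i-j]} +
  ((1-q^{-2})/(1+μ q^{2i-3})) ∑_{r=1}^{i-j-1} M^{[m+i-j-2r]} (q² g)^r) a_j`,
and for `1 ≤ i ≤ n` and `m ≥ i`,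
`B^{(m,i)} = (-1)^{i-1} ∑_{j=0}^{i-1} (-q)^j (μ⁻¹ q^{-2j} M^{[m-i+j]} g^{i-j} -
  (q^{-1}(1-q^{-2})/(1+μ q^{2i-3})) ∑_{r=1}^{i-j-1} M^{[m+i-j-2r]} (q² g)^r) a_j`. -/
theorem cayley_hamilton_newton_expansions
    {N : ℕ} [NeZero N] (n : ℕ) (q μ : ℂ)
    (hq0 : q ≠ 0) (hq1 : q ≠ 1) (hqm1 : q ≠ -1)
    (hμ0 : μ ≠ 0) (hμq : μ ≠ q) (hμq' : μ ≠ -q⁻¹)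
    (hiq : ∀ i : ℕ, 2 ≤ i → i ≤ n → nq q i ≠ 0)
    (hμi : ∀ i : ℕ, 1 ≤ i → i ≤ n - 1 → μ ≠ -q ^ (1 - 2 * (i : ℤ)))
    (R F ΨR ΨF ΨFinv ΨRinv : MatV N 2 ℂ)
    (hRbraid : IsBraid R) (hRdet : IsUnit R.det)
    (hFbraid : IsBraid F) (hFdet : IsUnit F.det)
    (hcomp : Compatible R F)
    (hΨR : SkewPair R ΨR) (hΨF : SkewPair F ΨF)
    (hΨFinv : SkewPair F⁻¹ ΨFinv) (hΨRinv : SkewPair R⁻¹ ΨRinv)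
    (hRstrict : IsUnit (Dof ΨR).det) (hFstrict : IsUnit (Dof ΨF).det)
    (hRinvstrict : IsUnit (Dof ΨRinv).det)
    (hbmw : IsBMW q μ R)
    (A : Type*) [Ring A] [Algebra ℂ A]
    (M : Matrix (Fin N) (Fin N) A)
    (hM : QMArel R F M) :
    (∀ i m : ℕ, 1 ≤ i → i ≤ n → i ≤ m + 2 →
      Ad q μ R F ΨR M m i =
        (-1 : ℂ) ^ (i - 1) •
          ∑ j ∈ Finset.range i,
            (-q) ^ j •
              rmulE
                (starPow R F ΨR M (m + i - j) +
                  ((1 - q ^ (-2 : ℤ)) / (1 + μ * q ^ (2 * (i : ℤ) - 3))) •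
                    ∑ r ∈ Finset.Icc 1 (i - j - 1),
                      rmulE (starPow R F ΨR M (m + i - j - 2 * r))
                        ((q ^ 2 • gElt q μ R F ΨR M) ^ r))
                (aElt q μ R F ΨR M j)) ∧
    (∀ i m : ℕ, 1 ≤ i → i ≤ n → i ≤ m →
      Bd q μ R F ΨR ΨF ΨFinv ΨRinv M m i =
        (-1 : ℂ) ^ (i - 1) •
          ∑ j ∈ Finset.range i,
            (-q) ^ j •
              rmulE
                ((μ⁻¹ * q ^ (-(2 * (j : ℤ)))) •
                    rmulE (starPow R F ΨR M (m + j - i)) (gElt q μ R F ΨR M ^ (i - j)) -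
                  (q⁻¹ * (1 - q ^ (-2 : ℤ)) / (1 + μ * q ^ (2 * (i : ℤ) - 3))) •
                    ∑ r ∈ Finset.Icc 1 (i - j - 1),
                      rmulE (starPow R F ΨR M (m + i - j - 2 * r))
                        ((q ^ 2 • gElt q μ R F ΨR M) ^ r))
                (aElt q μ R F ΨR M j)) := by
  have hg : Generic q μ n := Generic.of_ne hq0 hq1 hqm1 hμ0 hμq hμq' hiq hμi
  have h : PairData q μ R F ΨR :=
    { q_ne := hq0, lam_ne := hg.lam_ne, mu_ne := hμ0, R_det := hRdet, R_braid := hRbraid,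
      R_bmw := hbmw, skew := hΨR, F_det := hFdet, F_braid := hFbraid, compatible := hcomp }
  exact ⟨fun _ _ hi hn hm => Ad_expansion h hg hM hi hn hm,
    fun _ _ hi hn hm => Bd_expansion h hg hM ΨF ΨFinv ΨRinv hi hn hm⟩

end QMA

end
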